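/- Let p ≥ 1, s₀ > 0, and let L ∈ C⁰([0,∞)) ∩ C²((0,s₀)) be positive and nondecreasing on (0,∞) with L(0) = 0, satisfying hypothesis (H) for s₀, and such that s·L''(s) ≥ −((3p+q₀−2)/(p+q₀))·L'(s) for all s ∈ (0,s₀), for some q₀ > 0. Assume u₀ ∈ C⁰(ℝⁿ) is positive, radially symmetric and nonincreasing with respect to |x|, satisfies u₀ < min{s₀^{2/p}, s₀^{2/(p+q₀)}} in ℝⁿ, and ∫_{ℝⁿ} L(u₀) < ∞. Then there exist t₀ > 0 and C > 0 such that the minimal solution u of the Cauchy problem (0) satisfies ‖u(·,t)‖_{L^∞(ℝⁿ)} ≤ C · t^{−1/p} · L(1/t)^{−2/(np)} for all t ≥ t₀. -/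

import Mathlib

open Real Set MeasureTheory Metric Filter

/-- The Laplacian of a function on `ℝⁿ`, written via iterated Fréchet derivatives
in the coordinate directions. -/
noncomputable def lap {n : ℕ} (f : EuclideanSpace ℝ (Fin n) → ℝ)
    (x : EuclideanSpace ℝ (Fin n)) : ℝ :=
  ∑ i : Fin n, fderiv ℝ (fun y => fderiv ℝ f y (EuclideanSpace.single i 1)) x
    (EuclideanSpace.single i 1)

/-- `u` is a positive classical solution of the Cauchy problem `u_t = u^p Δu`,
`u(·,0) = u₀`, on `ℝⁿ × (0,T)`: it is continuous on `ℝⁿ × [0,T)`, attains the initial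
data, is positive and spatially `C²` for `0 < t < T`, and satisfies the PDE pointwise. -/
def IsSolOn (n : ℕ) (p : ℝ) (u₀ : EuclideanSpace ℝ (Fin n) → ℝ)
    (u : EuclideanSpace ℝ (Fin n) → ℝ → ℝ) (T : ℝ) : Prop :=
  ContinuousOn (fun z : (EuclideanSpace ℝ (Fin n)) × ℝ => u z.1 z.2) {z | 0 ≤ z.2 ∧ z.2 < T} ∧
  (∀ x, u x 0 = u₀ x) ∧
  (∀ x, ∀ t, 0 < t → t < T → 0 < u x t) ∧
  (∀ t, 0 < t → t < T → ContDiff ℝ 2 (fun y => u y t)) ∧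
  (∀ x, ∀ t, 0 < t → t < T →
    HasDerivAt (fun s => u x s) (u x t ^ p * lap (fun y => u y t) x) t)

/-- `u` is a global positive classical solution of the Cauchy problem
`u_t = u^p Δu` on `ℝⁿ × (0,∞)`, `u(·,0) = u₀`. -/
def IsSol (n : ℕ) (p : ℝ) (u₀ : EuclideanSpace ℝ (Fin n) → ℝ)
    (u : EuclideanSpace ℝ (Fin n) → ℝ → ℝ) : Prop :=
  ContinuousOn (fun z : (EuclideanSpace ℝ (Fin n)) × ℝ => u z.1 z.2) {z | 0 ≤ z.2} ∧
  (∀ x, u x 0 = u₀ x) ∧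
  (∀ x, ∀ t, 0 < t → 0 < u x t) ∧
  (∀ t, 0 < t → ContDiff ℝ 2 (fun y => u y t)) ∧
  (∀ x, ∀ t, 0 < t →
    HasDerivAt (fun s => u x s) (u x t ^ p * lap (fun y => u y t) x) t)

/-- `u` is the minimal global positive classical solution of the Cauchy problem:
whenever `T ∈ (0,∞]` and `v` is a positive classical solution on `ℝⁿ × (0,T)`, then
`u ≤ v` there.  (Quantifying over all finite `T > 0` covers `T = ∞`, since the
restriction of a global solution solves the problem on every `(0,T)`.) -/
def IsMinimalSol (n : ℕ) (p : ℝ) (u₀ : EuclideanSpace ℝ (Fin n) → ℝ)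
    (u : EuclideanSpace ℝ (Fin n) → ℝ → ℝ) : Prop :=
  IsSol n p u₀ u ∧
  ∀ T > (0:ℝ), ∀ v, IsSolOn n p u₀ v T → ∀ x, ∀ t, 0 ≤ t → t < T → u x t ≤ v x t


section
open Real Set MeasureTheory Metric Filter
open scoped Topology

abbrev Eu (n : ℕ) := EuclideanSpace ℝ (Fin n)

section LapBasics
variable {n : ℕ} {f g : Eu n → ℝ} {x : Eu n}

theorem lap_eq (hf : ContDiffAt ℝ 2 f x) :
    lap f x = ∑ i : Fin n, fderiv ℝ (fderiv ℝ f) x (EuclideanSpace.single i 1)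
      (EuclideanSpace.single i 1) := by
  have h1 : DifferentiableAt ℝ (fderiv ℝ f) x :=
    (hf.fderiv_right (m := 1) (by norm_num)).differentiableAt (by norm_num)
  unfold lap
  refine Finset.sum_congr rfl fun i _ => ?_
  rw [fderiv_clm_apply h1 (differentiableAt_const _)]
  simp

theorem lap_congr (h : f =ᶠ[𝓝 x] g) : lap f x = lap g x := by
  unfold lap
  refine Finset.sum_congr rfl fun i _ => ?_
  have h2 : (fun y => fderiv ℝ f y (EuclideanSpace.single i 1)) =ᶠ[𝓝 x]
      (fun y => fderiv ℝ g y (EuclideanSpace.single i 1)) := by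
    filter_upwards [h.fderiv (𝕜 := ℝ)] with y hy
    rw [hy]
  rw [h2.fderiv_eq]

theorem lap_eq_laplacian (hf : ContDiffAt ℝ 2 f x) : lap f x = Laplacian.laplacian f x := by
  rw [lap_eq hf, InnerProductSpace.laplacian_eq_iteratedFDeriv_orthonormalBasis f
    (EuclideanSpace.basisFun (Fin n) ℝ)]
  simp [iteratedFDeriv_two_apply]

theorem lap_add (hf : ContDiffAt ℝ 2 f x) (hg : ContDiffAt ℝ 2 g x) :
    lap (fun y => f y + g y) x = lap f x + lap g x := by
  rw [lap_eq_laplacian hf, lap_eq_laplacian hg, lap_eq_laplacian (hf.add hg)]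
  exact hf.laplacian_add hg

theorem lap_sub (hf : ContDiffAt ℝ 2 f x) (hg : ContDiffAt ℝ 2 g x) :
    lap (fun y => f y - g y) x = lap f x - lap g x := by
  rw [lap_eq_laplacian hf, lap_eq_laplacian hg, lap_eq_laplacian (hf.sub hg)]
  exact hf.laplacian_sub hg

theorem lap_const_mul (c : ℝ) (hf : ContDiffAt ℝ 2 f x) :
    lap (fun y => c * f y) x = c * lap f x := by
  rw [lap_eq_laplacian hf, lap_eq_laplacian (contDiffAt_const.mul hf)]
  exact InnerProductSpace.laplacian_smul (𝕜 := ℝ) c hf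

theorem lap_const (c : ℝ) : lap (fun _ : Eu n => c) x = 0 := by
  simp [lap]

theorem lap_add_const (hf : ContDiffAt ℝ 2 f x) (c : ℝ) :
    lap (fun y => f y + c) x = lap f x := by
  rw [lap_add hf contDiffAt_const, lap_const, add_zero]

theorem contDiff_normsq (x0 : Eu n) : ContDiff ℝ 2 (fun y : Eu n => ‖y - x0‖ ^ 2) :=
  (contDiff_id.sub contDiff_const).norm_sq ℝ

theorem fderiv_normsq (x0 x w : Eu n) :
    fderiv ℝ (fun y : Eu n => ‖y - x0‖ ^ 2) x w = 2 * inner ℝ (x - x0) w := by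
  have h := ((hasFDerivAt_id x).sub_const x0).norm_sq
  have h2 : HasFDerivAt (fun y : Eu n => ‖y - x0‖ ^ 2) _ x := h
  rw [h2.fderiv]
  simp [inner_sub_left]

theorem lap_normsq (x0 x : Eu n) : lap (fun y : Eu n => ‖y - x0‖ ^ 2) x = 2 * n := by
  unfold lap
  have : ∀ i : Fin n, fderiv ℝ (fun y => fderiv ℝ (fun y : Eu n => ‖y - x0‖ ^ 2) y
      (EuclideanSpace.single i 1)) x (EuclideanSpace.single i 1) = 2 := by
    intro i
    have h1 : (fun y : Eu n => fderiv ℝ (fun y : Eu n => ‖y - x0‖ ^ 2) y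
      (EuclideanSpace.single i 1)) = fun y => 2 * (y i - x0 i) := by
      funext y
      rw [fderiv_normsq, EuclideanSpace.inner_single_right]
      simp
    rw [h1]
    have h3 : HasFDerivAt (fun y : Eu n => 2 * (y i - x0 i))
        ((2:ℝ) • (EuclideanSpace.proj i : Eu n →L[ℝ] ℝ)) x := by
      exact (((EuclideanSpace.proj i : Eu n →L[ℝ] ℝ).hasFDerivAt (x := x)).sub_const (x0 i)).const_mul 2
    rw [h3.fderiv]
    simp
  simp [this, mul_comm]

/-- second derivative along a line -/
theorem deriv2_line (hf : ContDiffAt ℝ 2 f x) (e : Eu n) :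
    deriv (deriv (fun s : ℝ => f (x + s • e))) 0 = fderiv ℝ (fderiv ℝ f) x e e := by
  have hline : ∀ s : ℝ, HasDerivAt (fun s : ℝ => x + s • e) e s := by
    intro s
    simpa using ((hasDerivAt_id s).smul_const e).const_add x
  have ht : Tendsto (fun s : ℝ => x + s • e) (𝓝 0) (𝓝 x) := by
    have := (hline 0).continuousAt.tendsto
    simpa using this
  have hev : ∀ᶠ y in 𝓝 x, DifferentiableAt ℝ f y := by
    filter_upwards [hf.eventually (by simp)] with y hy
    exact hy.differentiableAt (by norm_num)
  have h1 : deriv (fun s : ℝ => f (x + s • e)) =ᶠ[𝓝 0] fun s => fderiv ℝ f (x + s • e) e := by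
    filter_upwards [ht.eventually hev] with s hs
    exact (hs.hasFDerivAt.comp_hasDerivAt s (hline s)).deriv
  rw [h1.deriv_eq]
  have h2 : DifferentiableAt ℝ (fderiv ℝ f) x :=
    (hf.fderiv_right (m := 1) (by norm_num)).differentiableAt (by norm_num)
  have h3 : HasFDerivAt (fderiv ℝ f) (fderiv ℝ (fderiv ℝ f) x) (x + (0:ℝ) • e) := by
    simpa using h2.hasFDerivAt
  have h4 := h3.comp_hasDerivAt (0:ℝ) (hline 0)
  have h5 := h4.clm_apply (hasDerivAt_const (0:ℝ) e)
  simpa using h5.deriv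

theorem deriv2_nonpos_of_localMax {g : ℝ → ℝ} (h : IsLocalMax g 0) (hc : ContinuousAt g 0) :
    deriv (deriv g) 0 ≤ 0 := by
  by_contra hcon
  push Not at hcon
  have hd := h.deriv_eq_zero
  have hmin := isLocalMin_of_deriv_deriv_pos hcon hd hc
  have heq : g =ᶠ[𝓝 0] fun _ => g 0 := by
    filter_upwards [h, hmin] with y h1 h2
    exact le_antisymm h1 h2
  have : deriv g =ᶠ[𝓝 0] fun _ => 0 := by
    have := heq.deriv
    simpa using this
  rw [this.deriv_eq] at hcon
  simp at hcon

theorem lap_nonpos_of_localMax (hf : ContDiffAt ℝ 2 f x) (h : IsLocalMax f x) : lap f x ≤ 0 := by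
  rw [lap_eq hf]
  refine Finset.sum_nonpos fun i _ => ?_
  rw [← deriv2_line hf]
  have ht : ContinuousAt (fun s : ℝ => x + s • (EuclideanSpace.single i 1 : Eu n)) 0 := by
    fun_prop
  apply deriv2_nonpos_of_localMax
  · have ht' : Tendsto (fun s : ℝ => x + s • (EuclideanSpace.single i 1 : Eu n)) (𝓝 0) (𝓝 x) := by
      simpa using ht.tendsto
    have := ht'.eventually h
    filter_upwards [this] with s hs
    simpa using hs
  · have : ContinuousAt f (x + (0:ℝ) • (EuclideanSpace.single i 1 : Eu n)) := by
      simpa using hf.continuousAt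
    exact this.comp (f := fun s : ℝ => x + s • (EuclideanSpace.single i 1 : Eu n)) ht

theorem lap_comp_smul (μ : ℝ) (x0 : Eu n) (hf : ContDiffAt ℝ 2 f (μ • x + x0)) :
    lap (fun y => f (μ • y + x0)) x = μ ^ 2 * lap f (μ • x + x0) := by
  have hA : ContDiffAt ℝ 2 (fun y : Eu n => μ • y + x0) x := by fun_prop
  have hc : ContDiffAt ℝ 2 (fun y => f (μ • y + x0)) x := hf.comp x hA
  rw [lap_eq hc, lap_eq hf, Finset.mul_sum]
  refine Finset.sum_congr rfl fun i _ => ?_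
  rw [← deriv2_line hc, ← deriv2_line hf]
  set e : Eu n := EuclideanSpace.single i 1
  have h1 : (fun s : ℝ => f (μ • (x + s • e) + x0)) =
      fun s : ℝ => (fun r => f (μ • x + x0 + r • e)) (μ * s) := by
    funext s
    congr 1
    module
  rw [h1]
  have h2 : ∀ (g : ℝ → ℝ), deriv (fun s => g (μ * s)) = fun s => μ * deriv g (μ * s) := by
    intro g
    funext s
    rw [deriv_comp_mul_left]
    simp
  have h3 := h2 (fun r => f (μ • x + x0 + r • e))
  have h4 := h2 (deriv (fun r => f (μ • x + x0 + r • e)))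
  rw [h3, deriv_const_mul_field, h4]
  simp
  ring

theorem lap_comp_isometry (A : Eu n ≃ₗᵢ[ℝ] Eu n) (b : Eu n) (hf : ContDiffAt ℝ 2 f (A x + b)) :
    lap (fun y => f (A y + b)) x = lap f (A x + b) := by
  have hA : ContDiffAt ℝ 2 (fun y : Eu n => A y + b) x := by
    exact (A.contDiff.contDiffAt).add contDiffAt_const
  have hc : ContDiffAt ℝ 2 (fun y => f (A y + b)) x := hf.comp x hA
  rw [lap_eq hc, lap_eq_laplacian hf,
    InnerProductSpace.laplacian_eq_iteratedFDeriv_orthonormalBasis f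
    ((EuclideanSpace.basisFun (Fin n) ℝ).map A)]
  refine Finset.sum_congr rfl fun i _ => ?_
  rw [← deriv2_line hc, iteratedFDeriv_two_apply]
  simp only [OrthonormalBasis.map_apply, EuclideanSpace.basisFun_apply, Matrix.cons_val_zero,
    Matrix.cons_val_one]
  rw [← deriv2_line hf]
  congr 2
  funext s
  simp only [map_add, map_smul]
  congr 1
  abel

theorem lap_mul (hf : ContDiffAt ℝ 2 f x) (hg : ContDiffAt ℝ 2 g x) :
    lap (fun y => f y * g y) x = f x * lap g x + g x * lap f x +
      2 * ∑ i : Fin n, fderiv ℝ f x (EuclideanSpace.single i 1) *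
        fderiv ℝ g x (EuclideanSpace.single i 1) := by
  unfold lap
  rw [Finset.mul_sum, Finset.mul_sum, Finset.mul_sum, ← Finset.sum_add_distrib,
    ← Finset.sum_add_distrib]
  refine Finset.sum_congr rfl fun i _ => ?_
  set e : Eu n := EuclideanSpace.single i 1
  have hev : (fun y => fderiv ℝ (fun y => f y * g y) y e) =ᶠ[𝓝 x]
      fun y => f y * fderiv ℝ g y e + g y * fderiv ℝ f y e := by
    filter_upwards [hf.eventually (by simp), hg.eventually (by simp)] with y h1 h2
    rw [fderiv_fun_mul (h1.differentiableAt (by norm_num)) (h2.differentiableAt (by norm_num))]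
    simp
  rw [hev.fderiv_eq]
  have df : DifferentiableAt ℝ f x := hf.differentiableAt (by norm_num)
  have dg : DifferentiableAt ℝ g x := hg.differentiableAt (by norm_num)
  have df2 : DifferentiableAt ℝ (fun y => fderiv ℝ f y e) x :=
    ((hf.fderiv_right (m := 1) (by norm_num)).differentiableAt (by norm_num)).clm_apply
      (differentiableAt_const _)
  have dg2 : DifferentiableAt ℝ (fun y => fderiv ℝ g y e) x :=
    ((hg.fderiv_right (m := 1) (by norm_num)).differentiableAt (by norm_num)).clm_apply
      (differentiableAt_const _)
  rw [fderiv_fun_add (df.fun_mul dg2) (dg.fun_mul df2), fderiv_fun_mul df dg2, fderiv_fun_mul dg df2]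
  simp
  ring

theorem ContDiffAt.continuousAt_lap (hf : ContDiffAt ℝ 2 f x) : ContinuousAt (lap f) x := by
  have h1 : ContinuousAt (fun y => ∑ i : Fin n, fderiv ℝ (fderiv ℝ f) y
      (EuclideanSpace.single i 1) (EuclideanSpace.single i 1)) x := by
    have h2 : ContinuousAt (fderiv ℝ (fderiv ℝ f)) x :=
      ((hf.fderiv_right (m := 1) (by norm_num)).fderiv_right (m := 0) (by norm_num)).continuousAt
    exact tendsto_finsetSum _ fun i _ =>
      ((h2.clm_apply continuousAt_const).clm_apply continuousAt_const)
  refine h1.congr ?_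
  filter_upwards [hf.eventually (by simp)] with y hy
  exact (lap_eq hy).symm

end LapBasics

end

section
open Real Set MeasureTheory Metric Filter
open scoped Topology

section Perron
variable {n : ℕ}

/-- comparison property from below -/
def Cmp (p : ℝ) (s : Eu n → ℝ → ℝ) : Prop :=
  ∀ (D : Set (Eu n)) (t1 t2 b : ℝ) (ψ : Eu n → ℝ), IsCompact D → 0 < t1 → t1 ≤ t2 →
    (∀ x ∈ D, ContDiffAt ℝ 2 ψ x) →
    (∀ x ∈ D, ∀ t ∈ Icc t1 t2, b < (max (ψ x + b * t) 0) ^ p * lap ψ x) →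
    (∀ x ∈ D, ψ x + b * t1 ≤ s x t1) →
    (∀ x ∈ frontier D, ∀ t ∈ Icc t1 t2, ψ x + b * t ≤ s x t) →
    ∀ x ∈ D, ∀ t ∈ Icc t1 t2, ψ x + b * t ≤ s x t

/-- The Perron class. -/
def Cls (p : ℝ) (u₀ : Eu n → ℝ) (s : Eu n → ℝ → ℝ) : Prop :=
  (∀ x t, 0 < t → 0 ≤ s x t) ∧
  (∀ R, ∀ ε > (0:ℝ), ∃ δ > (0:ℝ), ∀ x, ‖x‖ ≤ R → ∀ t, 0 < t → t < δ → u₀ x - ε ≤ s x t) ∧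
  Cmp p s

/-- The Perron solution. -/
noncomputable def vv (p : ℝ) (u₀ : Eu n → ℝ) (x : Eu n) (t : ℝ) : ℝ :=
  sInf ((fun s : Eu n → ℝ → ℝ => s x t) '' {s | Cls p u₀ s})

/-- classical comparison -/
theorem classical_cmp {p : ℝ} {D : Set (Eu n)} {t1 t2 b b' : ℝ} {ψ ψ' : Eu n → ℝ}
    (hD : IsCompact D)
    (hψ : ∀ x ∈ D, ContDiffAt ℝ 2 ψ x) (hψ' : ∀ x ∈ D, ContDiffAt ℝ 2 ψ' x)
    (hsub : ∀ x ∈ D, ∀ t ∈ Icc t1 t2, b < (max (ψ x + b * t) 0) ^ p * lap ψ x)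
    (hinitial : ∀ x ∈ D, ψ x + b * t1 ≤ ψ' x + b' * t1)
    (hbd : ∀ x ∈ frontier D, ∀ t ∈ Icc t1 t2, ψ x + b * t ≤ ψ' x + b' * t)
    (hsup : ∀ x ∈ D, ∀ t ∈ Icc t1 t2, ψ' x + b' * t < ψ x + b * t →
      (max (ψ x + b * t) 0) ^ p * lap ψ' x ≤ b') :
    ∀ x ∈ D, ∀ t ∈ Icc t1 t2, ψ x + b * t ≤ ψ' x + b' * t := by
  intro x hx t ht
  by_contra hcon
  push Not at hcon
  set F : Eu n × ℝ → ℝ := fun z => (ψ z.1 - ψ' z.1) + (b - b') * z.2 with hF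
  have hcont : ContinuousOn F (D ×ˢ Icc t1 t2) := by
    apply ContinuousOn.add
    · have h1 : ContinuousOn (fun x => ψ x - ψ' x) D := fun y hy =>
        ((hψ y hy).continuousAt.sub (hψ' y hy).continuousAt).continuousWithinAt
      exact h1.comp continuousOn_fst (fun z hz => hz.1)
    · fun_prop
  obtain ⟨⟨y, τ⟩, hmem, hmax⟩ := (hD.prod isCompact_Icc).exists_isMaxOn ⟨(x, t), ⟨hx, ht⟩⟩ hcont
  have hyD : y ∈ D := hmem.1
  have hτ : τ ∈ Icc t1 t2 := hmem.2
  have hpos : 0 < F (y, τ) := by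
    have := hmax (show (x, t) ∈ D ×ˢ Icc t1 t2 from ⟨hx, ht⟩)
    simp only [hF, mem_setOf_eq] at this ⊢
    nlinarith
  have hgt : ψ' y + b' * τ < ψ y + b * τ := by simp only [hF] at hpos; nlinarith
  have hintegr : y ∈ interior D := by
    by_contra hni
    have : y ∈ frontier D := ⟨subset_closure hyD, hni⟩
    linarith [hbd y this τ hτ]
  have hτ1 : t1 < τ := by
    rcases hτ.1.lt_or_eq with h | h
    · exact h
    · exfalso; subst h; linarith [hinitial y hyD]
  have hb : b' ≤ b := by
    have := hmax (show (y, t1) ∈ D ×ˢ Icc t1 t2 from ⟨hyD, ⟨le_refl _, hτ.1.trans hτ.2⟩⟩)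
    simp only [hF, mem_setOf_eq] at this
    by_contra hlt
    push Not at hlt
    nlinarith
  have hloc : IsLocalMax (fun z => ψ z - ψ' z) y := by
    filter_upwards [mem_interior_iff_mem_nhds.1 hintegr] with z hz
    have := hmax (show (z, τ) ∈ D ×ˢ Icc t1 t2 from ⟨hz, hτ⟩)
    simp only [hF, mem_setOf_eq] at this
    linarith
  have hlap := lap_nonpos_of_localMax ((hψ y hyD).sub (hψ' y hyD)) hloc
  rw [show lap (fun z => ψ z - ψ' z) y = lap ψ y - lap ψ' y from
    lap_sub (hψ y hyD) (hψ' y hyD)] at hlap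
  have h1 := hsub y hyD τ hτ
  have h2 := hsup y hyD τ hτ hgt
  have h3 : 0 ≤ (max (ψ y + b * τ) 0) ^ p := Real.rpow_nonneg (le_max_right _ _) _
  nlinarith

variable {p : ℝ} {u₀ : Eu n → ℝ} {M : ℝ}

theorem cmp_const {p : ℝ} (M : ℝ) : Cmp p (fun (_ : Eu n) (_ : ℝ) => M) := by
  intro D t1 t2 b ψ hD ht1 ht12 hψ hsub hinitial hbd x hx t ht
  have := classical_cmp (b' := 0) (ψ' := fun _ => M) hD hψ (fun _ _ => contDiffAt_const) hsub
    (by simpa using hinitial) (by simpa using hbd) (by simp [lap_const]) x hx t ht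
  simpa using this

theorem cls_const (hM : 0 ≤ M) (hu : ∀ x, u₀ x ≤ M) : Cls p u₀ (fun _ _ => M) :=
  ⟨fun _ _ _ => hM, fun _ ε hε => ⟨1, one_pos, fun x _ _ _ _ => by linarith [hu x]⟩, cmp_const M⟩

theorem vv_le {s : Eu n → ℝ → ℝ} (hs : Cls p u₀ s) {x : Eu n} {t : ℝ} (ht : 0 < t) :
    vv p u₀ x t ≤ s x t := by
  refine csInf_le ⟨0, ?_⟩ ⟨s, hs, rfl⟩
  rintro _ ⟨s', hs', rfl⟩
  exact hs'.1 x t ht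

theorem le_vv (hM : 0 ≤ M) (hu : ∀ x, u₀ x ≤ M) {x : Eu n} {t c : ℝ}
    (h : ∀ s, Cls p u₀ s → c ≤ s x t) : c ≤ vv p u₀ x t := by
  refine le_csInf ⟨M, ⟨_, cls_const hM hu, rfl⟩⟩ ?_
  rintro _ ⟨s', hs', rfl⟩
  exact h s' hs'

theorem vv_nonneg (hM : 0 ≤ M) (hu : ∀ x, u₀ x ≤ M) {x : Eu n} {t : ℝ} (ht : 0 < t) :
    0 ≤ vv p u₀ x t := le_vv hM hu fun s hs => hs.1 x t ht

theorem vv_le_M (hM : 0 ≤ M) (hu : ∀ x, u₀ x ≤ M) {x : Eu n} {t : ℝ} (ht : 0 < t) :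
    vv p u₀ x t ≤ M := vv_le (cls_const hM hu) ht

theorem cmp_vv (hM : 0 ≤ M) (hu : ∀ x, u₀ x ≤ M) : Cmp p (vv p u₀) := by
  intro D t1 t2 b ψ hD ht1 ht12 hψ hsub hinitial hbd x hx t ht
  refine le_vv hM hu fun s hs => ?_
  refine hs.2.2 D t1 t2 b ψ hD ht1 ht12 hψ hsub (fun y hy => (hinitial y hy).trans (vv_le hs ht1))
    (fun y hy τ hτ => (hbd y hy τ hτ).trans (vv_le hs (ht1.trans_le hτ.1))) x hx t ht

theorem lap_quad (m A : ℝ) (x0 x : Eu n) :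
    lap (fun y => m + A * ‖y - x0‖ ^ 2) x = A * (2 * n) := by
  rw [lap_add contDiffAt_const (contDiffAt_const.mul (contDiff_normsq x0).contDiffAt), lap_const,
    lap_const_mul _ (contDiff_normsq x0).contDiffAt, lap_normsq, zero_add]

theorem contDiff_quad (m A : ℝ) (x0 : Eu n) : ContDiff ℝ 2 (fun y => m + A * ‖y - x0‖ ^ 2) :=
  contDiff_const.add (contDiff_const.mul (contDiff_normsq x0))

/-- lower barrier for all members of the class -/
theorem lower_barrier (hp : 0 < p) {s : Eu n → ℝ → ℝ} (hs : Cls p u₀ s) {x0 : Eu n} {δ m ε κ : ℝ}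
    (hδ : 0 < δ) (hm : 0 < m) (hε : 0 < ε) (h : ∀ x ∈ closedBall x0 δ, m + ε ≤ u₀ x)
    (hκ : m ^ p * (m / δ ^ 2 * (2 * n)) < κ) :
    ∀ x ∈ closedBall x0 δ, ∀ t, 0 < t → m - m / δ ^ 2 * ‖x - x0‖ ^ 2 - κ * t ≤ s x t := by
  intro x hx t ht
  obtain ⟨δ', hδ', hinitial⟩ := hs.2.1 (‖x0‖ + δ) ε hε
  set t1 := min (δ' / 2) t with ht1
  have ht1pos : 0 < t1 := by rw [ht1]; positivity
  have ht1lt : t1 < δ' := (min_le_left _ _).trans_lt (by linarith)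
  have hκ0 : 0 < κ := lt_of_le_of_lt (by positivity) hκ
  have hmd : 0 ≤ m / δ ^ 2 := by positivity
  have key := hs.2.2 (closedBall x0 δ) t1 t (-κ) (fun y => m + (-(m / δ ^ 2)) * ‖y - x0‖ ^ 2)
    (isCompact_closedBall _ _) ht1pos (min_le_right _ _)
    (fun y _ => (contDiff_quad _ _ _).contDiffAt) ?_ ?_ ?_ x hx t ⟨min_le_right _ _, le_refl _⟩
  · linarith
  · intro y _ τ hτ
    rw [lap_quad]
    have hτ0 : 0 < τ := ht1pos.trans_le hτ.1
    have h1 : max (m + -(m / δ ^ 2) * ‖y - x0‖ ^ 2 + -κ * τ) 0 ≤ m := by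
      apply max_le _ hm.le
      have : 0 ≤ m / δ ^ 2 * ‖y - x0‖ ^ 2 := by positivity
      nlinarith
    have h2 := Real.rpow_le_rpow (le_max_right _ _) h1 hp.le
    have h3 : 0 ≤ m / δ ^ 2 * (2 * n) := by positivity
    nlinarith
  · intro y hy
    have hy' : ‖y‖ ≤ ‖x0‖ + δ := by
      have : ‖y - x0‖ ≤ δ := by simpa [dist_eq_norm] using hy
      calc ‖y‖ = ‖x0 + (y - x0)‖ := by congr 1; abel
        _ ≤ _ := (norm_add_le _ _).trans (by linarith)
    have h1 := hinitial y hy' t1 ht1pos ht1lt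
    have h2 := h y hy
    have : 0 ≤ m / δ ^ 2 * ‖y - x0‖ ^ 2 := by positivity
    nlinarith
  · intro y hy τ hτ
    have hτ0 : 0 < τ := ht1pos.trans_le hτ.1
    rw [frontier_closedBall _ hδ.ne'] at hy
    have : ‖y - x0‖ = δ := by simpa [dist_eq_norm] using hy
    have h1 := hs.1 y τ hτ0
    rw [this]
    have : m / δ ^ 2 * δ ^ 2 = m := by field_simp
    nlinarith

theorem vv_lower (hp : 0 < p) (hM : 0 ≤ M) (hu : ∀ x, u₀ x ≤ M) {x0 : Eu n} {δ m ε κ : ℝ}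
    (hδ : 0 < δ) (hm : 0 < m) (hε : 0 < ε) (h : ∀ x ∈ closedBall x0 δ, m + ε ≤ u₀ x)
    (hκ : m ^ p * (m / δ ^ 2 * (2 * n)) < κ) {t : ℝ} (ht : 0 < t) : m - κ * t ≤ vv p u₀ x0 t := by
  refine le_vv hM hu fun s hs => ?_
  have := lower_barrier hp hs hδ hm hε h hκ x0 (mem_closedBall_self hδ.le) t ht
  simpa using this

theorem unif_mod (hc : Continuous u₀) (R : ℝ) {ε : ℝ} (hε : 0 < ε) :
    ∃ δ > 0, ∀ x, ‖x‖ ≤ R → ∀ y ∈ closedBall x δ, |u₀ y - u₀ x| < ε := by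
  have huc := (isCompact_closedBall (0 : Eu n) (R + 1)).uniformContinuousOn_of_continuous
    hc.continuousOn
  rw [Metric.uniformContinuousOn_iff] at huc
  obtain ⟨δ, hδ, h⟩ := huc ε hε
  refine ⟨min (δ / 2) 1, by positivity, fun x hx y hy => ?_⟩
  have hxy : dist y x ≤ min (δ / 2) 1 := hy
  have h1 : dist y x < δ := (hxy.trans (min_le_left _ _)).trans_lt (by linarith)
  have h2 : dist y x ≤ 1 := hxy.trans (min_le_right _ _)
  have h3 : ‖y‖ ≤ R + 1 := by
    rw [dist_eq_norm] at h2
    calc ‖y‖ = ‖x + (y - x)‖ := by congr 1; abel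
      _ ≤ _ := (norm_add_le _ _).trans (by linarith)
  have := h y (by simpa using h3) x (by simp; linarith) h1
  rwa [Real.dist_eq] at this

theorem vv_init_lower (hp : 0 < p) (hM : 0 ≤ M) (hu : ∀ x, u₀ x ≤ M) (hc : Continuous u₀)
    (R : ℝ) {ε : ℝ} (hε : 0 < ε) :
    ∃ δ > (0:ℝ), ∀ x, ‖x‖ ≤ R → ∀ t, 0 < t → t < δ → u₀ x - ε ≤ vv p u₀ x t := by
  obtain ⟨δ, hδ, hmod⟩ := unif_mod hc R (show 0 < ε / 4 by linarith)
  set κ := M ^ p * (M / δ ^ 2 * (2 * n)) + 1 with hκ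
  have hκ0 : 0 < κ := by positivity
  refine ⟨ε / (2 * κ), by positivity, fun x hx t ht htd => ?_⟩
  have htk : κ * t < ε / 2 := by
    rw [lt_div_iff₀ (by positivity)] at htd
    linarith
  by_cases hm : u₀ x - ε / 2 ≤ 0
  · have := vv_nonneg (p := p) hM hu (x := x) ht
    linarith
  · push Not at hm
    have hmM : u₀ x - ε / 2 ≤ M := by linarith [hu x]
    have := vv_lower hp hM hu (x0 := x) (m := u₀ x - ε / 2) (ε := ε / 4) (κ := κ) hδ hm
      (by linarith) (fun y hy => by
        have := (abs_lt.1 (hmod x hx y hy)).1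
        linarith) (by
        rw [hκ]
        have h1 : (u₀ x - ε / 2) ^ p ≤ M ^ p := Real.rpow_le_rpow hm.le hmM hp.le
        have h2 : (u₀ x - ε / 2) / δ ^ 2 * (2 * n) ≤ M / δ ^ 2 * (2 * n) := by gcongr
        have h3 : (u₀ x - ε / 2) ^ p * ((u₀ x - ε / 2) / δ ^ 2 * (2 * n)) ≤
          M ^ p * (M / δ ^ 2 * (2 * n)) := by gcongr
        linarith) ht
    linarith

theorem cls_vv (hp : 0 < p) (hM : 0 ≤ M) (hu : ∀ x, u₀ x ≤ M) (hc : Continuous u₀) :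
    Cls p u₀ (vv p u₀) :=
  ⟨fun _ _ ht => vv_nonneg hM hu ht, fun R _ hε => vv_init_lower hp hM hu hc R hε, cmp_vv hM hu⟩

theorem cls_upper (hp : 0 < p) (hM : 0 ≤ M) (hu : ∀ x, u₀ x ≤ M) {x0 : Eu n} {m δ κ : ℝ}
    (hm : 0 ≤ m) (hδ : 0 < δ) (h : ∀ x ∈ closedBall x0 δ, u₀ x ≤ m)
    (hκ : M ^ p * (M / δ ^ 2 * (2 * n)) ≤ κ) :
    Cls p u₀ (fun x t => min M (m + M / δ ^ 2 * ‖x - x0‖ ^ 2 + κ * t)) := by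
  have hκ0 : 0 ≤ κ := le_trans (by positivity) hκ
  refine ⟨fun x t ht => ?_, fun R ε hε => ⟨1, one_pos, fun x _ t ht _ => ?_⟩, ?_⟩
  · positivity
  · refine le_min (by linarith [hu x]) ?_
    have : 0 ≤ κ * t := by positivity
    by_cases hx : x ∈ closedBall x0 δ
    · have : 0 ≤ M / δ ^ 2 * ‖x - x0‖ ^ 2 := by positivity
      linarith [h x hx]
    · have hx' : δ < ‖x - x0‖ := by simpa [dist_eq_norm] using hx
      have : M / δ ^ 2 * δ ^ 2 ≤ M / δ ^ 2 * ‖x - x0‖ ^ 2 := by gcongr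
      rw [div_mul_cancel₀ _ (by positivity)] at this
      linarith [hu x]
  · intro D t1 t2 b ψ hD ht1 ht12 hψ hsub hinitial hbd
    have hleM := cmp_const (p := p) M D t1 t2 b ψ hD ht1 ht12 hψ hsub
      (fun x hx => (hinitial x hx).trans (min_le_left _ _))
      (fun x hx t ht => (hbd x hx t ht).trans (min_le_left _ _))
    intro x hx t ht
    refine le_min (hleM x hx t ht) ?_
    refine classical_cmp (p := p) (b' := κ) (ψ' := fun x => m + M / δ ^ 2 * ‖x - x0‖ ^ 2) hD hψ
      (fun _ _ => (contDiff_quad _ _ _).contDiffAt) hsub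
      (fun x hx => (hinitial x hx).trans (min_le_right _ _))
      (fun x hx t ht => (hbd x hx t ht).trans (min_le_right _ _)) ?_ x hx t ht
    intro y hy τ hτ _
    rw [lap_quad]
    refine le_trans ?_ hκ
    have := Real.rpow_le_rpow (le_max_right _ _) (max_le (hleM y hy τ hτ) hM) hp.le
    gcongr

theorem vv_init_upper (hp : 0 < p) (hM : 0 ≤ M) (hu : ∀ x, u₀ x ≤ M) (hpos : ∀ x, 0 < u₀ x)
    (hc : Continuous u₀)
    (R : ℝ) {ε : ℝ} (hε : 0 < ε) :
    ∃ δ > (0:ℝ), ∀ x, ‖x‖ ≤ R → ∀ t, 0 < t → t < δ → vv p u₀ x t ≤ u₀ x + ε := by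
  obtain ⟨δ, hδ, hmod⟩ := unif_mod hc R (show 0 < ε / 2 by linarith)
  set κ := M ^ p * (M / δ ^ 2 * (2 * n)) + 1 with hκ
  have hκ0 : 0 < κ := by positivity
  refine ⟨ε / (2 * κ), by positivity, fun x hx t ht htd => ?_⟩
  have htk : κ * t < ε / 2 := by
    rw [lt_div_iff₀ (by positivity)] at htd
    linarith
  have := vv_le (cls_upper (p := p) (u₀ := u₀) (x0 := x) (m := u₀ x + ε / 2) (δ := δ) (κ := κ)
    hp hM hu (by linarith [hpos x]) hδ (fun y hy => by
        have := (abs_lt.1 (hmod x hx y hy)).2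
        linarith) (by linarith)) (x := x) ht
  have h2 := this.trans (min_le_right _ _)
  simp at h2
  linarith

/-- comparison from above for the Perron solution -/
theorem sub_cmp (hp : 0 < p) (hM : 0 ≤ M) (hu : ∀ x, u₀ x ≤ M) (hc : Continuous u₀)
    {D : Set (Eu n)} {t1 t2 b : ℝ} {ψ : Eu n → ℝ} (hD : IsCompact D) (ht1 : 0 < t1)
    (hψ : ∀ x ∈ D, ContDiffAt ℝ 2 ψ x)
    (hnn : ∀ x ∈ D, ∀ t ∈ Icc t1 t2, 0 ≤ ψ x + b * t)
    (hinitial : ∀ x ∈ D, vv p u₀ x t1 ≤ ψ x + b * t1)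
    (hbd : ∀ x ∈ frontier D, ∀ t ∈ Icc t1 t2, vv p u₀ x t ≤ ψ x + b * t)
    (hsup : ∀ x ∈ D, ∀ t ∈ Icc t1 t2, ∀ q, ψ x + b * t ≤ q → q ≤ vv p u₀ x t →
      q ^ p * lap ψ x ≤ b) :
    ∀ x ∈ D, ∀ t ∈ Icc t1 t2, vv p u₀ x t ≤ ψ x + b * t := by
  classical
  set v := vv p u₀ with hv
  have hcls := cls_vv (p := p) hp hM hu hc
  set s : Eu n → ℝ → ℝ := fun x t => if x ∈ D ∧ t ∈ Icc t1 t2 then min (v x t) (ψ x + b * t)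
    else v x t with hs
  have hsv : ∀ x t, s x t ≤ v x t := by
    intro x t
    simp only [hs]
    split_ifs
    · exact min_le_left _ _
    · exact le_refl _
  have hsQ : ∀ x ∈ D, ∀ t ∈ Icc t1 t2, s x t ≤ ψ x + b * t := by
    intro x hx t ht
    simp only [hs, if_pos (And.intro hx ht)]
    exact min_le_right _ _
  have hmem : Cls p u₀ s := by
    refine ⟨fun x t ht => ?_, fun R ε hε => ?_, ?_⟩
    · simp only [hs]
      split_ifs with h
      · exact le_min (hcls.1 x t ht) (hnn x h.1 t h.2)
      · exact hcls.1 x t ht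
    · obtain ⟨δ, hδ, h⟩ := hcls.2.1 R ε hε
      refine ⟨min δ t1, by positivity, fun x hx t ht htd => ?_⟩
      have h1 : t < t1 := htd.trans_le (min_le_right _ _)
      have : s x t = v x t := by
        simp only [hs]
        rw [if_neg]
        rintro ⟨_, h2⟩
        linarith [h2.1]
      rw [this]
      exact h x hx t ht (htd.trans_le (min_le_left _ _))
    · intro D' t1' t2' b' ψ' hD' ht1' ht12' hψ' hsub hinitial' hbd'
      have hlev := hcls.2.2 D' t1' t2' b' ψ' hD' ht1' ht12' hψ' hsub
        (fun x hx => (hinitial' x hx).trans (hsv _ _))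
        (fun x hx t ht => (hbd' x hx t ht).trans (hsv _ _))
      intro x hx t ht
      by_cases hin : x ∈ D ∧ t ∈ Icc t1 t2
      · have hst : s x t = min (v x t) (ψ x + b * t) := by simp only [hs, if_pos hin]
        rw [hst]
        refine le_min (hlev x hx t ht) ?_
        have hmax1 : ∀ τ ∈ Icc (max t1 t1') t, τ ∈ Icc t1 t2 := fun τ hτ =>
          ⟨(le_max_left _ _).trans hτ.1, hτ.2.trans hin.2.2⟩
        have hmax2 : ∀ τ ∈ Icc (max t1 t1') t, τ ∈ Icc t1' t2' := fun τ hτ =>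
          ⟨(le_max_right _ _).trans hτ.1, hτ.2.trans ht.2⟩
        have hself : max t1 t1' ∈ Icc (max t1 t1') t := ⟨le_refl _, max_le hin.2.1 ht.1⟩
        refine classical_cmp (p := p) (D := D ∩ D') (t1 := max t1 t1') (t2 := t)
          (b := b') (b' := b) (ψ := ψ') (ψ' := ψ) (hD.inter hD') (fun y hy => hψ' y hy.2)
          (fun y hy => hψ y hy.1) (fun y hy τ hτ => hsub y hy.2 τ (hmax2 τ hτ)) ?_ ?_ ?_
          x ⟨hin.1, hx⟩ t ⟨max_le hin.2.1 ht.1, le_refl _⟩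
        · intro y hy
          rcases le_total t1 t1' with h | h
          · rw [max_eq_right h] at hself ⊢
            refine (hinitial' y hy.2).trans (hsQ y hy.1 t1' ⟨h, hself.2.trans hin.2.2⟩)
          · rw [max_eq_left h] at hself ⊢
            exact (hlev y hy.2 t1 ⟨h, hself.2.trans ht.2⟩).trans (hinitial y hy.1)
        · intro y hy τ hτ
          have hyD : y ∈ D ∩ D' := (hD.inter hD').isClosed.frontier_subset hy
          rcases frontier_inter_subset _ _ hy with h | h
          · exact (hlev y hyD.2 τ (hmax2 τ hτ)).trans (hbd y h.1 τ (hmax1 τ hτ))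
          · exact (hbd' y h.2 τ (hmax2 τ hτ)).trans (hsQ y hyD.1 τ (hmax1 τ hτ))
        · intro y hy τ hτ hlt
          have h0 := hnn y hy.1 τ (hmax1 τ hτ)
          rw [max_eq_left (h0.trans hlt.le)]
          exact hsup y hy.1 τ (hmax1 τ hτ) _ hlt.le (hlev y hy.2 τ (hmax2 τ hτ))
      · have hst : s x t = v x t := by simp only [hs, if_neg hin]
        rw [hst]
        exact hlev x hx t ht
  intro x hx t ht
  exact (vv_le hmem (ht1.trans_le ht.1)).trans (hsQ x hx t ht)

end Perron

end

section
open Real Set MeasureTheory Metric Filter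
open scoped Topology

/-- standing assumptions on the data -/
structure Dat {n : ℕ} (p : ℝ) (u₀ : Eu n → ℝ) (M : ℝ) : Prop where
  hn : 1 ≤ n
  hp : 1 ≤ p
  hM : 0 < M
  hu : ∀ x, u₀ x ≤ M
  hpos : ∀ x, 0 < u₀ x
  hc : Continuous u₀
  hmono : ∀ x y, ‖y‖ ≤ ‖x‖ → u₀ x ≤ u₀ y

section Sym
variable {n : ℕ} {p : ℝ} {u₀ : Eu n → ℝ} {M : ℝ}

theorem Dat.p0 (d : Dat p u₀ M) : 0 < p := by linarith [d.hp]
theorem Dat.cls (d : Dat p u₀ M) : Cls p u₀ (vv p u₀) := cls_vv d.p0 d.hM.le d.hu d.hc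
theorem Dat.nonneg (d : Dat p u₀ M) {x t} (ht : 0 < t) : 0 ≤ vv p u₀ x t :=
  vv_nonneg d.hM.le d.hu ht
theorem Dat.leM (d : Dat p u₀ M) {x t} (ht : 0 < t) : vv p u₀ x t ≤ M :=
  vv_le_M d.hM.le d.hu ht

theorem cmp_scale {s : Eu n → ℝ → ℝ} (hs : Cmp p s) {k μ : ℝ} (hk : 0 < k) (hμ : 0 < μ) :
    Cmp p (fun x t => k * s (μ • x) (k ^ p * μ ^ 2 * t)) := by
  intro D t1 t2 b ψ hD ht1 ht12 hψ hsub hinitial hbd x hx t ht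
  set T : Eu n ≃ₜ Eu n := Homeomorph.smulOfNeZero μ hμ.ne' with hT
  have hTa : ∀ z, T z = μ • z := fun z => rfl
  have hl : 0 < k ^ p * μ ^ 2 := by positivity
  set l := k ^ p * μ ^ 2 with hldef
  have hc : ∀ z ∈ D, ContDiffAt ℝ 2 (fun y => ψ (μ⁻¹ • y + 0)) (T z) := by
    intro z hz
    have h1 : ContDiffAt ℝ 2 (fun y : Eu n => μ⁻¹ • y + 0) (T z) := by fun_prop
    have h2 : ContDiffAt ℝ 2 ψ (μ⁻¹ • T z + 0) := by
      rw [hTa, smul_smul, inv_mul_cancel₀ hμ.ne', one_smul, add_zero]; exact hψ z hz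
    exact h2.comp (T z) h1
  have hinv : ∀ z, μ⁻¹ • T z + 0 = z := fun z => by
    rw [hTa, smul_smul, inv_mul_cancel₀ hμ.ne', one_smul, add_zero]
  have hbb : ∀ τ, b / (k * l) * (l * τ) = k⁻¹ * (b * τ) := by
    intro τ; field_simp
  have hdl : ∀ τ, l * (τ / l) = τ := fun τ => by field_simp
  have key := hs (T '' D) (l * t1) (l * t2) (b / (k * l)) (fun y => k⁻¹ * ψ (μ⁻¹ • y + 0))
    (hD.image T.continuous) (by positivity) (by gcongr) ?_ ?_ ?_ ?_ (T x) ⟨x, hx, rfl⟩ (l * t)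
    ⟨by gcongr; exact ht.1, by gcongr; exact ht.2⟩
  · simp only [hinv, hbb] at key
    rw [hTa] at key
    calc ψ x + b * t = k * (k⁻¹ * ψ x + k⁻¹ * (b * t)) := by field_simp
      _ ≤ _ := mul_le_mul_of_nonneg_left key hk.le
  · rintro _ ⟨z, hz, rfl⟩
    exact contDiffAt_const.mul (hc z hz)
  · rintro _ ⟨z, hz, rfl⟩ τ hτ
    have hτ' : τ / l ∈ Icc t1 t2 := by
      constructor
      · rw [le_div_iff₀ hl]; linarith [hτ.1]
      · rw [div_le_iff₀ hl]; linarith [hτ.2]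
    have h1 := hsub z hz (τ / l) hτ'
    rw [lap_const_mul _ (hc z hz), lap_comp_smul (x := T z) μ⁻¹ 0
      (by rw [hinv]; exact hψ z hz), hinv]
    have h2 : k⁻¹ * ψ z + b / (k * l) * τ = k⁻¹ * (ψ z + b * (τ / l)) := by field_simp
    have h3 : max (k⁻¹ * (ψ z + b * (τ / l))) 0 = k⁻¹ * max (ψ z + b * (τ / l)) 0 := by
      rw [mul_max_of_nonneg _ _ (by positivity), mul_zero]
    rw [h2, h3, Real.mul_rpow (by positivity) (le_max_right _ _), Real.inv_rpow hk.le]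
    have : (k ^ p)⁻¹ * max (ψ z + b * (τ / l)) 0 ^ p * (k⁻¹ * (μ⁻¹ ^ 2 * lap ψ z)) =
       (max (ψ z + b * (τ / l)) 0 ^ p * lap ψ z) / (k * l) := by
      rw [hldef]; field_simp
    rw [this]
    exact div_lt_div_of_pos_right h1 (by positivity)
  · rintro _ ⟨z, hz, rfl⟩
    simp only [hinv, hbb]
    have := hinitial z hz
    rw [hTa]
    calc k⁻¹ * ψ z + k⁻¹ * (b * t1) = k⁻¹ * (ψ z + b * t1) := by ring
      _ ≤ k⁻¹ * (k * s (μ • z) (l * t1)) := by gcongr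
      _ = _ := by field_simp
  · intro w hw τ hτ
    rw [← T.image_frontier] at hw
    obtain ⟨z, hz, rfl⟩ := hw
    have hτ' : τ / l ∈ Icc t1 t2 := by
      constructor
      · rw [le_div_iff₀ hl]; linarith [hτ.1]
      · rw [div_le_iff₀ hl]; linarith [hτ.2]
    have := hbd z hz (τ / l) hτ'
    simp only [hinv, hdl] at this ⊢
    have h2 : k⁻¹ * ψ z + b / (k * l) * τ = k⁻¹ * (ψ z + b * (τ / l)) := by field_simp
    rw [h2, hTa]
    calc k⁻¹ * (ψ z + b * (τ / l)) ≤ k⁻¹ * (k * s (μ • z) τ) := by gcongr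
      _ = _ := by field_simp

theorem cmp_isom {s : Eu n → ℝ → ℝ} (hs : Cmp p s) (A : Eu n ≃ₗᵢ[ℝ] Eu n) (c : Eu n) :
    Cmp p (fun x t => s (A x + c) t) := by
  intro D t1 t2 b ψ hD ht1 ht12 hψ hsub hinitial hbd x hx t ht
  set T : Eu n ≃ₜ Eu n := A.toHomeomorph.trans (Homeomorph.addRight c) with hT
  have hTa : ∀ z, T z = A z + c := fun z => rfl
  set ψ' : Eu n → ℝ := fun y => ψ (A.symm y + (- A.symm c)) with hψ'
  have hinv : ∀ z, A.symm (T z) + (- A.symm c) = z := fun z => by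
    rw [hTa]; simp
  have hc : ∀ z ∈ D, ContDiffAt ℝ 2 ψ' (T z) := by
    intro z hz
    have h1 : ContDiffAt ℝ 2 (fun y : Eu n => A.symm y + (- A.symm c)) (T z) :=
      A.symm.contDiff.contDiffAt.add contDiffAt_const
    have h2 : ContDiffAt ℝ 2 ψ (A.symm (T z) + (- A.symm c)) := by
      rw [hinv]; exact hψ z hz
    exact h2.comp (T z) h1
  have hψz : ∀ z, ψ' (T z) = ψ z := fun z => by simp only [hψ']; rw [hinv]
  have key := hs (T '' D) t1 t2 b ψ' (hD.image T.continuous) ht1 ht12 ?_ ?_ ?_ ?_ (T x)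
    ⟨x, hx, rfl⟩ t ht
  · rw [hψz] at key; exact key
  · rintro _ ⟨z, hz, rfl⟩; exact hc z hz
  · rintro _ ⟨z, hz, rfl⟩ τ hτ
    have h1 : lap ψ' (T z) = lap ψ z := by
      have := lap_comp_isometry (f := ψ) (x := T z) A.symm (- A.symm c)
        (by rw [hinv]; exact hψ z hz)
      rw [hinv] at this
      exact this
    rw [hψz, h1]
    exact hsub z hz τ hτ
  · rintro _ ⟨z, hz, rfl⟩
    rw [hψz]; exact hinitial z hz
  · intro w hw τ hτ
    rw [← T.image_frontier] at hw
    obtain ⟨z, hz, rfl⟩ := hw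
    rw [hψz]; exact hbd z hz τ hτ

/-- Aronson-Benilan type monotonicity -/
theorem Dat.AB (d : Dat p u₀ M) {l : ℝ} (hl : 1 ≤ l) (x : Eu n) {t : ℝ} (ht : 0 < t) :
    vv p u₀ x t ≤ l ^ (1 / p) * vv p u₀ x (l * t) := by
  have hl0 : 0 < l := by linarith
  have hk : 0 < l ^ (1 / p) := by positivity
  have hkp : (l ^ (1 / p)) ^ p * (1:ℝ) ^ 2 = l := by
    rw [← Real.rpow_mul hl0.le, one_div, inv_mul_cancel₀ d.p0.ne']; simp
  have hk1 : 1 ≤ l ^ (1 / p) := Real.one_le_rpow hl (by have := d.p0; positivity)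
  have h := cmp_scale d.cls.2.2 hk one_pos
  simp only [hkp, one_smul] at h
  refine vv_le (s := fun x t => l ^ (1 / p) * vv p u₀ x (l * t)) ⟨fun x t ht => ?_, ?_, h⟩ ht
  · exact mul_nonneg hk.le (d.nonneg (by positivity))
  · intro R ε hε
    obtain ⟨δ, hδ, h⟩ := d.cls.2.1 R ε hε
    refine ⟨δ / l, by positivity, fun x hx t ht htd => ?_⟩
    rw [lt_div_iff₀ hl0] at htd
    have h1 := h x hx (l * t) (by positivity) (by linarith)
    have h2 := d.nonneg (x := x) (t := l * t) (by positivity)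
    simp only
    nlinarith

theorem Dat.scale (d : Dat p u₀ M) {μ : ℝ} (hμ : 0 < μ) (hμ1 : μ ≤ 1) (x : Eu n) {t : ℝ}
    (ht : 0 < t) : vv p u₀ x t ≤ vv p u₀ (μ • x) (μ ^ 2 * t) := by
  have h := cmp_scale d.cls.2.2 one_pos hμ
  simp only [Real.one_rpow, one_mul] at h
  refine vv_le (s := fun x t => vv p u₀ (μ • x) (μ ^ 2 * t)) ⟨fun x t ht => ?_, ?_, h⟩ ht
  · exact d.nonneg (by positivity)
  · intro R ε hε
    obtain ⟨δ, hδ, h⟩ := d.cls.2.1 R ε hε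
    refine ⟨δ, by positivity, fun x hx t ht htd => ?_⟩
    have hn : ‖μ • x‖ ≤ ‖x‖ := by
      rw [norm_smul, Real.norm_of_nonneg hμ.le]
      exact mul_le_of_le_one_left (norm_nonneg _) hμ1
    have hμ2 : μ ^ 2 * t ≤ t := mul_le_of_le_one_left ht.le (pow_le_one₀ hμ.le hμ1)
    have h1 := h (μ • x) (hn.trans hx) (μ ^ 2 * t) (by positivity) (by linarith)
    linarith [d.hmono x (μ • x) hn]

theorem Dat.mono (d : Dat p u₀ M) {x y : Eu n} (hxy : ‖y‖ ≤ ‖x‖) {t : ℝ} (ht : 0 < t) :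
    vv p u₀ x t ≤ vv p u₀ y t := by
  classical
  by_cases hne : x = y
  · rw [hne]
  set v := vv p u₀ with hv
  set e := x - y with he
  have he0 : e ≠ 0 := sub_ne_zero.2 hne
  have hen : 0 < ‖e‖ ^ 2 := by have := norm_pos_iff.2 he0; positivity
  set m : Eu n := (2:ℝ)⁻¹ • (x + y) with hm
  set A : Eu n ≃ₗᵢ[ℝ] Eu n := Submodule.reflection (Submodule.span ℝ {e})ᗮ with hA
  have hAf : ∀ z, A z = z - (2 * (inner ℝ e z / ‖e‖ ^ 2)) • e := by
    intro z
    rw [hA, Submodule.reflection_orthogonal_apply, Submodule.reflection_singleton_apply]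
    simp only [RCLike.ofReal_real_eq_id, id]
    module
  set c : Eu n := (2 * (inner ℝ e m / ‖e‖ ^ 2)) • e with hcdef
  set a : Eu n → ℝ := fun z => inner ℝ e (z - m) / ‖e‖ ^ 2 with ha
  have hR : ∀ z, A z + c = z - (2 * a z) • e := by
    intro z
    rw [hAf, hcdef, ha]
    simp only [inner_sub_right, sub_div]
    module
  have haz : ∀ z, a z * ‖e‖ ^ 2 = (‖z - y‖ ^ 2 - ‖z - x‖ ^ 2) / 2 := by
    intro z
    simp only [ha, div_mul_cancel₀ _ hen.ne']
    rw [norm_sub_sq_real, norm_sub_sq_real, he, hm]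
    simp only [inner_sub_left, inner_sub_right, inner_add_right, inner_smul_right, real_inner_self_eq_norm_sq]
    rw [real_inner_comm x z, real_inner_comm y z, real_inner_comm x y]
    ring
  have hme : inner ℝ e m = (‖x‖ ^ 2 - ‖y‖ ^ 2) / 2 := by
    rw [he, hm]
    simp only [inner_sub_left, inner_add_right, inner_smul_right, real_inner_self_eq_norm_sq]
    rw [real_inner_comm x y]
    ring
  have hme0 : 0 ≤ inner ℝ e m := by
    rw [hme]
    have := pow_le_pow_left₀ (norm_nonneg y) hxy 2
    linarith
  have hRn : ∀ z, 0 ≤ a z → ‖A z + c‖ ≤ ‖z‖ := by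
    intro z hz
    have h1 : ‖A z + c‖ ^ 2 ≤ ‖z‖ ^ 2 := by
      rw [hR, norm_sub_sq_real, inner_smul_right, norm_smul, mul_pow, Real.norm_eq_abs, sq_abs]
      have h2 : inner ℝ e z = a z * ‖e‖ ^ 2 + inner ℝ e m := by
        simp only [ha, div_mul_cancel₀ _ hen.ne', inner_sub_right]; ring
      rw [real_inner_comm z e] at h2
      rw [h2]
      nlinarith [mul_nonneg hz hme0]
    exact (pow_le_pow_iff_left₀ (norm_nonneg _) (norm_nonneg _) two_ne_zero).1 h1
  have hRfix : ∀ z, a z = 0 → A z + c = z := by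
    intro z hz; rw [hR, hz]; simp
  have hacont : Continuous a := by
    simp only [ha]; fun_prop
  set s : Eu n → ℝ → ℝ := fun z t => if 0 < a z then min (v z t) (v (A z + c) t) else v z t with hs
  have hsv : ∀ x t, s x t ≤ v x t := by
    intro x t
    simp only [hs]
    split_ifs
    · exact min_le_left _ _
    · exact le_refl _
  have hsR : ∀ z, 0 ≤ a z → ∀ t, s z t ≤ v (A z + c) t := by
    intro z hz t
    rcases hz.lt_or_eq with h | h
    · simp only [hs, if_pos h]; exact min_le_right _ _
    · rw [hRfix z h.symm]; exact hsv z t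
  have hmem : Cls p u₀ s := by
    refine ⟨fun z t ht => ?_, fun R ε hε => ?_, ?_⟩
    · simp only [hs]
      split_ifs with h
      · exact le_min (d.nonneg ht) (d.nonneg ht)
      · exact d.nonneg ht
    · obtain ⟨δ, hδ, h⟩ := d.cls.2.1 R ε hε
      refine ⟨δ, hδ, fun z hz t ht htd => ?_⟩
      simp only [hs]
      split_ifs with h2
      · refine le_min (h z hz t ht htd) ?_
        have h3 := h (A z + c) ((hRn z h2.le).trans hz) t ht htd
        linarith [d.hmono z (A z + c) (hRn z h2.le)]
      · exact h z hz t ht htd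
    · intro D t1 t2 b ψ hD ht1 ht12 hψ hsub hinitial hbd
      have hlev := d.cls.2.2 D t1 t2 b ψ hD ht1 ht12 hψ hsub
        (fun x hx => (hinitial x hx).trans (hsv _ _))
        (fun x hx t ht => (hbd x hx t ht).trans (hsv _ _))
      have hNcl : IsClosed {z | 0 ≤ a z} := isClosed_le continuous_const hacont
      have hD1 : IsCompact (D ∩ {z | 0 ≤ a z}) := hD.inter_right hNcl
      have hleR := cmp_isom d.cls.2.2 A c (D ∩ {z | 0 ≤ a z}) t1 t2 b ψ hD1 ht1 ht12
        (fun z hz => hψ z hz.1) (fun z hz => hsub z hz.1)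
        (fun z hz => (hinitial z hz.1).trans (hsR z hz.2 t1)) (fun z hz t ht => by
          have hzD := hD1.isClosed.frontier_subset hz
          rcases frontier_inter_subset _ _ hz with h | h
          · exact (hbd z h.1 t ht).trans (hsR z hzD.2 t)
          · have h2 : 0 = a z := frontier_le_subset_eq continuous_const hacont h.2
            simp only [hRfix z h2.symm]
            exact hlev z hzD.1 t ht)
      intro z hz t ht
      simp only [hs]
      split_ifs with h2
      · exact le_min (hlev z hz t ht) (hleR z ⟨hz, h2.le⟩ t ht)
      · exact hlev z hz t ht
  have hax : a x = 1 / 2 := by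
    have := haz x
    simp only [sub_self, norm_zero] at this
    rw [← he] at this
    have h3 : a x * ‖e‖ ^ 2 = 1 / 2 * ‖e‖ ^ 2 := by rw [this]; ring
    exact mul_right_cancel₀ hen.ne' h3
  have h1 := vv_le hmem (x := x) ht
  have h2 := h1.trans (hsR x (by rw [hax]; norm_num) t)
  rw [hR, hax, he] at h2
  simpa using h2

theorem Dat.pos (d : Dat p u₀ M) (x : Eu n) {t : ℝ} (ht : 0 < t) : 0 < vv p u₀ x t := by
  obtain ⟨δ, hδ, h⟩ := d.cls.2.1 ‖x‖ (u₀ x / 2) (by linarith [d.hpos x])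
  set s := min (δ / 2) t with hs
  have hs0 : 0 < s := by positivity
  have h1 := h x le_rfl s hs0 ((min_le_left _ _).trans_lt (by linarith))
  have h2 := d.AB (l := t / s) (by rw [one_le_div hs0]; exact min_le_right _ _) x hs0
  rw [div_mul_cancel₀ _ hs0.ne'] at h2
  have h3 : 0 < (t / s) ^ (1 / p) * vv p u₀ x t := by linarith [d.hpos x]
  exact pos_of_mul_pos_right h3 (by positivity)

end Sym

end

section
open Real Set MeasureTheory Metric Filter
open scoped Topology

section Touch
variable {n : ℕ} {p : ℝ} {u₀ : Eu n → ℝ} {M : ℝ}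

theorem lap_add_quad {ψ : Eu n → ℝ} {x : Eu n} (hψ : ContDiffAt ℝ 2 ψ x) (x0 : Eu n) (m A : ℝ) :
    lap (fun y => ψ y + (m + A * ‖y - x0‖ ^ 2)) x = lap ψ x + A * (2 * n) := by
  rw [lap_add hψ (contDiff_quad _ _ _).contDiffAt, lap_quad]

/-- touching from below -/
theorem Dat.superTouch (d : Dat p u₀ M) {x0 : Eu n} {t0 b r : ℝ} {ψ : Eu n → ℝ} (ht0 : 0 < t0)
    (hr : 0 < r) (hψ : ContDiffAt ℝ 2 ψ x0) (heq : ψ x0 + b * t0 = vv p u₀ x0 t0)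
    (hle : ∀ x ∈ ball x0 r, ∀ t ∈ Ioc (t0 - r) t0, 0 < t → ψ x + b * t ≤ vv p u₀ x t) :
    vv p u₀ x0 t0 ^ p * lap ψ x0 ≤ b := by
  by_contra hcon
  push Not at hcon
  have hp := d.p0
  have hv0 := d.nonneg (x := x0) ht0
  -- parameter space (x, t, η, δ)
  set Φ : Eu n × ℝ × ℝ × ℝ → ℝ := fun z =>
    (max (ψ z.1 - z.2.2.1 * ‖z.1 - x0‖ ^ 2 + (b + z.2.2.1) * z.2.1 - z.2.2.1 * t0 + z.2.2.2) 0) ^ p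
      * (lap ψ z.1 - z.2.2.1 * (2 * n)) - (b + z.2.2.1) with hΦ
  have hc0 : ContinuousAt (fun z : Eu n × ℝ × ℝ × ℝ => ψ z.1) (x0, t0, 0, 0) :=
    ContinuousAt.comp (g := ψ) (f := Prod.fst) hψ.continuousAt continuousAt_fst
  have hc1 : ContinuousAt (fun z : Eu n × ℝ × ℝ × ℝ => lap ψ z.1) (x0, t0, 0, 0) :=
    ContinuousAt.comp (g := lap ψ) (f := Prod.fst) hψ.continuousAt_lap continuousAt_fst
  have hcont : ContinuousAt Φ (x0, t0, 0, 0) := by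
    refine ContinuousAt.sub (ContinuousAt.mul (ContinuousAt.rpow_const ?_ (Or.inr hp.le)) ?_) ?_
    · refine Filter.Tendsto.max (?_ : ContinuousAt _ _) continuousAt_const
      fun_prop
    · fun_prop
    · fun_prop
  have hΦ0 : 0 < Φ (x0, t0, 0, 0) := by
    simp only [hΦ, sub_self, norm_zero]
    have : ψ x0 - 0 * 0 ^ 2 + (b + 0) * t0 - 0 * t0 + 0 = vv p u₀ x0 t0 := by linarith
    rw [this, max_eq_left hv0]
    linarith
  have hev := hcont.eventually (lt_mem_nhds hΦ0)
  have hevψ : ∀ᶠ z : Eu n × ℝ × ℝ × ℝ in 𝓝 (x0, t0, 0, 0), ContDiffAt ℝ 2 ψ z.1 :=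
    continuousAt_fst.eventually (hψ.eventually (by simp))
  obtain ⟨ρ, hρ, hball⟩ := Metric.eventually_nhds_iff_ball.1 (hev.and hevψ)
  set a := min (min ρ r) (min 1 t0) / 2 with ha
  have ha0 : 0 < a := by positivity
  have h2a : 2 * a = min (min ρ r) (min 1 t0) := by rw [ha]; ring
  have haρ : 2 * a ≤ ρ := by rw [h2a]; exact (min_le_left _ _).trans (min_le_left _ _)
  have har : 2 * a ≤ r := by rw [h2a]; exact (min_le_left _ _).trans (min_le_right _ _)
  have ha1 : 2 * a ≤ 1 := by rw [h2a]; exact (min_le_right _ _).trans (min_le_left _ _)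
  have hat : 2 * a ≤ t0 := by rw [h2a]; exact (min_le_right _ _).trans (min_le_right _ _)
  set δ := a * a ^ 2 with hδ
  have hδ0 : 0 < δ := by positivity
  have ha2 : a ^ 2 ≤ a := by nlinarith
  have hδa : δ ≤ a := by nlinarith
  have hin : ∀ x ∈ closedBall x0 a, ∀ t ∈ Icc (t0 - a) t0,
      ((x, t, a, δ) : Eu n × ℝ × ℝ × ℝ) ∈ ball ((x0, t0, 0, 0) : Eu n × ℝ × ℝ × ℝ) ρ := by
    intro x hx t ht
    rw [mem_ball, Prod.dist_eq, Prod.dist_eq, Prod.dist_eq]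
    have h1 : dist x x0 ≤ a := hx
    have h2 : dist t t0 ≤ a := by rw [Real.dist_eq, abs_le]; constructor <;> linarith [ht.1, ht.2]
    have h3 : dist a 0 ≤ a := by rw [Real.dist_eq, sub_zero, abs_of_pos ha0]
    have h4 : dist δ 0 ≤ a := by rw [Real.dist_eq, sub_zero, abs_of_pos hδ0]; exact hδa
    have : max (dist x x0) (max (dist t t0) (max (dist a 0) (dist δ 0))) ≤ a :=
      max_le h1 (max_le h2 (max_le h3 h4))
    simp only
    linarith
  set φ : Eu n → ℝ := fun y => ψ y + ((- a * t0 + δ) + (- a) * ‖y - x0‖ ^ 2) with hφ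
  have hφlap : ∀ x, ContDiffAt ℝ 2 ψ x → lap φ x = lap ψ x - a * (2 * n) := by
    intro x hx
    rw [hφ, lap_add_quad hx]; ring
  have ht0self : t0 ∈ Icc (t0 - a) t0 := ⟨by linarith, le_rfl⟩
  have key := d.cls.2.2 (closedBall x0 a) (t0 - a) t0 (b + a) φ (isCompact_closedBall _ _)
    (by linarith) (by linarith)
    (fun x hx => ((hball _ (hin x hx t0 ht0self)).2).add (contDiff_quad _ _ _).contDiffAt)
    ?_ ?_ ?_ x0 (mem_closedBall_self ha0.le) t0 ht0self
  · simp only [hφ, sub_self, norm_zero] at key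
    nlinarith
  · intro x hx t ht
    obtain ⟨h1, h2⟩ := hball _ (hin x hx t ht)
    rw [hφlap x h2]
    simp only [hΦ] at h1
    have : φ x + (b + a) * t = ψ x - a * ‖x - x0‖ ^ 2 + (b + a) * t - a * t0 + δ := by
      simp only [hφ]; ring
    rw [this]
    linarith
  · intro x hx
    have h1 := hle x (by rw [mem_ball]; have : dist x x0 ≤ a := hx; linarith) (t0 - a)
      ⟨by linarith, by linarith⟩ (by linarith)
    simp only [hφ]
    have : 0 ≤ a * ‖x - x0‖ ^ 2 := by positivity
    nlinarith
  · intro x hx t ht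
    rw [frontier_closedBall _ ha0.ne'] at hx
    have hxn : ‖x - x0‖ = a := by simpa [dist_eq_norm] using hx
    have hxd : dist x x0 = a := hx
    have h1 := hle x (by rw [mem_ball]; linarith) t
      ⟨by linarith [ht.1], ht.2⟩ (by linarith [ht.1])
    simp only [hφ, hxn]
    nlinarith [ht.2]

/-- touching from above -/
theorem Dat.subTouch (d : Dat p u₀ M) {x0 : Eu n} {t0 b r : ℝ} {ψ : Eu n → ℝ} (ht0 : 0 < t0)
    (hr : 0 < r) (hψ : ContDiffAt ℝ 2 ψ x0) (heq : ψ x0 + b * t0 = vv p u₀ x0 t0)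
    (hle : ∀ x ∈ ball x0 r, ∀ t ∈ Ioc (t0 - r) t0, 0 < t → vv p u₀ x t ≤ ψ x + b * t) :
    b ≤ vv p u₀ x0 t0 ^ p * lap ψ x0 := by
  by_contra hcon
  push Not at hcon
  have hp := d.p0
  have hv0 := d.pos x0 ht0
  set v0 := vv p u₀ x0 t0 with hv0def
  set Φ : Eu n × ℝ × ℝ → ℝ := fun z =>
    (b - z.2.2) - z.2.1 ^ p * (lap ψ z.1 + z.2.2 * (2 * n)) with hΦ
  have hc1 : ContinuousAt (fun z : Eu n × ℝ × ℝ => lap ψ z.1) (x0, v0, 0) :=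
    ContinuousAt.comp (g := lap ψ) (f := Prod.fst) hψ.continuousAt_lap continuousAt_fst
  have hcont : ContinuousAt Φ (x0, v0, 0) := by
    refine ContinuousAt.sub ?_ (ContinuousAt.mul (ContinuousAt.rpow_const ?_ (Or.inr hp.le)) ?_)
    · fun_prop
    · fun_prop
    · fun_prop
  have hΦ0 : 0 < Φ (x0, v0, 0) := by
    simp only [hΦ]
    linarith
  have hev := hcont.eventually (lt_mem_nhds hΦ0)
  obtain ⟨ρ, hρ, hball⟩ := Metric.eventually_nhds_iff_ball.1 hev
  -- second family
  set Ψ : Eu n × ℝ × ℝ × ℝ → ℝ := fun z =>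
    ψ z.1 + z.2.2.1 * ‖z.1 - x0‖ ^ 2 + (b - z.2.2.1) * z.2.1 + z.2.2.1 * t0 - z.2.2.2 with hΨ
  have hc0 : ContinuousAt (fun z : Eu n × ℝ × ℝ × ℝ => ψ z.1) (x0, t0, 0, 0) :=
    ContinuousAt.comp (g := ψ) (f := Prod.fst) hψ.continuousAt continuousAt_fst
  have hcont2 : ContinuousAt Ψ (x0, t0, 0, 0) := by
    fun_prop
  have hcont3 : ContinuousAt (fun z : Eu n × ℝ × ℝ × ℝ => ψ z.1 + b * z.2.1) (x0, t0, 0, 0) := by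
    fun_prop
  have hΨ0 : Ψ (x0, t0, 0, 0) = v0 := by
    simp only [hΨ, sub_self, norm_zero]; linarith
  set ρ' := min ρ v0 with hρ'
  have hρ'0 : 0 < ρ' := by positivity
  have hev2 : ∀ᶠ z in 𝓝 (x0, t0, 0, 0), Ψ z ∈ ball v0 ρ' :=
    hcont2.eventually (by rw [hΨ0]; exact ball_mem_nhds _ hρ'0)
  have hev3 : ∀ᶠ z : Eu n × ℝ × ℝ × ℝ in 𝓝 (x0, t0, 0, 0), ψ z.1 + b * z.2.1 ∈ ball v0 ρ' :=
    hcont3.eventually (by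
      simp only [heq]; exact ball_mem_nhds _ hρ'0)
  have hevψ : ∀ᶠ z : Eu n × ℝ × ℝ × ℝ in 𝓝 (x0, t0, 0, 0), ContDiffAt ℝ 2 ψ z.1 :=
    continuousAt_fst.eventually (hψ.eventually (by simp))
  obtain ⟨σ, hσ, hball2⟩ := Metric.eventually_nhds_iff_ball.1 (hev2.and (hev3.and hevψ))
  set a := min (min (min ρ σ) r) (min 1 t0) / 2 with ha
  have ha0 : 0 < a := by positivity
  have h2a : 2 * a = min (min (min ρ σ) r) (min 1 t0) := by rw [ha]; ring
  have haρ : 2 * a ≤ ρ := by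
    rw [h2a]; exact (min_le_left _ _).trans ((min_le_left _ _).trans (min_le_left _ _))
  have haσ : 2 * a ≤ σ := by
    rw [h2a]; exact (min_le_left _ _).trans ((min_le_left _ _).trans (min_le_right _ _))
  have har : 2 * a ≤ r := by rw [h2a]; exact (min_le_left _ _).trans (min_le_right _ _)
  have ha1 : 2 * a ≤ 1 := by rw [h2a]; exact (min_le_right _ _).trans (min_le_left _ _)
  have hat : 2 * a ≤ t0 := by rw [h2a]; exact (min_le_right _ _).trans (min_le_right _ _)
  set δ := a * a ^ 2 with hδ
  have hδ0 : 0 < δ := by positivity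
  have ha2 : a ^ 2 ≤ a := by nlinarith
  have hδa : δ ≤ a := by nlinarith
  have hin : ∀ x ∈ closedBall x0 a, ∀ t ∈ Icc (t0 - a) t0,
      ((x, t, a, δ) : Eu n × ℝ × ℝ × ℝ) ∈ ball ((x0, t0, 0, 0) : Eu n × ℝ × ℝ × ℝ) σ := by
    intro x hx t ht
    rw [mem_ball, Prod.dist_eq, Prod.dist_eq, Prod.dist_eq]
    have h1 : dist x x0 ≤ a := hx
    have h2 : dist t t0 ≤ a := by rw [Real.dist_eq, abs_le]; constructor <;> linarith [ht.1, ht.2]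
    have h3 : dist a 0 ≤ a := by rw [Real.dist_eq, sub_zero, abs_of_pos ha0]
    have h4 : dist δ 0 ≤ a := by rw [Real.dist_eq, sub_zero, abs_of_pos hδ0]; exact hδa
    have : max (dist x x0) (max (dist t t0) (max (dist a 0) (dist δ 0))) ≤ a :=
      max_le h1 (max_le h2 (max_le h3 h4))
    simp only
    linarith
  set φ : Eu n → ℝ := fun y => ψ y + ((a * t0 - δ) + a * ‖y - x0‖ ^ 2) with hφ
  have hφΨ : ∀ x t, φ x + (b - a) * t = Ψ (x, t, a, δ) := by
    intro x t; simp only [hφ, hΨ]; ring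
  have ht0self : t0 ∈ Icc (t0 - a) t0 := ⟨by linarith, le_rfl⟩
  have hvle : ∀ x ∈ closedBall x0 a, ∀ t ∈ Icc (t0 - a) t0, vv p u₀ x t ≤ ψ x + b * t := by
    intro x hx t ht
    exact hle x (by rw [mem_ball]; have : dist x x0 ≤ a := hx; linarith) t
      ⟨by linarith [ht.1], ht.2⟩ (by linarith [ht.1])
  have key := sub_cmp (p := p) hp d.hM.le d.hu d.hc (D := closedBall x0 a) (t1 := t0 - a) (t2 := t0)
    (b := b - a) (ψ := φ) (isCompact_closedBall _ _)
    (by linarith)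
    (fun x hx => ((hball2 _ (hin x hx t0 ht0self)).2.2).add (contDiff_quad _ _ _).contDiffAt)
    ?_ ?_ ?_ ?_ x0 (mem_closedBall_self ha0.le) t0 ht0self
  · simp only [hφ, sub_self, norm_zero] at key
    nlinarith
  · intro x hx t ht
    rw [hφΨ]
    have h1 := (hball2 _ (hin x hx t ht)).1
    rw [mem_ball, Real.dist_eq, abs_lt] at h1
    have : ρ' ≤ v0 := min_le_right _ _
    linarith [h1.1]
  · intro x hx
    have h1 := hvle x hx (t0 - a) ⟨le_rfl, by linarith⟩
    simp only [hφ]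
    have : 0 ≤ a * ‖x - x0‖ ^ 2 := by positivity
    nlinarith
  · intro x hx t ht
    have h1 := hvle x (isClosed_closedBall.frontier_subset hx) t ht
    rw [frontier_closedBall _ ha0.ne'] at hx
    have hxn : ‖x - x0‖ = a := by simpa [dist_eq_norm] using hx
    simp only [hφ, hxn]
    nlinarith [ht.2]
  · intro x hx t ht q hq1 hq2
    obtain ⟨h1, h2, h3⟩ := hball2 _ (hin x hx t ht)
    rw [hφΨ] at hq1
    have h4 := hvle x hx t ht
    simp only [mem_ball, Real.dist_eq, abs_lt] at h1 h2
    have hρρ : ρ' ≤ ρ := min_le_left _ _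
    have hmem : ((x, q, a) : Eu n × ℝ × ℝ) ∈ ball ((x0, v0, 0) : Eu n × ℝ × ℝ) ρ := by
      rw [mem_ball, Prod.dist_eq, Prod.dist_eq]
      have g1 : dist x x0 < ρ := by have : dist x x0 ≤ a := hx; linarith
      have g2 : dist q v0 < ρ := by
        rw [Real.dist_eq, abs_lt]; constructor <;> linarith [h1.1, h2.2]
      have g3 : dist a 0 < ρ := by rw [Real.dist_eq, sub_zero, abs_of_pos ha0]; linarith
      exact max_lt g1 (max_lt g2 g3)
    have h5 := hball _ hmem
    simp only [hΦ] at h5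
    rw [hφ, lap_add_quad h3]
    linarith

theorem Dat.time_lower (d : Dat p u₀ M) (x : Eu n) {s t : ℝ} (hs : 0 < s) (hst : s ≤ t) :
    s / t * vv p u₀ x s ≤ vv p u₀ x t := by
  have ht : 0 < t := by linarith
  have h1 := d.AB (l := t / s) (by rwa [one_le_div hs]) x hs
  rw [div_mul_cancel₀ _ hs.ne'] at h1
  have h2 : (t / s) ^ (1 / p) ≤ t / s := by
    have : (t / s) ^ (1 / p) ≤ (t / s) ^ (1:ℝ) := by
      apply Real.rpow_le_rpow_of_exponent_le (by rwa [one_le_div hs])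
      rw [div_le_one d.p0]; exact d.hp
    simpa using this
  have h3 : vv p u₀ x s ≤ t / s * vv p u₀ x t :=
    h1.trans (mul_le_mul_of_nonneg_right h2 (d.nonneg ht))
  calc s / t * vv p u₀ x s ≤ s / t * (t / s * vv p u₀ x t) := by gcongr
    _ = _ := by field_simp

theorem Dat.time_lower' (d : Dat p u₀ M) (x : Eu n) {s t : ℝ} (hs : 0 < s) (hst : s ≤ t)
    (_ : t ≤ 2 * s) : vv p u₀ x s ≤ vv p u₀ x t + 2 * M / t * (t - s) := by
  have ht : 0 < t := by linarith
  have h1 := d.time_lower x hs hst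
  have hM := d.leM (x := x) hs
  have h0 := d.nonneg (x := x) hs
  have : s / t * vv p u₀ x s = vv p u₀ x s - (t - s) / t * vv p u₀ x s := by field_simp; ring
  have h3 : (t - s) / t * vv p u₀ x s ≤ (t - s) / t * M := by
    have : 0 ≤ (t - s) / t := div_nonneg (by linarith) ht.le
    gcongr
  have h4 : 2 * M / t * (t - s) = 2 * ((t - s) / t * M) := by ring
  have h5 : 0 ≤ (t - s) / t * M := mul_nonneg (div_nonneg (by linarith) ht.le) d.hM.le
  linarith

/-- gradient estimate -/
theorem Dat.grad (d : Dat p u₀ M) {x y : Eu n} (hxy : ‖x‖ ≤ ‖y‖) {t C : ℝ} (ht : 0 < t)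
    (hC : 3 * M / t ≤ C * vv p u₀ y t ^ p) :
    vv p u₀ x t ≤ vv p u₀ y t + C / (2 * n) * (‖y‖ ^ 2 - ‖x‖ ^ 2) := by
  by_contra hcon
  push Not at hcon
  have hn : (0:ℝ) < n := by have := d.hn; positivity
  have hM := d.hM
  set h2 := vv p u₀ y t with hh2
  have hh2p : 0 < h2 := d.pos y ht
  have hC0 : 0 ≤ C := by
    by_contra hneg
    push Not at hneg
    have : C * h2 ^ p < 0 := mul_neg_of_neg_of_pos hneg (by positivity)
    have : 0 < 3 * M / t := by positivity
    linarith
  set r := ‖y‖ with hr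
  have hr0 : 0 < r := by
    rcases (norm_nonneg y).lt_or_eq with h | h
    · exact h
    · exfalso
      have hx0 : ‖x‖ = 0 := le_antisymm (by rw [h]; exact hxy) (norm_nonneg x)
      have hy0 : y = 0 := norm_eq_zero.1 h.symm
      have hx0' : x = 0 := norm_eq_zero.1 hx0
      rw [hh2, hr, hx0', hy0] at hcon
      simp at hcon
  set f : Eu n → ℝ := fun z => vv p u₀ z t - h2 - C / (2 * n) * (r ^ 2 - ‖z‖ ^ 2) with hf
  set S := f '' closedBall 0 r with hS
  have hbdd : BddAbove S := by
    refine ⟨M, ?_⟩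
    rintro _ ⟨z, hz, rfl⟩
    have hz' : ‖z‖ ≤ r := by simpa using hz
    have h1 : 0 ≤ C / (2 * n) * (r ^ 2 - ‖z‖ ^ 2) := by
      have := pow_le_pow_left₀ (norm_nonneg z) hz' 2
      apply mul_nonneg (by positivity) (by linarith)
    have := d.leM (x := z) ht
    simp only [hf]; linarith
  set m := sSup S with hm
  have hfm : ∀ z, ‖z‖ ≤ r → f z ≤ m := fun z hz => le_csSup hbdd ⟨z, by simpa using hz, rfl⟩
  have hm0 : 0 < m := by
    have := hfm x hxy
    simp only [hf] at this
    linarith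
  set δ := min m (M / 2) with hδ
  have hδ0 : 0 < δ := by positivity
  have hδm : δ ≤ m := min_le_left _ _
  have hδM : δ ≤ M / 2 := min_le_right _ _
  have hlapψ : ∀ z, lap (fun z : Eu n => (h2 + C / (2 * n) * r ^ 2 + m - δ + 3 * M / t * t) +
      (-(C / (2 * n))) * ‖z - 0‖ ^ 2) z = - C := by
    intro z; rw [lap_quad]; field_simp
  have hball : ∀ z ∈ closedBall (0 : Eu n) r, ‖z‖ ≤ r := fun z hz => by simpa using hz
  have hMt : 3 * M / t * t = 3 * M := by field_simp
  have hMt2 : 3 * M / t * (t / 2) = 3 * M / 2 := by field_simp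
  have hMt3 : 2 * M / t * (t / 2) = M := by field_simp
  have key := sub_cmp (p := p) d.p0 hM.le d.hu d.hc (D := closedBall 0 r) (t1 := t / 2)
    (t2 := t) (b := - (3 * M / t)) (ψ := fun z : Eu n => (h2 + C / (2 * n) * r ^ 2 + m - δ +
      3 * M / t * t) + (-(C / (2 * n))) * ‖z - 0‖ ^ 2)
    (isCompact_closedBall _ _) (by linarith) (fun z _ => (contDiff_quad _ _ _).contDiffAt)
    ?_ ?_ ?_ ?_
  · -- conclude
    have : m ≤ m - δ := by
      refine csSup_le (s := S) ⟨f x, x, by simpa using hxy, rfl⟩ ?_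
      rintro _ ⟨z, hz, rfl⟩
      have := key z hz t ⟨by linarith, le_rfl⟩
      simp only [sub_zero] at this
      simp only [hf]
      nlinarith
    linarith
  · intro z hz s hs
    have h1 := pow_le_pow_left₀ (norm_nonneg z) (hball z hz) 2
    have h3 : 0 ≤ C / (2 * n) * (r ^ 2 - ‖z‖ ^ 2) := mul_nonneg (by positivity) (by linarith)
    have h4 : 0 ≤ 3 * M / t * (t - s) := mul_nonneg (by positivity) (by linarith [hs.2])
    simp only [sub_zero]
    nlinarith
  · intro z hz
    have h1 := d.time_lower' z (s := t / 2) (t := t) (by linarith) (by linarith) (by linarith)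
    have h3 := hfm z (hball z hz)
    simp only [hf] at h3
    simp only [sub_zero]
    rw [show t - t / 2 = t / 2 by ring, hMt3] at h1
    nlinarith
  · intro z hz s hs
    rw [frontier_closedBall _ hr0.ne'] at hz
    have hz' : ‖z‖ = r := by simpa using hz
    have h1 := d.time_lower' z (s := s) (t := t) (by linarith [hs.1]) hs.2 (by linarith [hs.1])
    have h3 : vv p u₀ z t ≤ h2 := d.mono (by rw [hz']) ht
    have h4 : 2 * M / t * (t - s) ≤ 3 * M / t * (t - s) := by
      have : 0 ≤ t - s := by linarith [hs.2]
      gcongr; norm_num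
    simp only [sub_zero, hz']
    nlinarith
  · intro z hz s hs q hq _
    rw [hlapψ]
    have h1 := pow_le_pow_left₀ (norm_nonneg z) (hball z hz) 2
    have h3 : 0 ≤ C / (2 * n) * (r ^ 2 - ‖z‖ ^ 2) := mul_nonneg (by positivity) (by linarith)
    have h4 : 0 ≤ 3 * M / t * (t - s) := mul_nonneg (by positivity) (by linarith [hs.2])
    simp only [sub_zero] at hq
    have h5 : h2 ≤ q := by nlinarith
    have h6 : h2 ^ p ≤ q ^ p := Real.rpow_le_rpow hh2p.le h5 d.p0.le
    nlinarith

end Touch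

end

section
open Real Set MeasureTheory Metric Filter
open scoped Topology

variable {n : ℕ} {p M : ℝ} {u₀ : Eu n → ℝ}

theorem Dat.exists_unit (d : Dat p u₀ M) : ∃ e : Eu n, ‖e‖ = 1 :=
  ⟨EuclideanSpace.single ⟨0, d.hn⟩ 1, by simp⟩

theorem Dat.loc (d : Dat p u₀ M) {R t1 t2 : ℝ} (hR : 0 < R) (ht1 : 0 < t1) (ht12 : t1 ≤ t2) :
    ∃ K > (0:ℝ), ∃ c > (0:ℝ),
      (∀ x, ‖x‖ ≤ R → ∀ t ∈ Icc t1 t2, c ≤ vv p u₀ x t) ∧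
      (∀ x y, ‖x‖ ≤ ‖y‖ → ‖y‖ ≤ R → ∀ t ∈ Icc t1 t2,
        vv p u₀ x t ≤ vv p u₀ y t + K * (‖y‖ ^ 2 - ‖x‖ ^ 2)) ∧
      (∀ x, ‖x‖ ≤ R → ∀ s ∈ Icc t1 t2, ∀ t ∈ Icc t1 t2,
        |vv p u₀ x t - vv p u₀ x s| ≤ K * |t - s|) := by
  obtain ⟨e, he⟩ := d.exists_unit
  have hM := d.hM
  have hn : (1:ℝ) ≤ n := by exact_mod_cast d.hn
  have ht2 : 0 < t2 := by linarith
  set c := t1 / t2 * vv p u₀ (R • e) t1 with hc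
  have hc0 : 0 < c := mul_pos (by positivity) (d.pos _ ht1)
  have hlow : ∀ x, ‖x‖ ≤ R → ∀ t ∈ Icc t1 t2, c ≤ vv p u₀ x t := by
    intro x hx t ht
    have h1 := d.time_lower x ht1 ht.1
    have h2 : vv p u₀ (R • e) t1 ≤ vv p u₀ x t1 := d.mono (by
      rw [norm_smul, he, mul_one, Real.norm_of_nonneg hR.le]; exact hx) ht1
    have h3 := d.nonneg (x := R • e) ht1
    have ht0 : 0 < t := ht1.trans_le ht.1
    calc c ≤ t1 / t * vv p u₀ (R • e) t1 := by
          rw [hc]; gcongr; exact ht.2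
      _ ≤ t1 / t * vv p u₀ x t1 := by gcongr
      _ ≤ _ := h1
  set C := 3 * M / (t1 * c ^ p) with hC
  have hC0 : 0 < C := by positivity
  have hgrad : ∀ x y, ‖x‖ ≤ ‖y‖ → ‖y‖ ≤ R → ∀ t ∈ Icc t1 t2,
      vv p u₀ x t ≤ vv p u₀ y t + C * (‖y‖ ^ 2 - ‖x‖ ^ 2) := by
    intro x y hxy hy t ht
    have ht0 : 0 < t := ht1.trans_le ht.1
    have h1 := d.grad hxy ht0 (C := C) (by
      have h2 : c ^ p ≤ vv p u₀ y t ^ p := Real.rpow_le_rpow hc0.le (hlow y hy t ht) d.p0.le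
      calc 3 * M / t ≤ 3 * M / t1 := by gcongr; exact ht.1
        _ = C * c ^ p := by rw [hC]; field_simp
        _ ≤ _ := by gcongr)
    have h3 : C / (2 * n) ≤ C := div_le_self hC0.le (by linarith)
    have h4 : 0 ≤ ‖y‖ ^ 2 - ‖x‖ ^ 2 := by
      have := pow_le_pow_left₀ (norm_nonneg x) hxy 2; linarith
    nlinarith [mul_le_mul_of_nonneg_right h3 h4]
  have htime : ∀ x, ‖x‖ ≤ R → ∀ s ∈ Icc t1 t2, ∀ t ∈ Icc t1 t2, s ≤ t →
        |vv p u₀ x t - vv p u₀ x s| ≤ (C * R ^ 2 / t1 + M / t1) * (t - s) := by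
    intro x hx s hs t ht hst
    have hs0 : 0 < s := ht1.trans_le hs.1
    have ht0 : 0 < t := ht1.trans_le ht.1
    have hq1 : s / t ≤ 1 := by rw [div_le_one ht0]; exact hst
    have hμ0 : 0 < √(s / t) := Real.sqrt_pos.2 (by positivity)
    have hμ1 : √(s / t) ≤ 1 := by rw [Real.sqrt_le_left (by norm_num)]; simpa using hq1
    have h1 := d.scale hμ0 hμ1 x ht0
    rw [Real.sq_sqrt (by positivity), div_mul_cancel₀ _ ht0.ne'] at h1
    have hnx : ‖√(s / t) • x‖ ≤ ‖x‖ := by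
      rw [norm_smul, Real.norm_of_nonneg hμ0.le]
      exact mul_le_of_le_one_left (norm_nonneg _) hμ1
    have h2 := hgrad _ x hnx hx s hs
    rw [norm_smul, mul_pow, Real.norm_of_nonneg hμ0.le, Real.sq_sqrt (by positivity)] at h2
    have h3 : C * (‖x‖ ^ 2 - s / t * ‖x‖ ^ 2) ≤ C * R ^ 2 / t1 * (t - s) := by
      have e1 : C * (‖x‖ ^ 2 - s / t * ‖x‖ ^ 2) = C * ‖x‖ ^ 2 / t * (t - s) := by
        field_simp
      rw [e1]
      have : 0 ≤ t - s := by linarith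
      gcongr
      exact ht.1
    have h4 := d.time_lower x hs0 hst
    have h5 := d.leM (x := x) hs0
    have h6 := d.nonneg (x := x) hs0
    have h7 : vv p u₀ x s ≤ vv p u₀ x t + M / t1 * (t - s) := by
      have e1 : vv p u₀ x s = s / t * vv p u₀ x s + vv p u₀ x s / t * (t - s) := by
        field_simp; ring
      have : vv p u₀ x s / t * (t - s) ≤ M / t1 * (t - s) := by
        have : 0 ≤ t - s := by linarith
        gcongr
        exact ht.1
      linarith
    have p1 : 0 ≤ C * R ^ 2 / t1 * (t - s) := mul_nonneg (by positivity) (by linarith)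
    have p2 : 0 ≤ M / t1 * (t - s) := mul_nonneg (by positivity) (by linarith)
    rw [abs_le]; constructor <;> nlinarith
  refine ⟨C + (C * R ^ 2 / t1 + M / t1), by positivity, c, hc0, hlow, ?_, ?_⟩
  · intro x y hxy hy t ht
    have h1 := hgrad x y hxy hy t ht
    have h4 : 0 ≤ ‖y‖ ^ 2 - ‖x‖ ^ 2 := by
      have := pow_le_pow_left₀ (norm_nonneg x) hxy 2; linarith
    have h5 : 0 ≤ (C * R ^ 2 / t1 + M / t1) * (‖y‖ ^ 2 - ‖x‖ ^ 2) := mul_nonneg (by positivity) h4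
    nlinarith
  · intro x hx s hs t ht
    rcases le_total s t with h | h
    · have h1 := htime x hx s hs t ht h
      rw [abs_of_nonneg (by linarith : 0 ≤ t - s)]
      have : 0 ≤ C * (t - s) := mul_nonneg hC0.le (by linarith)
      nlinarith
    · have h1 := htime x hx t ht s hs h
      rw [abs_sub_comm, abs_sub_comm t s, abs_of_nonneg (by linarith : 0 ≤ s - t)]
      have : 0 ≤ C * (s - t) := mul_nonneg hC0.le (by linarith)
      nlinarith

theorem convex_of_noTouch {f : ℝ → ℝ} {R K : ℝ} (hf : ContinuousOn f (Ioo (-R) R))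
    (h : ∀ c ∈ Ioo (-R) R, ∀ α : ℝ,
      ¬ ∀ᶠ r in 𝓝 c, f r ≤ f c + α * (r - c) - K / 2 * (r - c) ^ 2) :
    ConvexOn ℝ (Ioo (-R) R) (fun r => f r + K / 2 * r ^ 2) := by
  refine LinearOrder.convexOn_of_lt (convex_Ioo _ _) ?_
  intro x hx y hy hxy a b ha hb hab
  by_contra hcon
  push Not at hcon
  simp only [smul_eq_mul] at hcon
  set F : ℝ → ℝ := fun r => f r + K / 2 * r ^ 2 with hF
  have hsub : Icc x y ⊆ Ioo (-R) R := fun z hz => ⟨hx.1.trans_le hz.1, hz.2.trans_lt hy.2⟩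
  set m := (F y - F x) / (y - x) with hm
  have hm' : m * (y - x) = F y - F x := by
    rw [hm, div_mul_cancel₀]; linarith
  set g : ℝ → ℝ := fun r => F r - F x - m * (r - x) with hg
  have hgc : ContinuousOn g (Icc x y) := by
    have := hf.mono hsub
    fun_prop
  obtain ⟨c, hc, hmax⟩ := isCompact_Icc.exists_isMaxOn ⟨x, left_mem_Icc.2 hxy.le⟩ hgc
  have hz : a * x + b * y ∈ Icc x y := by
    have hb' : b = 1 - a := by linarith
    subst hb'
    constructor <;> nlinarith [mul_pos ha (sub_pos.2 hxy), mul_pos hb (sub_pos.2 hxy)]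
  have hzpos : 0 < g (a * x + b * y) := by
    have e1 : m * (a * x + b * y - x) = b * (F y - F x) := by
      rw [← hm']; have : a = 1 - b := by linarith
      rw [this]; ring
    have e2 : a * F x + b * F y = F x + b * (F y - F x) := by
      have : a = 1 - b := by linarith
      rw [this]; ring
    have e3 : F (a * x + b * y) > a * F x + b * F y := hcon
    simp only [hg]; linarith
  have hcpos : 0 < g c := hzpos.trans_le (hmax hz)
  have hcx : c ≠ x := by
    rintro rfl; simp [hg] at hcpos
  have hcy : c ≠ y := by
    rintro rfl; simp only [hg, hm'] at hcpos; linarith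
  have hcI : c ∈ Ioo x y := ⟨lt_of_le_of_ne hc.1 hcx.symm, lt_of_le_of_ne hc.2 hcy⟩
  refine h c (hsub hc) (m - K * c) ?_
  filter_upwards [Ioo_mem_nhds hcI.1 hcI.2] with r hr
  have h1 : g r ≤ g c := hmax (Ioo_subset_Icc_self hr)
  simp only [hg, hF] at h1
  nlinarith

theorem support_line {f : ℝ → ℝ} {R : ℝ} (hf : ConvexOn ℝ (Ioo (-R) R) f) {x : ℝ}
    (hx : x ∈ Ioo (-R) R) : ∃ α, ∀ y ∈ Ioo (-R) R, f x + α * (y - x) ≤ f y := by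
  have hxi : x ∈ interior (Ioo (-R) R) := by rwa [interior_Ioo]
  refine ⟨derivWithin f (Ioi x) x, fun y hy => ?_⟩
  rcases lt_trichotomy x y with h | h | h
  · have h1 := hf.rightDeriv_le_slope_of_mem_interior hxi hy h
    rw [slope_def_field, le_div_iff₀ (by linarith)] at h1
    linarith
  · subst h; simp
  · have h1 := hf.slope_le_leftDeriv_of_mem_interior hy hxi h
    have h2 := hf.leftDeriv_le_rightDeriv_of_mem_interior hxi
    rw [slope_def_field] at h1
    have h3 := (h1.trans h2)
    rw [div_le_iff₀ (by linarith)] at h3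
    nlinarith

theorem taylor_line {f : ℝ → ℝ} {R K : ℝ}
    (h1 : ConvexOn ℝ (Ioo (-R) R) (fun r => f r + K / 2 * r ^ 2))
    (h2 : ConvexOn ℝ (Ioo (-R) R) (fun r => - f r + K / 2 * r ^ 2)) {x : ℝ}
    (hx : x ∈ Ioo (-R) R) :
    ∃ α, ∀ y ∈ Ioo (-R) R, |f y - f x - α * (y - x)| ≤ K / 2 * (y - x) ^ 2 := by
  obtain ⟨α, ha⟩ := support_line h1 hx
  obtain ⟨β, hb⟩ := support_line h2 hx
  have hl : ∀ y ∈ Ioo (-R) R, f x + (α - K * x) * (y - x) - K / 2 * (y - x) ^ 2 ≤ f y := by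
    intro y hy; have := ha y hy; nlinarith
  have hu : ∀ y ∈ Ioo (-R) R, f y ≤ f x + (K * x - β) * (y - x) + K / 2 * (y - x) ^ 2 := by
    intro y hy; have := hb y hy; nlinarith
  have heq : α - K * x = K * x - β := by
    set D := (α - K * x) - (K * x - β) with hD
    have key : ∀ y ∈ Ioo (-R) R, D * (y - x) ≤ K * (y - x) ^ 2 := by
      intro y hy; have := hl y hy; have := hu y hy; simp only [hD]; nlinarith
    -- derivative of K (y-x)^2 - D (y-x), min at x
    have hmin : IsLocalMin (fun y => K * (y - x) ^ 2 - D * (y - x)) x := by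
      filter_upwards [Ioo_mem_nhds hx.1 hx.2] with y hy
      have := key y hy; simp only [sub_self]; norm_num; linarith
    have hd : HasDerivAt (fun y => K * (y - x) ^ 2 - D * (y - x))
        (K * (2 * (x - x) ^ 1 * 1) - D * 1) x := by
      have hid := (hasDerivAt_id x).sub_const x
      exact ((hid.pow 2).const_mul K).sub (hid.const_mul D)
    have := hmin.hasDerivAt_eq_zero hd
    simp at this
    linarith
  refine ⟨α - K * x, fun y hy => ?_⟩
  have a1 := hl y hy
  have a2 := hu y hy
  rw [← heq] at a2
  rw [abs_le]; constructor <;> linarith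

end

section
open Real Set MeasureTheory Metric Filter
open scoped Topology

variable {n : ℕ} {p M : ℝ} {u₀ : Eu n → ℝ}

theorem inner_proj {e : Eu n} (he : ‖e‖ = 1) (x : Eu n) :
    ‖x - (inner ℝ e x) • e‖ ^ 2 = ‖x‖ ^ 2 - (inner ℝ e x) ^ 2 := by
  rw [norm_sub_sq_real, inner_smul_right, norm_smul, he, real_inner_comm]
  simp; ring

theorem contDiff_inner_quad (e : Eu n) (m β c A : ℝ) :
    ContDiff ℝ 2 (fun x : Eu n => m + β * (inner ℝ e x - c) + A * (inner ℝ e x - c) ^ 2) := by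
  have : ContDiff ℝ 2 (fun x : Eu n => (inner ℝ e x : ℝ)) := contDiff_const.inner ℝ contDiff_id
  fun_prop

theorem lap_inner_quad {e : Eu n} (he : ‖e‖ = 1) (m β c A : ℝ) (x : Eu n) :
    lap (fun x : Eu n => m + β * (inner ℝ e x - c) + A * (inner ℝ e x - c) ^ 2) x = 2 * A := by
  have hfd : ∀ y w : Eu n, fderiv ℝ (fun x : Eu n => m + β * (inner ℝ e x - c) +
      A * (inner ℝ e x - c) ^ 2) y w = β * inner ℝ e w + 2 * A * (inner ℝ e y - c) * inner ℝ e w := by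
    intro y w
    have h0 : HasFDerivAt (fun x : Eu n => (inner ℝ e x : ℝ)) (innerSL ℝ e) y :=
      (innerSL ℝ e).hasFDerivAt
    have h1 := h0.sub_const c
    have h2 := ((h1.const_mul β).const_add m).add ((h1.pow 2).const_mul A)
    have h3 : HasFDerivAt (fun x : Eu n => m + β * (inner ℝ e x - c) +
      A * (inner ℝ e x - c) ^ 2) _ y := h2
    rw [h3.fderiv]
    simp; ring
  unfold lap
  have : ∀ i : Fin n, fderiv ℝ (fun y => fderiv ℝ (fun x : Eu n => m + β * (inner ℝ e x - c) +
      A * (inner ℝ e x - c) ^ 2) y (EuclideanSpace.single i 1)) x (EuclideanSpace.single i 1)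
      = 2 * A * (e i) ^ 2 := by
    intro i
    simp only [hfd]
    have h0 : HasFDerivAt (fun x : Eu n => (inner ℝ e x : ℝ)) (innerSL ℝ e) x :=
      (innerSL ℝ e).hasFDerivAt
    have h1 := ((((h0.sub_const c).const_mul (2 * A)).mul_const
      (inner ℝ e (EuclideanSpace.single i (1:ℝ))))).const_add
      (β * inner ℝ e (EuclideanSpace.single i (1:ℝ)))
    rw [h1.fderiv]
    simp [EuclideanSpace.inner_single_right]; ring
  rw [Finset.sum_congr rfl fun i _ => this i, ← Finset.mul_sum]
  have h2 := EuclideanSpace.norm_sq_eq e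
  rw [he] at h2
  simp only [Real.norm_eq_abs, sq_abs] at h2
  rw [← h2]; simp

theorem Dat.taylor (d : Dat p u₀ M) {R t1 t2 : ℝ} (hR : 0 < R) (ht1 : 0 < t1) (ht12 : t1 ≤ t2) :
    ∃ K > (0:ℝ), ∀ t ∈ Icc t1 t2, ∀ x, ‖x‖ < R → ∃ G : Eu n, ∀ y, ‖y‖ < R →
      |vv p u₀ y t - vv p u₀ x t - inner ℝ G (y - x)| ≤ K * ‖y - x‖ ^ 2 := by
  obtain ⟨K, hK, c, hc, hlow, hgrad, htime⟩ :=
    d.loc (t1 := t1 / 2) (t2 := t2) hR (by linarith) (by linarith)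
  have hp := d.p0
  have hn : (1:ℝ) ≤ n := by exact_mod_cast d.hn
  have hcp : 0 < c ^ p := by positivity
  set K2 := 2 * n * K + 2 * K / c ^ p with hK2
  have hK20 : 0 < K2 := by positivity
  refine ⟨K2 / 2 + K, by positivity, ?_⟩
  intro t ht x hx
  have htI : t ∈ Icc (t1 / 2) t2 := ⟨by linarith [ht.1], ht.2⟩
  have ht0 : 0 < t := by linarith [ht.1]
  -- choose unit vector
  obtain ⟨e, he, hxe⟩ : ∃ e : Eu n, ‖e‖ = 1 ∧ x = ‖x‖ • e := by
    by_cases h0 : x = 0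
    · obtain ⟨e, he⟩ := d.exists_unit
      exact ⟨e, he, by simp [h0]⟩
    · have : ‖x‖ ≠ 0 := norm_ne_zero_iff.2 h0
      refine ⟨‖x‖⁻¹ • x, by rw [norm_smul, norm_inv, norm_norm, inv_mul_cancel₀ this], ?_⟩
      rw [smul_smul, mul_inv_cancel₀ this, one_smul]
  set v := vv p u₀ with hv
  set h : ℝ → ℝ := fun r => v (r • e) t with hh
  have hnr : ∀ r : ℝ, ‖r • e‖ = |r| := fun r => by rw [norm_smul, he, mul_one, Real.norm_eq_abs]
  have hproj : ∀ y : Eu n, |inner ℝ e y| ≤ ‖y‖ := fun y => by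
    simpa [he] using abs_real_inner_le_norm e y
  have hup : ∀ y : Eu n, v y t ≤ h (inner ℝ e y) := fun y =>
    d.mono (by rw [hnr]; exact hproj y) ht0
  have hdn : ∀ y : Eu n, ‖y‖ ≤ R → h (inner ℝ e y) ≤ v y t + K * (‖y‖ ^ 2 - (inner ℝ e y) ^ 2) := by
    intro y hy
    have := hgrad ((inner ℝ e y : ℝ) • e) y (by rw [hnr]; exact hproj y) hy t htI
    rwa [hnr, sq_abs] at this
  have hhc : ContinuousOn h (Ioo (-R) R) := by
    have key : ∀ r ∈ Ioo (-R) R, ∀ s ∈ Ioo (-R) R, |h r - h s| ≤ K * |r ^ 2 - s ^ 2| := by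
      have aux : ∀ r ∈ Ioo (-R) R, ∀ s ∈ Ioo (-R) R, |r| ≤ |s| → |h r - h s| ≤ K * |r ^ 2 - s ^ 2| := by
        intro r hr s hs hrs
        have h1 := hgrad (r • e) (s • e) (by simpa only [hnr]) (by
          rw [hnr, abs_le]; exact ⟨hs.1.le, hs.2.le⟩) t htI
        have h2 : v (s • e) t ≤ v (r • e) t := d.mono (by simpa only [hnr]) ht0
        simp only [hnr, sq_abs] at h1
        rw [abs_of_nonneg (by simp only [hh]; linarith), abs_sub_comm]
        have : K * (s ^ 2 - r ^ 2) ≤ K * |s ^ 2 - r ^ 2| := by gcongr; exact le_abs_self _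
        simp only [hh]; linarith
      intro r hr s hs
      rcases le_total |r| |s| with h1 | h1
      · exact aux r hr s hs h1
      · rw [abs_sub_comm, abs_sub_comm (r ^ 2)]; exact aux s hs r hr h1
    intro s hs
    rw [ContinuousWithinAt, tendsto_iff_norm_sub_tendsto_zero]
    refine squeeze_zero' (Eventually.of_forall fun _ => norm_nonneg _)
      (g := fun r => K * |r ^ 2 - s ^ 2|) ?_ ?_
    · filter_upwards [self_mem_nhdsWithin] with r hr
      exact key r hr s hs
    · have : ContinuousAt (fun r : ℝ => K * |r ^ 2 - s ^ 2|) s := by fun_prop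
      have h2 := this.tendsto
      simp only [sub_self, abs_zero, mul_zero] at h2
      exact h2.mono_left nhdsWithin_le_nhds
  -- common setup at a point c0
  have hball : ∀ c0 ∈ Ioo (-R) R, ∀ P : ℝ → Prop, (∀ᶠ r in 𝓝 c0, P r) → ∃ ρ > (0:ℝ),
      ρ ≤ t1 / 2 ∧ ∀ y ∈ ball (c0 • e) ρ, P (inner ℝ e y) ∧ ‖y‖ ≤ R := by
    intro c0 hc0 P hP
    have h1 : Tendsto (fun y : Eu n => (inner ℝ e y : ℝ)) (𝓝 (c0 • e)) (𝓝 c0) := by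
      have : Continuous (fun y : Eu n => (inner ℝ e y : ℝ)) := by fun_prop
      have h2 := this.tendsto (c0 • e)
      rwa [inner_smul_right, real_inner_self_eq_norm_sq, he, one_pow, mul_one] at h2
    have h2 : ∀ᶠ y : Eu n in 𝓝 (c0 • e), ‖y‖ < R := by
      apply continuous_norm.continuousAt.eventually_lt continuousAt_const
      rw [hnr, abs_lt]; exact hc0
    obtain ⟨ρ, hρ, hb⟩ := Metric.eventually_nhds_iff_ball.1 ((h1.eventually hP).and h2)
    exact ⟨min ρ (t1 / 2), by positivity, min_le_right _ _, fun y hy =>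
      ⟨(hb y (ball_subset_ball (min_le_left _ _) hy)).1,
      (hb y (ball_subset_ball (min_le_left _ _) hy)).2.le⟩⟩
  have hin : ∀ c0 : ℝ, (inner ℝ e (c0 • e) : ℝ) = c0 := fun c0 => by
    rw [inner_smul_right, real_inner_self_eq_norm_sq, he]; simp
  have hKc : K < K2 * c ^ p := by
    have : K2 * c ^ p = 2 * n * K * c ^ p + 2 * K := by rw [hK2]; field_simp
    rw [this]; have : 0 ≤ 2 * n * K * c ^ p := by positivity
    linarith
  have hconv1 : ConvexOn ℝ (Ioo (-R) R) (fun r => h r + K2 / 2 * r ^ 2) := by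
    refine convex_of_noTouch hhc ?_
    intro c0 hc0 α hev
    obtain ⟨ρ, hρ, hρt, hb⟩ := hball c0 hc0 _ hev
    have := d.subTouch (x0 := c0 • e) (t0 := t) (b := -K) (r := ρ)
      (ψ := fun y => (h c0 + K * t) + α * (inner ℝ e y - c0) + (-(K2 / 2)) * (inner ℝ e y - c0) ^ 2)
      ht0 hρ (contDiff_inner_quad _ _ _ _ _).contDiffAt (by simp only [hin, hh]; simp [hv]) (by
        intro y hy s hs hs0
        obtain ⟨h1, h2⟩ := hb y hy
        have h3 := htime y h2 s ⟨by linarith [hs.1, ht.1], hs.2.trans ht.2⟩ t htI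
        rw [abs_of_nonneg (by linarith [hs.2] : 0 ≤ t - s)] at h3
        have h4 := neg_abs_le (v y t - v y s)
        have h5 := hup y
        nlinarith)
    rw [lap_inner_quad he] at this
    have hlo : c ^ p ≤ v (c0 • e) t ^ p := Real.rpow_le_rpow hc.le (hlow _ (by
      rw [hnr, abs_le]; exact ⟨hc0.1.le, hc0.2.le⟩) t htI) hp.le
    nlinarith [mul_le_mul_of_nonneg_left hlo hK20.le]
  have hconv2 : ConvexOn ℝ (Ioo (-R) R) (fun r => - h r + K2 / 2 * r ^ 2) := by
    refine convex_of_noTouch hhc.neg ?_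
    intro c0 hc0 α hev
    obtain ⟨ρ, hρ, hρt, hb⟩ := hball c0 hc0 _ hev
    have := d.superTouch (x0 := c0 • e) (t0 := t) (b := K) (r := ρ)
      (ψ := fun y => ((h c0 - K * t + K * c0 ^ 2) + (2 * K * c0 - α) * (inner ℝ e y - c0) +
        (K2 / 2 + K) * (inner ℝ e y - c0) ^ 2) + (0 + (-K) * ‖y - 0‖ ^ 2))
      ht0 hρ ((contDiff_inner_quad _ _ _ _ _).contDiffAt.add (contDiff_quad _ _ _).contDiffAt)
      (by simp only [hin, hh, sub_zero, hnr, sq_abs]; ring) (by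
        intro y hy s hs hs0
        obtain ⟨h1, h2⟩ := hb y hy
        have h3 := htime y h2 s ⟨by linarith [hs.1, ht.1], hs.2.trans ht.2⟩ t htI
        rw [abs_of_nonneg (by linarith [hs.2] : 0 ≤ t - s)] at h3
        have h4 := le_abs_self (v y t - v y s)
        have h5 := hdn y h2
        simp only [sub_zero]
        nlinarith)
    rw [lap_add_quad (contDiff_inner_quad _ _ _ _ _).contDiffAt, lap_inner_quad he] at this
    have hlo : c ^ p ≤ v (c0 • e) t ^ p := Real.rpow_le_rpow hc.le (hlow _ (by
      rw [hnr, abs_le]; exact ⟨hc0.1.le, hc0.2.le⟩) t htI) hp.le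
    have e1 : 2 * (K2 / 2 + K) + -K * (2 * n) = 2 * K + 2 * K / c ^ p := by rw [hK2]; ring
    rw [e1] at this
    have e2 : (2 * K + 2 * K / c ^ p) * c ^ p = 2 * K * c ^ p + 2 * K := by field_simp
    have e3 : 0 ≤ 2 * K + 2 * K / c ^ p := by positivity
    nlinarith [mul_le_mul_of_nonneg_left hlo e3, mul_pos hK hcp]
  obtain ⟨α, hα⟩ := taylor_line hconv1 hconv2 (x := ‖x‖) ⟨by linarith [norm_nonneg x], hx⟩
  refine ⟨α • e, fun y hy => ?_⟩
  have hyI : (inner ℝ e y : ℝ) ∈ Ioo (-R) R := by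
    have := abs_lt.1 ((hproj y).trans_lt hy); exact this
  have h1 := hα _ hyI
  have hxv : h ‖x‖ = v x t := by simp only [hh]; rw [← hxe]
  have hix : (inner ℝ e x : ℝ) = ‖x‖ := by conv_lhs => rw [hxe, hin]
  have h2 : (inner ℝ (α • e) (y - x) : ℝ) = α * (inner ℝ e y - ‖x‖) := by
    rw [real_inner_smul_left, inner_sub_right, hix]
  have h3 : ‖y‖ ^ 2 - (inner ℝ e y) ^ 2 ≤ ‖y - x‖ ^ 2 := by
    have a1 := inner_proj he (y - x)
    have a2 : (y - x) - (inner ℝ e (y - x) : ℝ) • e = y - (inner ℝ e y : ℝ) • e := by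
      rw [inner_sub_right, hix, sub_smul, ← hxe]; abel
    rw [a2, inner_proj he] at a1
    rw [a1]; nlinarith [sq_nonneg (inner ℝ e (y - x) : ℝ)]
  have h4 : ((inner ℝ e y : ℝ) - ‖x‖) ^ 2 ≤ ‖y - x‖ ^ 2 := by
    have := hproj (y - x)
    rw [inner_sub_right, hix] at this
    rw [← sq_abs]; gcongr
  have h5 := hup y
  have h6 := hdn y hy.le
  rw [h2, ← hxv]
  rw [abs_le] at h1 ⊢
  have h7 := mul_le_mul_of_nonneg_left h3 hK.le
  have h8 := mul_le_mul_of_nonneg_left h4 (show 0 ≤ K2 / 2 by positivity)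
  have h9 : 0 ≤ K * ‖y - x‖ ^ 2 := by positivity
  constructor <;> linarith

end

section
open Real Set MeasureTheory Metric Filter
open scoped Topology

variable {n : ℕ} {p M : ℝ} {u₀ : Eu n → ℝ}

/-- spatial derivative of the Perron function -/
noncomputable def Dv (p : ℝ) (u₀ : Eu n → ℝ) (x : Eu n) (t : ℝ) : Eu n →L[ℝ] ℝ :=
  fderiv ℝ (fun y => vv p u₀ y t) x

theorem hasFDerivAt_of_quad {f : Eu n → ℝ} {x : Eu n} {A : Eu n →L[ℝ] ℝ} {K r : ℝ} (hr : 0 < r)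
    (h : ∀ y ∈ ball x r, |f y - f x - A (y - x)| ≤ K * ‖y - x‖ ^ 2) : HasFDerivAt f A x := by
  rw [hasFDerivAt_iff_isLittleO]
  have h1 : (fun y => f y - f x - A (y - x)) =O[𝓝 x] fun y => ‖y - x‖ ^ 2 := by
    refine Asymptotics.IsBigO.of_bound K ?_
    filter_upwards [ball_mem_nhds x hr] with y hy
    simpa using h y hy
  refine h1.trans_isLittleO ?_
  have h2 : (fun y => ‖y - x‖ ^ 2) =o[𝓝 x] fun y => ‖y - x‖ := by
    have h3 : Tendsto (fun y => ‖y - x‖) (𝓝 x) (𝓝 0) := by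
      have : Continuous (fun y : Eu n => ‖y - x‖) := by fun_prop
      simpa using this.tendsto x
    exact (Asymptotics.isLittleO_pow_id (one_lt_two)).comp_tendsto h3
  exact h2.of_norm_right

set_option maxHeartbeats 1000000 in
theorem Dat.c11 (d : Dat p u₀ M) {R t1 t2 : ℝ} (hR : 0 < R) (ht1 : 0 < t1) (ht12 : t1 ≤ t2) :
    ∃ K > (0:ℝ), ∀ t ∈ Icc t1 t2, ∀ x, ‖x‖ < R → HasFDerivAt (fun y => vv p u₀ y t) (Dv p u₀ x t) x ∧
      ‖Dv p u₀ x t‖ ≤ K ∧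
      (∀ y, ‖y‖ < R → |vv p u₀ y t - vv p u₀ x t - Dv p u₀ x t (y - x)| ≤ K * ‖y - x‖ ^ 2 ∧
        ‖Dv p u₀ x t - Dv p u₀ y t‖ ≤ K * ‖x - y‖ ∧ |vv p u₀ x t - vv p u₀ y t| ≤ K * ‖x - y‖) ∧
      (∀ s ∈ Icc t1 t2, |vv p u₀ x t - vv p u₀ x s| ≤ K * |t - s| ∧
        (|t - s| ≤ R ^ 2 → ‖Dv p u₀ x t - Dv p u₀ x s‖ ≤ K * √|t - s|)) := by
  obtain ⟨K, hK, hT⟩ := d.taylor (R := 3 * R) (by linarith) ht1 ht12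
  obtain ⟨K', hK', c, hc, hlow, hgrad, htime⟩ := d.loc (R := 3 * R) (by linarith) ht1 ht12
  set v := vv p u₀ with hv
  have hD : ∀ t ∈ Icc t1 t2, ∀ x, ‖x‖ < 3 * R → HasFDerivAt (fun y => v y t) (Dv p u₀ x t) x ∧
      ∀ y, ‖y‖ < 3 * R → |v y t - v x t - Dv p u₀ x t (y - x)| ≤ K * ‖y - x‖ ^ 2 := by
    intro t ht x hx
    obtain ⟨G, hG⟩ := hT t ht x hx
    have h1 : HasFDerivAt (fun y => v y t) (innerSL ℝ G) x := by
      refine hasFDerivAt_of_quad (r := 3 * R - ‖x‖) (K := K) (by linarith) ?_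
      intro y hy
      refine hG y ?_
      have := norm_sub_norm_le y x
      rw [mem_ball, dist_eq_norm] at hy
      linarith
    have h2 : Dv p u₀ x t = innerSL ℝ G := h1.fderiv
    rw [h2]
    exact ⟨h1, fun y hy => hG y hy⟩
  have hlip : ∀ t ∈ Icc t1 t2, ∀ x, ‖x‖ < R → ∀ y, ‖y‖ < R → |v x t - v y t| ≤ K' * (2 * R) * ‖x - y‖ := by
    have aux : ∀ t ∈ Icc t1 t2, ∀ x, ‖x‖ < R → ∀ y, ‖y‖ < R → ‖x‖ ≤ ‖y‖ →
        |v x t - v y t| ≤ K' * (2 * R) * ‖x - y‖ := by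
      intro t ht x hx y hy hxy
      have h1 := hgrad x y hxy (by linarith) t ht
      have h2 : v y t ≤ v x t := d.mono hxy (ht1.trans_le ht.1)
      rw [abs_of_nonneg (by linarith)]
      have h3 : ‖y‖ ^ 2 - ‖x‖ ^ 2 ≤ (2 * R) * ‖x - y‖ := by
        have h4 := norm_sub_norm_le y x
        rw [norm_sub_rev] at h4
        have : ‖y‖ ^ 2 - ‖x‖ ^ 2 = (‖y‖ + ‖x‖) * (‖y‖ - ‖x‖) := by ring
        rw [this]
        have : 0 ≤ ‖y‖ - ‖x‖ := by linarith
        gcongr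
        linarith
      nlinarith [mul_le_mul_of_nonneg_left h3 hK'.le]
    intro t ht x hx y hy
    rcases le_total ‖x‖ ‖y‖ with h | h
    · exact aux t ht x hx y hy h
    · rw [abs_sub_comm, norm_sub_rev]; exact aux t ht y hy x hx h
  set C := 6 * K + 2 * K' + K' * (2 * R) with hC
  have hC0 : 0 < C := by positivity
  have hK6 : 6 * K ≤ C := by have : 0 ≤ 2 * K' + K' * (2 * R) := by positivity
                             linarith
  have hK2 : 2 * K + 2 * K' ≤ C := by have : 0 ≤ 4 * K + K' * (2 * R) := by positivity
                                      linarith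
  have hKR : K' * (2 * R) ≤ C := by have : 0 ≤ 6 * K + 2 * K' := by positivity
                                    linarith
  refine ⟨C, hC0, ?_⟩
  intro t ht x hx
  have hx3 : ‖x‖ < 3 * R := by linarith
  obtain ⟨hd1, hd2⟩ := hD t ht x hx3
  refine ⟨hd1, ?_, ?_, ?_⟩
  · refine hd1.le_of_lip' hC0.le ?_
    have : ∀ᶠ y : Eu n in 𝓝 x, ‖y‖ < R :=
      continuous_norm.continuousAt.eventually_lt continuousAt_const hx
    filter_upwards [this] with y hy
    exact (hlip t ht y hy x hx).trans (by gcongr)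
  · intro y hy
    have hy3 : ‖y‖ < 3 * R := by linarith
    refine ⟨(hd2 y hy3).trans (by gcongr; linarith), ?_, (hlip t ht x hx y hy).trans (by gcongr)⟩
    obtain ⟨he1, he2⟩ := hD t ht y hy3
    rcases eq_or_ne x y with hxy | hxy
    · simp [hxy]
    set δ := ‖x - y‖ with hδ
    have hδ0 : 0 < δ := norm_pos_iff.2 (sub_ne_zero.2 hxy)
    have hδ2 : δ < 2 * R := (norm_sub_le _ _).trans_lt (by linarith)
    refine ContinuousLinearMap.opNorm_le_of_unit_norm (by positivity) ?_
    intro w hw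
    have hz : ‖y + δ • w‖ < 3 * R := by
      refine (norm_add_le _ _).trans_lt ?_
      rw [norm_smul, hw, Real.norm_of_nonneg hδ0.le]; linarith
    have a1 := hd2 (y + δ • w) hz
    have a2 := hd2 y hy3
    have a3 := he2 (y + δ • w) hz
    have n1 : ‖y + δ • w - y‖ = δ := by
      rw [add_sub_cancel_left, norm_smul, hw, Real.norm_of_nonneg hδ0.le, mul_one]
    have n2 : ‖y + δ • w - x‖ ≤ 2 * δ := by
      have : y + δ • w - x = δ • w - (x - y) := by abel
      rw [this]
      refine (norm_sub_le _ _).trans ?_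
      rw [norm_smul, hw, Real.norm_of_nonneg hδ0.le]; linarith
    have n3 : ‖y - x‖ = δ := norm_sub_rev _ _
    rw [n1] at a3
    rw [n3] at a2
    have a1' : |v (y + δ • w) t - v x t - Dv p u₀ x t (y + δ • w - x)| ≤ K * (2 * δ) ^ 2 :=
      a1.trans (by gcongr)
    have lin1 : Dv p u₀ x t (y + δ • w - x) = Dv p u₀ x t (y - x) + δ * Dv p u₀ x t w := by
      have : y + δ • w - x = (y - x) + δ • w := by abel
      rw [this, map_add, map_smul, smul_eq_mul]
    have lin2 : Dv p u₀ y t (y + δ • w - y) = δ * Dv p u₀ y t w := by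
      rw [add_sub_cancel_left, map_smul, smul_eq_mul]
    rw [lin1] at a1'
    rw [lin2] at a3
    rw [sub_apply, Real.norm_eq_abs]
    have b1 := abs_le.1 a1'
    have b2 := abs_le.1 a2
    have b3 := abs_le.1 a3
    have key : δ * |Dv p u₀ x t w - Dv p u₀ y t w| ≤ δ * (6 * K * δ) := by
      rw [← abs_of_pos hδ0, ← abs_mul, abs_of_pos hδ0, abs_le]
      constructor <;> nlinarith
    exact (le_of_mul_le_mul_left key hδ0).trans (by gcongr)
  · intro s hs
    have ht' := htime x (by linarith) s hs t ht
    refine ⟨ht'.trans (by gcongr; have : 0 ≤ 6 * K + K' + K' * (2 * R) := by positivity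
                          linarith), fun hsR => ?_⟩
    rcases eq_or_ne t s with h | h
    · subst h; simp
    obtain ⟨he1, he2⟩ := hD s hs x hx3
    have hts : 0 < |t - s| := abs_pos.2 (sub_ne_zero.2 h)
    set δ := √|t - s| with hδ
    have hδ0 : 0 < δ := Real.sqrt_pos.2 hts
    have hδsq : δ ^ 2 = |t - s| := Real.sq_sqrt hts.le
    have hδR : δ ≤ R := by rw [hδ, Real.sqrt_le_left hR.le]; exact hsR
    refine ContinuousLinearMap.opNorm_le_of_unit_norm (by positivity) ?_
    intro w hw
    have hzR : ‖x + δ • w‖ < 3 * R := by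
      refine (norm_add_le _ _).trans_lt ?_
      rw [norm_smul, hw, Real.norm_of_nonneg hδ0.le]; linarith
    have a1 := hd2 (x + δ • w) hzR
    have a2 := he2 (x + δ • w) hzR
    have a3 := htime (x + δ • w) hzR.le s hs t ht
    have n1 : ‖x + δ • w - x‖ = δ := by
      rw [add_sub_cancel_left, norm_smul, hw, Real.norm_of_nonneg hδ0.le, mul_one]
    rw [n1, add_sub_cancel_left, map_smul, smul_eq_mul] at a1 a2
    rw [sub_apply, Real.norm_eq_abs]
    rw [← hδsq] at a3 ht'
    have b1 := abs_le.1 a1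
    have b2 := abs_le.1 a2
    have b3 := abs_le.1 a3
    have b4 := abs_le.1 ht'
    have key : δ * |Dv p u₀ x t w - Dv p u₀ x s w| ≤ δ * ((2 * K + 2 * K') * δ) := by
      rw [← abs_of_pos hδ0, ← abs_mul, abs_of_pos hδ0, abs_le]
      constructor <;> nlinarith
    exact (le_of_mul_le_mul_left key hδ0).trans (by gcongr)

theorem Dat.hasFDerivAt (d : Dat p u₀ M) (x : Eu n) {t : ℝ} (ht : 0 < t) :
    HasFDerivAt (fun y => vv p u₀ y t) (Dv p u₀ x t) x := by
  obtain ⟨K, hK, h⟩ := d.c11 (R := ‖x‖ + 1) (by positivity) ht le_rfl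
  exact (h t ⟨le_rfl, le_rfl⟩ x (by linarith)).1

theorem Dat.contD (d : Dat p u₀ M) (x : Eu n) {t : ℝ} (ht : 0 < t) :
    ContinuousAt (fun z : Eu n × ℝ => vv p u₀ z.1 z.2) (x, t) ∧
    ContinuousAt (fun z : Eu n × ℝ => Dv p u₀ z.1 z.2) (x, t) := by
  obtain ⟨K, hK, h⟩ := d.c11 (R := ‖x‖ + 1) (t1 := t / 2) (t2 := 2 * t) (by positivity)
    (by linarith) (by linarith)
  have e1 : ∀ᶠ z : Eu n × ℝ in 𝓝 (x, t), ‖z.1‖ < ‖x‖ + 1 ∧ z.2 ∈ Icc (t / 2) (2 * t) ∧ |z.2 - t| ≤ (‖x‖ + 1) ^ 2 := by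
    have h1 : ∀ᶠ z : Eu n × ℝ in 𝓝 (x, t), ‖z.1‖ < ‖x‖ + 1 := by
      have : Continuous (fun z : Eu n × ℝ => ‖z.1‖) := by fun_prop
      exact this.continuousAt.eventually_lt continuousAt_const (by simp)
    have h2 : ∀ᶠ z : Eu n × ℝ in 𝓝 (x, t), z.2 ∈ Icc (t / 2) (2 * t) :=
      continuousAt_snd.eventually (Icc_mem_nhds (by simp; linarith) (by simp; linarith))
    have h3 : ∀ᶠ z : Eu n × ℝ in 𝓝 (x, t), |z.2 - t| < (‖x‖ + 1) ^ 2 := by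
      have : Continuous (fun z : Eu n × ℝ => |z.2 - t|) := by fun_prop
      exact this.continuousAt.eventually_lt continuousAt_const (by simp; positivity)
    filter_upwards [h1, h2, h3] with z a b c using ⟨a, b, c.le⟩
  have htI : t ∈ Icc (t / 2) (2 * t) := ⟨by linarith, by linarith⟩
  constructor
  · rw [ContinuousAt, tendsto_iff_norm_sub_tendsto_zero]
    refine squeeze_zero' (Eventually.of_forall fun _ => norm_nonneg _)
      (g := fun z => K * ‖z.1 - x‖ + K * |z.2 - t|) ?_ ?_
    · filter_upwards [e1] with z hz
      have a1 := (((h z.2 hz.2.1 z.1 hz.1).2.2.1) x (by linarith)).2.2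
      have a2 := ((h z.2 hz.2.1 x (by linarith)).2.2.2 t htI).1
      rw [Real.norm_eq_abs]
      calc _ = |(vv p u₀ z.1 z.2 - vv p u₀ x z.2) + (vv p u₀ x z.2 - vv p u₀ x t)| := by congr 1; ring
        _ ≤ _ := (abs_add_le _ _).trans (add_le_add a1 a2)
    · have : Continuous (fun z : Eu n × ℝ => K * ‖z.1 - x‖ + K * |z.2 - t|) := by fun_prop
      simpa using this.tendsto (x, t)
  · rw [ContinuousAt, tendsto_iff_norm_sub_tendsto_zero]
    refine squeeze_zero' (Eventually.of_forall fun _ => norm_nonneg _)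
      (g := fun z => K * ‖z.1 - x‖ + K * √|z.2 - t|) ?_ ?_
    · filter_upwards [e1] with z hz
      have a1 := (((h z.2 hz.2.1 z.1 hz.1).2.2.1) x (by linarith)).2.1
      have a2 := ((h z.2 hz.2.1 x (by linarith)).2.2.2 t htI).2 hz.2.2
      calc _ = ‖(Dv p u₀ z.1 z.2 - Dv p u₀ x z.2) + (Dv p u₀ x z.2 - Dv p u₀ x t)‖ := by
            congr 1; abel
        _ ≤ _ := (norm_add_le _ _).trans (add_le_add a1 a2)
    · have : Continuous (fun z : Eu n × ℝ => K * ‖z.1 - x‖ + K * √|z.2 - t|) := by fun_prop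
      simpa using this.tendsto (x, t)

end

section
open Real Set MeasureTheory Metric Filter
open scoped Topology SchwartzMap

variable {n : ℕ}

theorem poly_exp_bound (N : ℕ) (r : ℝ) (hr : 0 ≤ r) :
    (1 + r) ^ N * exp (-(1/4) * r ^ 2) ≤ N.factorial * exp 2 := by
  have h1 : (1 + r) ^ N / N.factorial ≤ exp (1 + r) := Real.pow_div_factorial_le_exp _ (by linarith) N
  have h2 : (0:ℝ) < N.factorial := by positivity
  rw [div_le_iff₀ h2] at h1
  calc (1 + r) ^ N * exp (-(1/4) * r ^ 2) ≤ exp (1 + r) * N.factorial * exp (-(1/4) * r ^ 2) := by gcongr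
    _ = N.factorial * exp (1 + r + -(1/4) * r ^ 2) := by rw [exp_add (1+r)]; ring
    _ ≤ _ := by gcongr; nlinarith [sq_nonneg (r - 2)]

theorem gauss_decay (k m : ℕ) : ∃ C : ℝ, ∀ x : Eu n,
    ‖x‖ ^ k * ‖iteratedFDeriv ℝ m (fun x : Eu n => exp (-(1/4) * ‖x‖ ^ 2)) x‖ ≤ C := by
  obtain ⟨j, C, hC, hj⟩ := (Function.hasTemperateGrowth_norm_sq (H := Eu n)).norm_iteratedFDeriv_le_uniform m
  refine ⟨m.factorial * (C + 1) ^ m * ((k + j * m).factorial * exp 2), fun x => ?_⟩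
  have hg : ContDiff ℝ m (fun s : ℝ => exp (-(1/4) * s)) := by fun_prop
  have hf : ContDiff ℝ m (fun x : Eu n => ‖x‖ ^ 2) := contDiff_norm_sq ℝ
  have := norm_iteratedFDeriv_comp_le hg hf le_rfl x (C := exp (-(1/4) * ‖x‖ ^ 2))
    (D := (C + 1) * (1 + ‖x‖) ^ j) ?_ ?_
  · have h1 := poly_exp_bound (k + j * m) ‖x‖ (norm_nonneg _)
    calc _ ≤ (1 + ‖x‖) ^ k * (m.factorial * exp (-(1/4) * ‖x‖ ^ 2) * ((C + 1) * (1 + ‖x‖) ^ j) ^ m) := by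
          gcongr
          · linarith
          · exact this
      _ = m.factorial * (C + 1) ^ m * ((1 + ‖x‖) ^ (k + j * m) * exp (-(1/4) * ‖x‖ ^ 2)) := by
          rw [mul_pow, pow_add, pow_mul]; ring
      _ ≤ _ := by gcongr
  · intro i hi
    rw [norm_iteratedFDeriv_eq_norm_iteratedDeriv, iteratedDeriv_exp_const_mul]
    rw [norm_mul, norm_pow, Real.norm_eq_abs, Real.norm_eq_abs, abs_of_pos (exp_pos _)]
    have : |(-(1/4:ℝ))| ^ i ≤ 1 := pow_le_one₀ (abs_nonneg _) (by norm_num [abs_of_neg])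
    nlinarith [exp_pos (-(1/4) * ‖x‖ ^ 2)]
  · intro i hi1 hi2
    refine (hj i hi2 x).trans ?_
    have h1 : 1 ≤ (1 + ‖x‖) ^ j := one_le_pow₀ (by linarith [norm_nonneg x])
    refine le_trans ?_ (le_self_pow₀ ?_ (by omega))
    · gcongr; linarith
    · nlinarith

/-- the heat kernel at time one -/
noncomputable def gam (n : ℕ) : 𝓢(Eu n, ℝ) :=
  ((4 * π) ^ (-(n:ℝ) / 2)) • (
  { toFun := fun x => exp (-(1/4) * ‖x‖ ^ 2)
    smooth' := (contDiff_exp).comp (contDiff_const.mul (contDiff_norm_sq ℝ))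
    decay' := fun k m => gauss_decay k m } : 𝓢(Eu n, ℝ))

theorem gam_apply (x : Eu n) : gam n x = (4 * π) ^ (-(n:ℝ) / 2) * exp (-(1/4) * ‖x‖ ^ 2) := rfl

theorem integral_gam : ∫ z, gam n z = 1 := by
  simp_rw [gam_apply]
  rw [integral_const_mul, GaussianFourier.integral_rexp_neg_mul_sq_norm (by norm_num)]
  rw [finrank_euclideanSpace_fin, show π / (1/4) = 4 * π by ring, ← rpow_add (by positivity)]
  have : -(n:ℝ)/2 + n/2 = 0 := by ring
  rw [this, rpow_zero]

/-- derivative of Schwartz functions -/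
noncomputable abbrev SD {W : Type*} [NormedAddCommGroup W] [NormedSpace ℝ W] (q : 𝓢(Eu n, W)) :
    𝓢(Eu n, Eu n →L[ℝ] W) := SchwartzMap.fderivCLM ℝ (Eu n) W q

section
variable {W : Type*} [NormedAddCommGroup W] [NormedSpace ℝ W]

/-- convolution with rescaled kernel -/
noncomputable def GG (q : 𝓢(Eu n, W)) (σ : ℝ) (F : Eu n → ℝ) (x : Eu n) : W :=
  ∫ z, F (x - √σ • z) • q z

theorem schwartz_bound (q : 𝓢(Eu n, W)) (N : ℕ) : ∃ C > 0, ∀ z, ‖q z‖ ≤ C * (1 + ‖z‖) ^ (-(N:ℝ)) := by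
  refine ⟨2 ^ N * (Finset.Iic (N, 0)).sup (fun m => SchwartzMap.seminorm ℝ m.1 m.2) q + 1, ?_, ?_⟩
  · have : 0 ≤ (Finset.Iic (N, 0)).sup (fun m => SchwartzMap.seminorm ℝ m.1 m.2) q := apply_nonneg _ _
    positivity
  intro z
  have := SchwartzMap.one_add_le_sup_seminorm_apply (𝕜 := ℝ) (m := (N,0)) (k := N) (n := 0) le_rfl le_rfl q z
  rw [rpow_neg (by positivity), rpow_natCast, ← div_eq_mul_inv, le_div_iff₀ (by positivity)]
  simp at this ⊢
  linarith

theorem GG_integrable (q : 𝓢(Eu n, W)) (σ : ℝ) {F : Eu n → ℝ} (hF : Continuous F) {B : ℝ}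
    (hB : ∀ x, |F x| ≤ B) (x : Eu n) : Integrable (fun z => F (x - √σ • z) • q z) := by
  refine (q.integrable.norm.const_mul B).mono' ?_ (Eventually.of_forall fun z => ?_)
  · exact (Continuous.smul (by fun_prop) q.continuous).aestronglyMeasurable
  · rw [norm_smul]; gcongr; exact hB _

theorem GG_bound (q : 𝓢(Eu n, W)) (σ : ℝ) {F : Eu n → ℝ} {B : ℝ}
    (hB : ∀ x, |F x| ≤ B) (x : Eu n) : ‖GG q σ F x‖ ≤ B * ∫ z, ‖q z‖ := by
  unfold GG
  rw [← integral_const_mul]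
  refine norm_integral_le_of_norm_le (q.integrable.norm.const_mul B) (Eventually.of_forall fun z => ?_)
  rw [norm_smul]; gcongr; exact hB _

theorem GG_add (q : 𝓢(Eu n, W)) (σ : ℝ) {F G : Eu n → ℝ} (hF : Continuous F) (hG : Continuous G) {B : ℝ}
    (hB : ∀ x, |F x| ≤ B) (hB' : ∀ x, |G x| ≤ B) (x : Eu n) :
    GG q σ (fun y => F y - G y) x = GG q σ F x - GG q σ G x := by
  unfold GG
  rw [← integral_sub (GG_integrable q σ hF hB x) (GG_integrable q σ hG hB' x)]
  simp_rw [sub_smul]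

theorem GG_holder [CompleteSpace W] (q : 𝓢(Eu n, W)) (hq : ∫ z, q z = 0) (σ : ℝ) {F : Eu n → ℝ} (hF : Continuous F) {B H : ℝ}
    (hB : ∀ x, |F x| ≤ B) (hH : ∀ x y, |F x - F y| ≤ H * √‖x - y‖) (hH0 : 0 ≤ H) (x : Eu n) :
    ‖GG q σ F x‖ ≤ H * √(√σ) * ∫ z, (1 + ‖z‖) * ‖q z‖ := by
  have h1 : GG q σ F x = ∫ z, (F (x - √σ • z) - F x) • q z := by
    simp_rw [sub_smul]
    rw [integral_sub (GG_integrable q σ hF hB x) ((q.integrable.smul (F x) : Integrable (fun z => F x • q z))), integral_smul, hq]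
    simp [GG]
  rw [h1, ← integral_const_mul]
  refine norm_integral_le_of_norm_le (Integrable.const_mul ?_ _) (Eventually.of_forall fun z => ?_)
  · have := (q.integrable.norm).add (q.integrable_pow_mul volume 1)
    refine this.congr (Eventually.of_forall fun z => ?_)
    simp; ring
  · rw [norm_smul, Real.norm_eq_abs, ← mul_assoc]
    gcongr
    refine (hH _ _).trans ?_
    have : ‖x - √σ • z - x‖ = √σ * ‖z‖ := by
      rw [show x - √σ • z - x = -(√σ • z) by abel, norm_neg, norm_smul, Real.norm_of_nonneg (sqrt_nonneg _)]
    rw [this, sqrt_mul (sqrt_nonneg _), ← mul_assoc]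
    gcongr
    rw [sqrt_le_left (by positivity)]
    nlinarith [norm_nonneg z]

theorem GG_continuous (q : 𝓢(Eu n, W)) {X : Type*} [TopologicalSpace X] [FirstCountableTopology X]
    {F : X → Eu n → ℝ} (hF : Continuous (fun a : X × Eu n => F a.1 a.2)) {B : ℝ}
    (hB : ∀ t x, |F t x| ≤ B) {σ : X → ℝ} (hσ : Continuous σ) {x : X → Eu n} (hx : Continuous x) :
    Continuous (fun a : X => GG q (σ a) (F a) (x a)) := by
  unfold GG
  have hF' : ∀ {g : X → Eu n}, Continuous g → Continuous fun a => F a (g a) := fun hg =>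
    hF.comp (continuous_id.prodMk hg)
  refine continuous_of_dominated (bound := fun z => B * ‖q z‖) (fun a => ?_) (fun a => ?_) ?_ ?_
  · have : Continuous (F a) := hF.comp (Continuous.prodMk_right a)
    exact (Continuous.smul (by fun_prop) q.continuous).aestronglyMeasurable
  · refine Eventually.of_forall fun z => ?_
    rw [norm_smul]; gcongr; exact hB _ _
  · exact q.integrable.norm.const_mul B
  · refine Eventually.of_forall fun z => ?_
    exact (hF' (by fun_prop)).smul continuous_const

/-- kernel form -/
theorem GG_kernel (q : 𝓢(Eu n, W)) {σ : ℝ} (hσ : 0 < σ) (F : Eu n → ℝ) (x : Eu n) :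
    GG q σ F x = ((√σ) ^ n)⁻¹ • ∫ y, F y • q ((√σ)⁻¹ • (x - y)) := by
  have hs : 0 < √σ := sqrt_pos.2 hσ
  have h1 : ∫ y, F y • q ((√σ)⁻¹ • (x - y)) = ∫ y, F (x - y) • q ((√σ)⁻¹ • y) := by
    rw [← integral_sub_left_eq_self _ volume x]
    congr 1; ext y; congr 3; abel
  rw [h1]
  have h2 := Measure.integral_comp_inv_smul (volume : Measure (Eu n)) (fun z => F (x - √σ • z) • q z) (√σ)
  have h3 : (fun y : Eu n => F (x - √σ • (√σ)⁻¹ • y) • q ((√σ)⁻¹ • y)) = fun y => F (x - y) • q ((√σ)⁻¹ • y) := by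
    ext y; rw [smul_inv_smul₀ hs.ne']
  rw [h3] at h2
  rw [h2, finrank_euclideanSpace_fin, abs_of_pos (by positivity), inv_smul_smul₀ (by positivity)]
  rfl

set_option maxHeartbeats 1000000 in
theorem GG_hasFDerivAt [CompleteSpace W] (q : 𝓢(Eu n, W)) {σ : ℝ} (hσ : 0 < σ) {F : Eu n → ℝ} (hF : Continuous F) {B : ℝ}
    (hB : ∀ x, |F x| ≤ B) (x : Eu n) :
    HasFDerivAt (GG q σ F) ((√σ)⁻¹ • GG (SD q) σ F x) x := by
  have hs : 0 < √σ := sqrt_pos.2 hσ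
  have e1 : GG q σ F = fun x => ((√σ) ^ n)⁻¹ • ∫ y, F y • q ((√σ)⁻¹ • (x - y)) := by
    ext x; exact GG_kernel q hσ F x
  have e2 : (√σ)⁻¹ • GG (SD q) σ F x = ((√σ) ^ n)⁻¹ • ∫ y, F y • (√σ)⁻¹ • SD q ((√σ)⁻¹ • (x - y)) := by
    rw [GG_kernel (SD q) hσ F x, smul_comm, ← integral_smul]
    congr 2; ext1 y; rw [smul_comm]
  rw [e1, e2]
  refine HasFDerivAt.const_smul ?_ _
  obtain ⟨C, hC, hb⟩ := schwartz_bound (SD q) (n + 1)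
  have hB0 : 0 ≤ B := (abs_nonneg _).trans (hB 0)
  have hcomp : ∀ x : Eu n, Integrable fun y => F y • q ((√σ)⁻¹ • (x - y)) := by
    intro x
    have h1 : Integrable fun y => q ((√σ)⁻¹ • (x - y)) :=
      ((integrable_comp_smul_iff volume q (inv_ne_zero hs.ne')).2 q.integrable).comp_sub_left x
    refine (h1.norm.const_mul B).mono' ?_ (Eventually.of_forall fun z => ?_)
    · exact (Continuous.smul hF (q.continuous.comp (by fun_prop))).aestronglyMeasurable
    · rw [norm_smul]; gcongr; exact hB _
  refine hasFDerivAt_integral_of_dominated_of_fderiv_le (𝕜 := ℝ) (F := fun x y => F y • q ((√σ)⁻¹ • (x - y)))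
    (F' := fun x y => F y • (√σ)⁻¹ • SD q ((√σ)⁻¹ • (x - y)))
    (bound := fun y => B * ((√σ)⁻¹ * (C * 2 ^ (n+1) * (1 + ‖(√σ)⁻¹ • (x - y)‖) ^ (-((n + 1 : ℕ):ℝ)))))
    (s := ball x (√σ)) (ball_mem_nhds x hs) ?_ (hcomp x) ?_ ?_ ?_ ?_
  · exact Eventually.of_forall fun x => (hcomp x).aestronglyMeasurable
  · have hc : Continuous fun y : Eu n => (√σ)⁻¹ • (x - y) := by fun_prop
    exact (Continuous.smul hF (((SD q).continuous.comp hc).const_smul (√σ)⁻¹)).aestronglyMeasurable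
  · refine Eventually.of_forall fun y x' hx' => ?_
    rw [norm_smul, norm_smul, Real.norm_of_nonneg (r := (√σ)⁻¹) (by positivity)]
    gcongr
    · exact hB y
    refine (hb _).trans ?_
    rw [mul_assoc]
    gcongr
    rw [rpow_neg (by positivity), rpow_neg (by positivity), rpow_natCast, rpow_natCast,
      inv_eq_one_div, div_le_iff₀ (by positivity), mul_assoc, mul_comm, mul_assoc, ← div_eq_inv_mul]
    rw [le_div_iff₀ (by positivity), one_mul, ← mul_pow]
    gcongr
    have : ‖(√σ)⁻¹ • (x - y)‖ ≤ ‖(√σ)⁻¹ • (x' - y)‖ + 1 := by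
      have : (√σ)⁻¹ • (x - y) = (√σ)⁻¹ • (x' - y) + (√σ)⁻¹ • (x - x') := by
        rw [← smul_add]; congr 1; abel
      rw [this]
      refine (norm_add_le _ _).trans ?_
      gcongr
      rw [norm_smul, Real.norm_of_nonneg (by positivity), inv_mul_le_iff₀ hs, mul_one, ← dist_eq_norm, dist_comm]
      exact (mem_ball.1 hx').le
    nlinarith [norm_nonneg ((√σ)⁻¹ • (x' - y))]
  · refine (Integrable.const_mul (Integrable.const_mul (Integrable.const_mul ?_ _) _) _)
    have h0 : Integrable (fun z : Eu n => (1 + ‖z‖) ^ (-((n + 1 : ℕ):ℝ))) :=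
      integrable_one_add_norm (by rw [finrank_euclideanSpace_fin]; push_cast; linarith)
    exact ((integrable_comp_smul_iff volume (fun z : Eu n => (1 + ‖z‖) ^ (-((n + 1 : ℕ):ℝ)))
      (inv_ne_zero hs.ne')).2 h0).comp_sub_left x
  · refine Eventually.of_forall fun y x' hx' => ?_
    refine HasFDerivAt.const_smul ?_ (F y)
    have h1 : HasFDerivAt q (SD q ((√σ)⁻¹ • (x' - y))) ((√σ)⁻¹ • (x' - y)) := q.differentiableAt.hasFDerivAt
    have h2 : HasFDerivAt (fun x : Eu n => (√σ)⁻¹ • (x - y)) ((√σ)⁻¹ • ContinuousLinearMap.id ℝ (Eu n)) x' :=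
      ((hasFDerivAt_id x').sub_const y).fun_const_smul (√σ)⁻¹
    have := h1.comp x' h2
    rw [ContinuousLinearMap.comp_smul] at this
    simpa [Function.comp_def] using this

theorem integral_SD [CompleteSpace W] (q : 𝓢(Eu n, W)) : ∫ z, SD q z = 0 := by
  have h := GG_hasFDerivAt q one_pos (F := fun _ => 1) continuous_const (B := 1) (by simp) 0
  have e : GG q 1 (fun _ => 1) = fun _ : Eu n => ∫ z, q z := by ext; simp [GG]
  rw [e] at h
  have := h.unique (hasFDerivAt_const _ _)
  simpa [GG] using this
end

end

section
open Real Set MeasureTheory Metric Filter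
open scoped Topology SchwartzMap

variable {n : ℕ}

/-- trace of a bilinear form -/
noncomputable def trL (n : ℕ) : (Eu n →L[ℝ] Eu n →L[ℝ] ℝ) →L[ℝ] ℝ :=
  ∑ i : Fin n, (ContinuousLinearMap.apply ℝ ℝ (EuclideanSpace.single i 1 : Eu n)).comp
    (ContinuousLinearMap.apply ℝ (Eu n →L[ℝ] ℝ) (EuclideanSpace.single i 1 : Eu n))

theorem trL_apply (A : Eu n →L[ℝ] Eu n →L[ℝ] ℝ) :
    trL n A = ∑ i : Fin n, A (EuclideanSpace.single i 1) (EuclideanSpace.single i 1) := by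
  simp [trL]

/-- Laplacian of the Gaussian -/
noncomputable def Lgam (n : ℕ) : 𝓢(Eu n, ℝ) := (SD (SD (gam n))).postcompCLM (trL n)

theorem Lgam_apply (z : Eu n) : Lgam n z = (-(n:ℝ)/2 + ‖z‖ ^ 2 / 4) * gam n z := by
  have h0 : ∀ z : Eu n, HasFDerivAt (gam n) ((-(1/2) * gam n z) • innerSL ℝ z) z := by
    intro z
    have h1 : HasFDerivAt (fun z : Eu n => ‖z‖ ^ 2) (2 • innerSL ℝ z) z := (hasStrictFDerivAt_norm_sq z).hasFDerivAt
    have h2 := ((h1.const_mul (-(1/4))).exp).const_mul ((4 * π) ^ (-(n:ℝ) / 2))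
    have e : (gam n : Eu n → ℝ) = fun y => (4 * π) ^ (-(n:ℝ) / 2) * exp (-(1/4) * ‖y‖ ^ 2) := by
      ext y; exact gam_apply y
    rw [e]
    refine h2.congr_fderiv ?_
    ext w
    simp
    ring
  have h1 : ∀ w, SD (gam n) w = (-(1/2) * gam n w) • innerSL ℝ w := fun w => (h0 w).fderiv
  let I : Eu n →L[ℝ] Eu n →L[ℝ] ℝ := innerSL ℝ
  have h2 : HasFDerivAt (SD (gam n)) ((-(1/2) * gam n z) • I +
      ((-(1/2) : ℝ) • ((-(1/2) * gam n z) • innerSL ℝ z)).smulRight (innerSL ℝ z)) z := by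
    have e : (SD (gam n) : Eu n → _) = fun w => (-(1/2) * gam n w) • innerSL ℝ w := funext h1
    rw [e]
    exact ((h0 z).const_mul (-(1/2))).fun_smul I.hasFDerivAt
  have h3 : SD (SD (gam n)) z = _ := h2.fderiv
  have : Lgam n z = trL n (SD (SD (gam n)) z) := rfl
  rw [this, h3, trL_apply]
  have hz : ‖z‖ ^ 2 = ∑ i, z i ^ 2 := EuclideanSpace.real_norm_sq_eq z
  rw [hz, add_mul, Finset.sum_div, Finset.sum_mul]
  have : -(n:ℝ)/2 * gam n z = ∑ i : Fin n, -(1/2) * gam n z := by simp; ring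
  rw [this, ← Finset.sum_add_distrib]
  refine Finset.sum_congr rfl fun i _ => ?_
  have e1 : I (EuclideanSpace.single i 1) (EuclideanSpace.single i 1) = 1 := by
    show innerSL ℝ (EuclideanSpace.single i 1 : Eu n) (EuclideanSpace.single i 1) = _
    rw [innerSL_apply_apply]
    simp
  have e2 : innerSL ℝ z (EuclideanSpace.single i 1) = z i := by
    rw [innerSL_apply_apply]
    simp [EuclideanSpace.inner_single_right]
  rw [add_apply, add_apply, smul_apply, smul_apply, ContinuousLinearMap.smulRight_apply, smul_apply, smul_apply,
    smul_apply, e1, e2]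
  simp only [smul_eq_mul]
  ring

theorem tr_GG (q : 𝓢(Eu n, Eu n →L[ℝ] Eu n →L[ℝ] ℝ)) (σ : ℝ) {F : Eu n → ℝ} (hF : Continuous F) {B : ℝ}
    (hB : ∀ x, |F x| ≤ B) (x : Eu n) :
    trL n (GG q σ F x) = GG (q.postcompCLM (𝕜 := ℝ) (trL n)) σ F x := by
  have h := ContinuousLinearMap.integral_comp_comm (𝕜 := ℝ) (Fₗ := ℝ) (trL n) (GG_integrable q σ hF hB x)
  unfold GG
  refine h.symm.trans ?_
  congr 1
  ext z
  exact (trL n).map_smul _ _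

theorem integral_Lgam : ∫ z, Lgam n z = 0 := by
  have h := ContinuousLinearMap.integral_comp_comm (trL n) (SD (SD (gam n))).integrable (μ := volume)
  rw [integral_SD, map_zero] at h
  exact h

theorem schwartz_comp_int {W : Type*} [NormedAddCommGroup W] {f : Eu n → W} (hf : Integrable f)
    {s : ℝ} (hs : s ≠ 0) (x : Eu n) : Integrable fun y => f (s • (x - y)) :=
  ((integrable_comp_smul_iff volume f hs).2 hf).comp_sub_left x

theorem gam_scale (σ : ℝ) (hσ : 0 < σ) (w : Eu n) :
    gam n ((√σ)⁻¹ • w) = (4 * π) ^ (-(n:ℝ) / 2) * exp (-(1/4) * ‖w‖ ^ 2 * σ⁻¹) := by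
  rw [gam_apply, norm_smul, mul_pow, norm_inv, Real.norm_of_nonneg (sqrt_nonneg _), inv_pow, sq_sqrt hσ.le]
  ring_nf

set_option maxHeartbeats 1000000 in
theorem GG_hasDerivAt {σ : ℝ} (hσ : 0 < σ) {F : Eu n → ℝ} (hF : Continuous F) {B : ℝ}
    (hB : ∀ x, |F x| ≤ B) (x : Eu n) :
    HasDerivAt (fun σ => GG (gam n) σ F x) (σ⁻¹ * GG (Lgam n) σ F x) σ := by
  have hB0 : 0 ≤ B := (abs_nonneg _).trans (hB 0)
  have hs : 0 < √σ := sqrt_pos.2 hσ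
  have hi0 : ∀ s > 0, Integrable fun y => F y * gam n ((√s)⁻¹ • (x - y)) := by
    intro s hs
    refine ((schwartz_comp_int (gam n).integrable.norm (inv_ne_zero (sqrt_pos.2 hs).ne') x).const_mul B).mono' ?_
      (Eventually.of_forall fun z => ?_)
    · exact (hF.mul ((gam n).continuous.comp (by fun_prop))).aestronglyMeasurable
    · rw [norm_mul]; gcongr; exact hB _
  have key := hasDerivAt_integral_of_dominated_loc_of_deriv_le (μ := volume) (x₀ := σ) (s := Ioo (σ/2) (2*σ))
    (F := fun s y => F y * gam n ((√s)⁻¹ • (x - y)))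
    (F' := fun s y => F y * (gam n ((√s)⁻¹ • (x - y)) * (1/4 * ‖x - y‖ ^ 2 * (s ^ 2)⁻¹)))
    (bound := fun y => B * ((2 / σ) * (‖(√(2 * σ))⁻¹ • (x - y)‖ ^ 2 * ‖gam n ((√(2*σ))⁻¹ • (x - y))‖)))
    (Ioo_mem_nhds (by linarith) (by linarith)) ?_ (hi0 σ hσ) ?_ ?_ ?_ ?_
  · have hd := key.2
    have e : (fun σ => GG (gam n) σ F x) =ᶠ[𝓝 σ]
        fun s => s ^ (-(n:ℝ)/2) * ∫ y, F y * gam n ((√s)⁻¹ • (x - y)) := by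
      filter_upwards [lt_mem_nhds hσ] with s hs
      rw [GG_kernel _ hs]
      have : ((√s) ^ n)⁻¹ = s ^ (-(n:ℝ)/2) := by
        rw [sqrt_eq_rpow, ← rpow_natCast, ← rpow_mul hs.le, ← rpow_neg hs.le]; congr 1; ring
      rw [this]; rfl
    refine HasDerivAt.congr_of_eventuallyEq ?_ e
    have h1 : HasDerivAt (fun s : ℝ => s ^ (-(n:ℝ)/2)) (-(n:ℝ)/2 * σ ^ (-(n:ℝ)/2 - 1)) σ :=
      hasDerivAt_rpow_const (Or.inl hσ.ne')
    refine (h1.mul hd).congr_deriv ?_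
    have hE : ((√σ) ^ n)⁻¹ = σ ^ (-(n:ℝ)/2) := by
        rw [sqrt_eq_rpow, ← rpow_natCast, ← rpow_mul hσ.le, ← rpow_neg hσ.le]; congr 1; ring
    rw [GG_kernel _ hσ, hE, rpow_sub_one hσ.ne', smul_eq_mul]
    have h3 : ∀ y, F y • Lgam n ((√σ)⁻¹ • (x - y)) = -(n:ℝ)/2 * (F y * gam n ((√σ)⁻¹ • (x - y)))
        + σ * (F y * (gam n ((√σ)⁻¹ • (x - y)) * (1/4 * ‖x - y‖ ^ 2 * (σ ^ 2)⁻¹))) := by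
      intro y
      rw [Lgam_apply, norm_smul, mul_pow, norm_inv, Real.norm_of_nonneg (sqrt_nonneg _), inv_pow, sq_sqrt hσ.le,
        smul_eq_mul]
      field_simp
    simp_rw [h3]
    rw [integral_add ((hi0 σ hσ).const_mul _) (key.1.const_mul _), integral_const_mul, integral_const_mul]
    field_simp
  · filter_upwards [lt_mem_nhds hσ] with s hs
    exact (hi0 s hs).aestronglyMeasurable
  · refine Continuous.aestronglyMeasurable ?_
    exact hF.mul (((gam n).continuous.comp (by fun_prop)).mul (by fun_prop))
  · refine Eventually.of_forall fun y s hs => ?_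
    have hs0 : 0 < s := by linarith [hs.1]
    rw [norm_mul, Real.norm_eq_abs (F y)]
    refine mul_le_mul (hB y) ?_ (norm_nonneg _) hB0
    rw [gam_scale s hs0, gam_scale (2 * σ) (by linarith), norm_mul, Real.norm_of_nonneg (by positivity),
      Real.norm_of_nonneg (by positivity), Real.norm_of_nonneg (by positivity), norm_smul, mul_pow, norm_inv,
      Real.norm_of_nonneg (sqrt_nonneg _), inv_pow, sq_sqrt (by linarith : 0 ≤ 2 * σ)]
    have h1 : exp (-(1/4) * ‖x - y‖ ^ 2 * s⁻¹) ≤ exp (-(1/4) * ‖x - y‖ ^ 2 * (2 * σ)⁻¹) := by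
      rw [exp_le_exp]
      have : (2 * σ)⁻¹ ≤ s⁻¹ := inv_anti₀ hs0 hs.2.le
      nlinarith [sq_nonneg ‖x - y‖]
    have h2 : (s ^ 2)⁻¹ ≤ ((σ/2) ^ 2)⁻¹ := by
      apply inv_anti₀ (by positivity)
      have := hs.1
      gcongr
    calc _ ≤ (4 * π) ^ (-(n:ℝ) / 2) * exp (-(1/4) * ‖x - y‖ ^ 2 * (2 * σ)⁻¹) * (1/4 * ‖x - y‖ ^ 2 * ((σ/2) ^ 2)⁻¹) := by
          gcongr
      _ = _ := by field_simp; norm_num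
  · refine Integrable.const_mul (Integrable.const_mul ?_ _) _
    exact schwartz_comp_int ((gam n).integrable_pow_mul volume 2) (inv_ne_zero (sqrt_pos.2 (by linarith)).ne') x
  · refine Eventually.of_forall fun y s hs => ?_
    have hs0 : 0 < s := by linarith [hs.1]
    refine HasDerivAt.const_mul _ ?_
    have e : (fun s => gam n ((√s)⁻¹ • (x - y))) =ᶠ[𝓝 s]
        fun s => (4 * π) ^ (-(n:ℝ) / 2) * exp (-(1/4) * ‖x - y‖ ^ 2 * s⁻¹) := by
      filter_upwards [lt_mem_nhds hs0] with r hr using gam_scale r hr _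
    refine HasDerivAt.congr_of_eventuallyEq ?_ e
    refine (((hasDerivAt_inv hs0.ne').const_mul (-(1/4) * ‖x - y‖ ^ 2)).exp.const_mul _).congr_deriv ?_
    rw [gam_scale s hs0]
    ring

theorem inv_mul_sqrt2 {θ : ℝ} (h : 0 < θ) : θ⁻¹ * √(√θ) = θ ^ (-(3/4) : ℝ) := by
  rw [sqrt_eq_rpow, sqrt_eq_rpow, ← rpow_mul h.le, ← rpow_neg_one, ← rpow_add h]; norm_num

theorem rpow34_int (a b : ℝ) : IntervalIntegrable (fun θ : ℝ => θ ^ (-(3/4) : ℝ)) volume a b :=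
  intervalIntegral.intervalIntegrable_rpow' (by norm_num)

theorem GG_heat_int {F : Eu n → ℝ} (hF : Continuous F) {B H : ℝ}
    (hB : ∀ x, |F x| ≤ B) (hH : ∀ x y, |F x - F y| ≤ H * √‖x - y‖) (hH0 : 0 ≤ H) (x : Eu n) {σ : ℝ} (hσ : 0 ≤ σ) :
    IntervalIntegrable (fun τ => τ⁻¹ * GG (Lgam n) τ F x) volume 0 σ := by
  have hc : Continuous fun τ => GG (Lgam n) τ F x :=
    GG_continuous (Lgam n) (X := ℝ) (F := fun _ => F) (hF.comp continuous_snd) (B := B) (fun _ => hB) continuous_id continuous_const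
  have hb := (rpow34_int 0 σ).const_mul (H * ∫ z, (1 + ‖z‖) * ‖Lgam n z‖)
  refine hb.mono_fun (measurable_inv.aestronglyMeasurable.mul hc.aestronglyMeasurable) ?_
  refine (ae_restrict_iff' measurableSet_uIoc).2 (Eventually.of_forall fun τ hτ => ?_)
  rw [uIoc_of_le hσ] at hτ
  have := GG_holder (Lgam n) integral_Lgam τ hF hB hH hH0 x
  show ‖_ * _‖ ≤ ‖_ * _‖
  rw [norm_mul, ← inv_mul_sqrt2 hτ.1, norm_inv, Real.norm_of_nonneg hτ.1.le]
  have i0 : 0 ≤ τ⁻¹ := inv_nonneg.2 hτ.1.le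
  refine (mul_le_mul_of_nonneg_left this i0).trans (le_trans (le_of_eq ?_) (le_abs_self _))
  ring

theorem GG_heat {F : Eu n → ℝ} (hF : Continuous F) {B H : ℝ}
    (hB : ∀ x, |F x| ≤ B) (hH : ∀ x y, |F x - F y| ≤ H * √‖x - y‖) (hH0 : 0 ≤ H) (x : Eu n) {σ : ℝ} (hσ : 0 ≤ σ) :
    GG (gam n) σ F x = F x + ∫ τ in 0..σ, τ⁻¹ * GG (Lgam n) τ F x := by
  have hc : Continuous fun τ => GG (gam n) τ F x :=
    GG_continuous (gam n) (X := ℝ) (F := fun _ => F) (hF.comp continuous_snd) (B := B) (fun _ => hB) continuous_id continuous_const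
  have h := intervalIntegral.integral_eq_sub_of_hasDerivAt_of_le hσ hc.continuousOn
    (fun τ hτ => GG_hasDerivAt hτ.1 hF hB x) (GG_heat_int hF hB hH hH0 x hσ)
  have h0 : GG (gam n) 0 F x = F x := by
    simp [GG, integral_const_mul, integral_gam]
  rw [h, h0]; ring

end

section
open Real Set MeasureTheory Metric Filter
open scoped Topology SchwartzMap

variable {n : ℕ}

/-- bounded, jointly continuous, spatially half-Hoelder functions -/
structure HF (F : ℝ → Eu n → ℝ) (B H : ℝ) : Prop where
  cont : Continuous (fun a : ℝ × Eu n => F a.1 a.2)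
  bd : ∀ t x, |F t x| ≤ B
  hol : ∀ t x y, |F t x - F t y| ≤ H * √‖x - y‖
  H0 : 0 ≤ H

theorem HF.c {F : ℝ → Eu n → ℝ} {B H : ℝ} (h : HF F B H) (t : ℝ) : Continuous (F t) :=
  h.cont.comp (Continuous.prodMk_right t)

section
variable {W : Type*} [NormedAddCommGroup W] [NormedSpace ℝ W]

/-- time integral of kernels -/
noncomputable def JJ (w : ℝ → ℝ) (q : 𝓢(Eu n, W)) (F : ℝ → Eu n → ℝ) (t : ℝ) (x : Eu n) : W :=
  ∫ θ in 0..1, w θ • GG q (t * θ) (F (t * (1 - θ))) x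

/-- admissible weights -/
def JB (w : ℝ → ℝ) (q : 𝓢(Eu n, W)) (F : ℝ → Eu n → ℝ) : Prop :=
  Measurable w ∧ ∀ R : ℝ, ∃ C : ℝ, ∀ t ≤ R, ∀ θ ∈ Ioc (0:ℝ) 1, ∀ x,
    ‖w θ • GG q (t * θ) (F (t * (1 - θ))) x‖ ≤ C * θ ^ (-(3/4) : ℝ)

theorem GG_cont_theta (q : 𝓢(Eu n, W)) {F : ℝ → Eu n → ℝ} {B H : ℝ} (h : HF F B H) (t : ℝ) (x : Eu n) :
    Continuous fun θ => GG q (t * θ) (F (t * (1 - θ))) x := by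
  refine GG_continuous q (X := ℝ) (F := fun θ => F (t * (1 - θ))) ?_ (B := B) (fun _ => h.bd _) (by fun_prop) continuous_const
  exact h.cont.comp (f := fun a : ℝ × Eu n => (t * (1 - a.1), a.2)) (by fun_prop)

theorem GG_cont_tx (q : 𝓢(Eu n, W)) {F : ℝ → Eu n → ℝ} {B H : ℝ} (h : HF F B H) (θ : ℝ) :
    Continuous fun a : ℝ × Eu n => GG q (a.1 * θ) (F (a.1 * (1 - θ))) a.2 := by
  refine GG_continuous q (X := ℝ × Eu n) (F := fun a => F (a.1 * (1 - θ))) ?_ (B := B) (fun _ => h.bd _) (by fun_prop) continuous_snd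
  exact h.cont.comp (f := fun a : (ℝ × Eu n) × Eu n => (a.1.1 * (1 - θ), a.2)) (by fun_prop)

theorem JJ_meas {w : ℝ → ℝ} (q : 𝓢(Eu n, W)) {F : ℝ → Eu n → ℝ} {B H : ℝ} (h : HF F B H)
    (hw : Measurable w) (t : ℝ) (x : Eu n) (μ : Measure ℝ) :
    AEStronglyMeasurable (fun θ => w θ • GG q (t * θ) (F (t * (1 - θ))) x) μ :=
  hw.aestronglyMeasurable.smul (GG_cont_theta q h t x).aestronglyMeasurable

theorem JJ_int {w : ℝ → ℝ} {q : 𝓢(Eu n, W)} {F : ℝ → Eu n → ℝ} {B H : ℝ} (h : HF F B H)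
    (hJ : JB w q F) (t : ℝ) (x : Eu n) :
    IntervalIntegrable (fun θ => w θ • GG q (t * θ) (F (t * (1 - θ))) x) volume 0 1 := by
  obtain ⟨C, hC⟩ := hJ.2 t
  refine ((rpow34_int 0 1).const_mul C).mono_fun (JJ_meas q h hJ.1 t x _) ?_
  refine (ae_restrict_iff' measurableSet_uIoc).2 (Eventually.of_forall fun θ hθ => ?_)
  rw [uIoc_of_le zero_le_one] at hθ
  exact (hC t le_rfl θ hθ x).trans (le_abs_self _)

theorem JJ_cont {w : ℝ → ℝ} {q : 𝓢(Eu n, W)} {F : ℝ → Eu n → ℝ} {B H : ℝ} (h : HF F B H)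
    (hJ : JB w q F) : Continuous fun a : ℝ × Eu n => JJ w q F a.1 a.2 := by
  rw [continuous_iff_continuousAt]
  rintro ⟨t, x⟩
  obtain ⟨C, hC⟩ := hJ.2 (t + 1)
  refine intervalIntegral.continuousAt_of_dominated_interval (bound := fun θ => C * θ ^ (-(3/4) : ℝ)) ?_ ?_ ?_ ?_
  · exact Eventually.of_forall fun a => JJ_meas q h hJ.1 _ _ _
  · have : ∀ᶠ a : ℝ × Eu n in 𝓝 (t, x), a.1 < t + 1 := (continuous_fst.tendsto (t,x)).eventually (gt_mem_nhds (by simp))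
    filter_upwards [this] with a ha
    refine Eventually.of_forall fun θ hθ => ?_
    rw [uIoc_of_le zero_le_one] at hθ
    exact hC a.1 ha.le θ hθ a.2
  · exact (rpow34_int 0 1).const_mul C
  · exact Eventually.of_forall fun θ hθ => ((GG_cont_tx q h θ).const_smul (w θ)).continuousAt

theorem JJ_cont_x {w : ℝ → ℝ} {q : 𝓢(Eu n, W)} {F : ℝ → Eu n → ℝ} {B H : ℝ} (h : HF F B H)
    (hJ : JB w q F) (t : ℝ) : Continuous (JJ w q F t) :=
  (JJ_cont h hJ).comp (Continuous.prodMk_right t)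

theorem JJ_hasFDerivAt [CompleteSpace W] {w w' : ℝ → ℝ} {q : 𝓢(Eu n, W)} {F : ℝ → Eu n → ℝ} {B H : ℝ} (h : HF F B H)
    (hJ : JB w q F) (hJ' : JB w' (SD q) F) {t κ : ℝ} (ht : 0 < t)
    (hw : ∀ θ ∈ Ioc (0:ℝ) 1, w θ * (√(t * θ))⁻¹ = κ * w' θ) (x : Eu n) :
    HasFDerivAt (JJ w q F t) (κ • JJ w' (SD q) F t x) x := by
  obtain ⟨C, hC⟩ := hJ'.2 t
  unfold JJ
  rw [← intervalIntegral.integral_smul]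
  refine intervalIntegral.hasFDerivAt_integral_of_dominated_of_fderiv_le (𝕜 := ℝ)
    (F' := fun x θ => κ • w' θ • GG (SD q) (t * θ) (F (t * (1 - θ))) x)
    (bound := fun θ => ‖κ‖ * (C * θ ^ (-(3/4) : ℝ)))
    univ_mem ?_ (JJ_int h hJ t x) ?_ ?_ ?_ ?_
  · exact Eventually.of_forall fun y => JJ_meas q h hJ.1 _ _ _
  · exact (JJ_meas (SD q) h hJ'.1 t x _).const_smul κ
  · refine Eventually.of_forall fun θ hθ y _ => ?_
    rw [uIoc_of_le zero_le_one] at hθ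
    rw [norm_smul]
    exact mul_le_mul_of_nonneg_left (hC t le_rfl θ hθ y) (norm_nonneg _)
  · exact ((rpow34_int 0 1).const_mul C).const_mul _
  · refine Eventually.of_forall fun θ hθ y _ => ?_
    rw [uIoc_of_le zero_le_one] at hθ
    have := (GG_hasFDerivAt q (mul_pos ht hθ.1) (h.c (t * (1 - θ))) (h.bd _) y).fun_const_smul (w θ)
    refine this.congr_fderiv ?_
    rw [smul_smul, hw θ hθ, smul_smul]

theorem one_le_34 {θ : ℝ} (h : θ ∈ Ioc (0:ℝ) 1) : 1 ≤ θ ^ (-(3/4) : ℝ) :=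
  one_le_rpow_of_pos_of_le_one_of_nonpos h.1 h.2 (by norm_num)

theorem sqrt_inv_le_34 {θ : ℝ} (h : θ ∈ Ioc (0:ℝ) 1) : (√θ)⁻¹ ≤ θ ^ (-(3/4) : ℝ) := by
  rw [sqrt_eq_rpow, ← rpow_neg h.1.le]
  exact rpow_le_rpow_of_exponent_ge h.1 h.2 (by norm_num)

theorem JB_one (q : 𝓢(Eu n, W)) {F : ℝ → Eu n → ℝ} {B H : ℝ} (h : HF F B H) : JB (fun _ => 1) q F := by
  refine ⟨measurable_const, fun R => ⟨B * ∫ z, ‖q z‖, fun t _ θ hθ x => ?_⟩⟩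
  rw [one_smul]
  have h1 := GG_bound q (t * θ) (h.bd (t * (1 - θ))) x
  have h2 := one_le_34 hθ
  have h3 := (norm_nonneg _).trans h1
  nlinarith

theorem JB_sqrt (q : 𝓢(Eu n, W)) {F : ℝ → Eu n → ℝ} {B H : ℝ} (h : HF F B H) : JB (fun θ => (√θ)⁻¹) q F := by
  refine ⟨by fun_prop, fun R => ⟨B * ∫ z, ‖q z‖, fun t _ θ hθ x => ?_⟩⟩
  rw [norm_smul, norm_inv, Real.norm_of_nonneg (sqrt_nonneg _), mul_comm]
  have h1 := GG_bound q (t * θ) (h.bd (t * (1 - θ))) x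
  have h2 := sqrt_inv_le_34 hθ
  have h3 := (norm_nonneg _).trans h1
  have : 0 ≤ (√θ)⁻¹ := by positivity
  gcongr

theorem GG_inv_bound [CompleteSpace W] {q : 𝓢(Eu n, W)} (hq : ∫ z, q z = 0) {F : ℝ → Eu n → ℝ} {B H : ℝ} (h : HF F B H)
    {t R θ : ℝ} (hR : 0 ≤ R) (ht : t ≤ R) (hθ : θ ∈ Ioc (0:ℝ) 1) (x : Eu n) :
    ‖θ⁻¹ • GG q (t * θ) (F (t * (1 - θ))) x‖ ≤ (H * √(√R) * ∫ z, (1 + ‖z‖) * ‖q z‖) * θ ^ (-(3/4) : ℝ) := by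
  have h1 := GG_holder q hq (t * θ) (h.c (t * (1 - θ))) (h.bd _) (h.hol _) h.H0 x
  have hA : 0 ≤ ∫ z, (1 + ‖z‖) * ‖q z‖ := integral_nonneg fun z => by positivity
  have h2 : √(√(t * θ)) ≤ √(√R) * √(√θ) := by
    rw [← sqrt_mul (sqrt_nonneg _), ← sqrt_mul hR]
    have := hθ.1
    gcongr
  have hH := h.H0
  have i0 : 0 < θ⁻¹ := inv_pos.2 hθ.1
  rw [norm_smul, Real.norm_of_nonneg i0.le, ← inv_mul_sqrt2 hθ.1]
  calc _ ≤ θ⁻¹ * (H * (√(√R) * √(√θ)) * ∫ z, (1 + ‖z‖) * ‖q z‖) := by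
        gcongr; exact h1.trans (by gcongr)
    _ = _ := by ring

theorem JB_inv [CompleteSpace W] {q : 𝓢(Eu n, W)} (hq : ∫ z, q z = 0) {F : ℝ → Eu n → ℝ} {B H : ℝ} (h : HF F B H) :
    JB (fun θ => θ⁻¹) q F := by
  refine ⟨measurable_inv, fun R => ⟨H * √(√(max R 0)) * ∫ z, (1 + ‖z‖) * ‖q z‖, fun t ht θ hθ x => ?_⟩⟩
  exact GG_inv_bound hq h (le_max_right _ _) (ht.trans (le_max_left _ _)) hθ x

end

/-- Duhamel potential -/
noncomputable def ZZ (F : ℝ → Eu n → ℝ) (t : ℝ) (x : Eu n) : ℝ := t * JJ (fun _ => 1) (gam n) F t x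

/-- its Laplacian -/
noncomputable def LZ (F : ℝ → Eu n → ℝ) (t : ℝ) (x : Eu n) : ℝ := JJ (fun θ => θ⁻¹) (Lgam n) F t x

variable {F : ℝ → Eu n → ℝ} {B H : ℝ}

theorem ZZ_cont (h : HF F B H) : Continuous fun a : ℝ × Eu n => ZZ F a.1 a.2 :=
  continuous_fst.mul (JJ_cont h (JB_one _ h))

theorem LZ_cont (h : HF F B H) : Continuous fun a : ℝ × Eu n => LZ F a.1 a.2 :=
  JJ_cont h (JB_inv integral_Lgam h)

theorem ZZ_hasFDerivAt (h : HF F B H) {t : ℝ} (ht : 0 < t) (x : Eu n) :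
    HasFDerivAt (ZZ F t) (√t • JJ (fun θ => (√θ)⁻¹) (SD (gam n)) F t x) x := by
  have h1 := (JJ_hasFDerivAt h (JB_one (gam n) h) (JB_sqrt _ h) ht (κ := (√t)⁻¹)
    (fun θ hθ => by rw [one_mul, sqrt_mul ht.le, mul_inv]) x).const_mul t
  rw [smul_smul] at h1
  have : t * (√t)⁻¹ = √t := by
    rw [← div_eq_mul_inv, div_sqrt]
  rwa [this] at h1

theorem ZZ_hasFDerivAt2 (h : HF F B H) {t : ℝ} (ht : 0 < t) (x : Eu n) :
    HasFDerivAt (fun x => √t • JJ (fun θ => (√θ)⁻¹) (SD (gam n)) F t x)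
      (JJ (fun θ => θ⁻¹) (SD (SD (gam n))) F t x) x := by
  have h1 := (JJ_hasFDerivAt h (JB_sqrt (SD (gam n)) h) (JB_inv (integral_SD _) h) ht (κ := (√t)⁻¹)
    (w' := fun θ => θ⁻¹)
    (fun θ hθ => by
      rw [sqrt_mul ht.le, mul_inv, ← mul_assoc, mul_comm (√θ)⁻¹, mul_assoc, ← mul_inv, mul_self_sqrt hθ.1.le]) x).fun_const_smul (√t)
  rwa [smul_smul, mul_inv_cancel₀ (sqrt_pos.2 ht).ne', one_smul] at h1

theorem ZZ_contDiff (h : HF F B H) {t : ℝ} (ht : 0 < t) : ContDiff ℝ 2 (ZZ F t) := by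
  have e1 : fderiv ℝ (ZZ F t) = fun x => √t • JJ (fun θ => (√θ)⁻¹) (SD (gam n)) F t x :=
    funext fun x => (ZZ_hasFDerivAt h ht x).fderiv
  rw [show (2 : WithTop ℕ∞) = 1 + 1 by norm_num, contDiff_succ_iff_fderiv]
  refine ⟨fun x => (ZZ_hasFDerivAt h ht x).differentiableAt, by simp, ?_⟩
  rw [e1, contDiff_one_iff_fderiv]
  refine ⟨fun x => (ZZ_hasFDerivAt2 h ht x).differentiableAt, ?_⟩
  rw [funext fun x => (ZZ_hasFDerivAt2 h ht x).fderiv]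
  exact JJ_cont_x h (JB_inv (integral_SD (SD (gam n))) h) t

theorem lap_ZZ (h : HF F B H) {t : ℝ} (ht : 0 < t) (x : Eu n) : lap (ZZ F t) x = LZ F t x := by
  have e1 : fderiv ℝ (ZZ F t) = fun x => √t • JJ (fun θ => (√θ)⁻¹) (SD (gam n)) F t x :=
    funext fun x => (ZZ_hasFDerivAt h ht x).fderiv
  rw [lap_eq (ZZ_contDiff h ht).contDiffAt, ← trL_apply, e1, (ZZ_hasFDerivAt2 h ht x).fderiv]
  unfold JJ LZ JJ
  have := ContinuousLinearMap.intervalIntegral_comp_comm (𝕜 := ℝ) (F := ℝ) (trL n) (JJ_int h (JB_inv (integral_SD (SD (gam n))) h) t x)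
  refine this.symm.trans ?_
  congr 1
  ext θ
  refine ((trL n).map_smul _ _).trans ?_
  rw [tr_GG _ _ (h.c _) (h.bd _)]
  rfl

theorem LZ_sub {G : ℝ → Eu n → ℝ} (h : HF F B H) {B' H' : ℝ} (h' : HF G B' H') (t : ℝ) (x : Eu n) :
    LZ (fun t x => F t x - G t x) t x = LZ F t x - LZ G t x := by
  unfold LZ JJ
  rw [← intervalIntegral.integral_sub (JJ_int h (JB_inv integral_Lgam h) t x) (JJ_int h' (JB_inv integral_Lgam h') t x)]
  congr 1
  ext θ
  rw [← smul_sub, GG_add (Lgam n) _ (h.c _) (h'.c _) (B := max B B') (fun x => (h.bd _ x).trans (le_max_left _ _))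
    (fun x => (h'.bd _ x).trans (le_max_right _ _))]

/-- constant in the sup bound -/
noncomputable def cA (n : ℕ) : ℝ := ∫ z : Eu n, (1 + ‖z‖) * ‖Lgam n z‖
/-- constant in the gradient bound -/
noncomputable def cA' (n : ℕ) : ℝ := ∫ z : Eu n, (1 + ‖z‖) * ‖SD (Lgam n) z‖

theorem cA_nonneg : 0 ≤ cA n := integral_nonneg fun z => by positivity
theorem cA'_nonneg : 0 ≤ cA' n := integral_nonneg fun z => by positivity

theorem int34 {m : ℝ} : ∫ θ in 0..m, θ ^ (-(3/4) : ℝ) = 4 * m ^ (1/4:ℝ) := by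
  rw [integral_rpow (Or.inl (by norm_num))]
  rw [zero_rpow (by norm_num), show (-(3/4) : ℝ) + 1 = 1/4 by norm_num]
  ring

theorem LZ_bound (h : HF F B H) {t : ℝ} (ht : 0 ≤ t) (x : Eu n) : |LZ F t x| ≤ 4 * cA n * H * √(√t) := by
  have hb := intervalIntegral.norm_integral_le_of_norm_le (μ := volume) zero_le_one
    (f := fun θ => θ⁻¹ • GG (Lgam n) (t * θ) (F (t * (1 - θ))) x)
    (g := fun θ => (H * √(√t) * cA n) * θ ^ (-(3/4) : ℝ))
    (Eventually.of_forall fun θ hθ => GG_inv_bound integral_Lgam h ht le_rfl hθ x) ((rpow34_int 0 1).const_mul _)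
  rw [intervalIntegral.integral_const_mul, int34, one_rpow] at hb
  refine hb.trans (le_of_eq (by ring))

end

section
open Real Set MeasureTheory Metric Filter
open scoped Topology SchwartzMap

variable {n : ℕ} {F : ℝ → Eu n → ℝ} {B H : ℝ}

theorem GG_nonpos {q : 𝓢(Eu n, ℝ)} (hq : ∫ z, q z = 0) {σ : ℝ} (hσ : σ ≤ 0) (F : Eu n → ℝ) (x : Eu n) :
    GG q σ F x = 0 := by
  simp [GG, sqrt_eq_zero_of_nonpos hσ, integral_const_mul, hq]

theorem LZ_nonpos {t : ℝ} (ht : t ≤ 0) (x : Eu n) : LZ F t x = 0 := by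
  unfold LZ JJ
  rw [intervalIntegral.integral_congr (g := fun _ => (0:ℝ))]
  · simp
  · intro θ hθ
    rw [uIcc_of_le zero_le_one] at hθ
    simp only
    rw [GG_nonpos integral_Lgam (mul_nonpos_of_nonpos_of_nonneg ht hθ.1), smul_zero]

theorem GG_lip (h : HF F B H) {σ : ℝ} (hσ : 0 < σ) (t : ℝ) (x y : Eu n) :
    |GG (Lgam n) σ (F t) x - GG (Lgam n) σ (F t) y| ≤ (√σ)⁻¹ * (H * √(√σ) * cA' n) * ‖x - y‖ := by
  refine Convex.norm_image_sub_le_of_norm_hasFDerivWithin_le (𝕜 := ℝ) (s := univ)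
    (f' := fun x => (√σ)⁻¹ • GG (SD (Lgam n)) σ (F t) x)
    (fun x _ => (GG_hasFDerivAt (Lgam n) hσ (h.c t) (h.bd t) x).hasFDerivWithinAt) ?_ convex_univ (mem_univ _) (mem_univ _)
  intro z _
  rw [norm_smul, Real.norm_of_nonneg (by positivity)]
  gcongr
  exact GG_holder _ (integral_SD _) σ (h.c t) (h.bd t) (h.hol t) h.H0 z

theorem int54 {m : ℝ} (h0 : 0 < m) (h1 : m ≤ 1) : ∫ θ in m..1, θ ^ (-(5/4) : ℝ) ≤ 4 * m ^ (-(1/4):ℝ) := by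
  rw [integral_rpow (Or.inr ⟨by norm_num, by rw [uIcc_of_le h1]; exact fun h => absurd h.1 (by linarith)⟩)]
  rw [one_rpow, show (-(5/4) : ℝ) + 1 = -(1/4) by norm_num]
  linarith

theorem sqrt2_rpow (t : ℝ) (ht : 0 ≤ t) : √(√t) = t ^ (1/4:ℝ) := by
  rw [sqrt_eq_rpow, sqrt_eq_rpow, ← rpow_mul ht]; norm_num

theorem LZ_holder (h : HF F B H) (t : ℝ) (x y : Eu n) :
    |LZ F t x - LZ F t y| ≤ (8 * cA n + 4 * cA' n) * H * √‖x - y‖ := by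
  have hA := cA_nonneg (n := n)
  have hA' := cA'_nonneg (n := n)
  have hH := h.H0
  rcases le_or_gt t 0 with ht | ht
  · rw [LZ_nonpos ht, LZ_nonpos ht]; simp; positivity
  rcases eq_or_ne x y with rfl | hxy
  · simp
  have hd : 0 < ‖x - y‖ := norm_pos_iff.2 (sub_ne_zero.2 hxy)
  set d := ‖x - y‖ with hdd
  set m := min 1 (d ^ 2 / t) with hm
  have hm0 : 0 < m := lt_min one_pos (by positivity)
  have hm1 : m ≤ 1 := min_le_left _ _
  have hmd : m ≤ d ^ 2 / t := min_le_right _ _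
  set f : ℝ → ℝ := fun θ => θ⁻¹ • GG (Lgam n) (t * θ) (F (t * (1 - θ))) x - θ⁻¹ • GG (Lgam n) (t * θ) (F (t * (1 - θ))) y with hf
  have hix := JJ_int h (JB_inv integral_Lgam h) t x
  have hiy := JJ_int h (JB_inv integral_Lgam h) t y
  have hif : IntervalIntegrable f volume 0 1 := hix.sub hiy
  have e : LZ F t x - LZ F t y = (∫ θ in 0..m, f θ) + ∫ θ in m..1, f θ := by
    rw [intervalIntegral.integral_add_adjacent_intervals]
    · exact (intervalIntegral.integral_sub hix hiy).symm
    · exact hif.mono_set (by rw [uIcc_of_le hm0.le, uIcc_of_le zero_le_one]; exact Icc_subset_Icc_right hm1)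
    · exact hif.mono_set (by rw [uIcc_of_le hm1, uIcc_of_le zero_le_one]; exact Icc_subset_Icc_left hm0.le)
  have b1 : |∫ θ in 0..m, f θ| ≤ 8 * cA n * H * √d := by
    have hb := intervalIntegral.norm_integral_le_of_norm_le (μ := volume) hm0.le (f := f)
      (g := fun θ => (2 * (H * √(√t) * cA n)) * θ ^ (-(3/4) : ℝ))
      (Eventually.of_forall fun θ hθ => by
        have hθ' : θ ∈ Ioc (0:ℝ) 1 := ⟨hθ.1, hθ.2.trans hm1⟩
        have h1 := GG_inv_bound integral_Lgam h ht.le le_rfl hθ' x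
        have h2 := GG_inv_bound integral_Lgam h ht.le le_rfl hθ' y
        refine (norm_sub_le _ _).trans ((add_le_add h1 h2).trans (le_of_eq ?_))
        unfold cA; ring) ((rpow34_int 0 m).const_mul _)
    rw [intervalIntegral.integral_const_mul, int34] at hb
    refine hb.trans ?_
    have : √(√t) * m ^ (1/4:ℝ) ≤ √d := by
      calc _ ≤ t ^ (1/4:ℝ) * (d^2/t) ^ (1/4:ℝ) := by rw [sqrt2_rpow t ht.le]; gcongr
        _ = √d := by
          rw [← mul_rpow ht.le (by positivity), mul_div_cancel₀ _ ht.ne', ← sqrt2_rpow _ (by positivity), sqrt_sq hd.le]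
    calc _ = 8 * cA n * H * (√(√t) * m ^ (1/4:ℝ)) := by ring
      _ ≤ _ := by gcongr
  have b2 : |∫ θ in m..1, f θ| ≤ 4 * cA' n * H * √d := by
    rcases hm1.eq_or_lt with h1 | h1
    · rw [h1]; simp; positivity
    have hmeq : m = d ^ 2 / t := by
      rcases min_choice 1 (d^2/t) with h2 | h2
      · rw [← hm] at h2; linarith
      · exact h2
    have hb := intervalIntegral.norm_integral_le_of_norm_le (μ := volume) hm1 (f := f)
      (g := fun θ => (H * cA' n * d * t ^ (-(1/4):ℝ)) * θ ^ (-(5/4) : ℝ))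
      (Eventually.of_forall fun θ hθ => by
        have hθ0 : 0 < θ := hm0.trans hθ.1
        have h1 := GG_lip h (mul_pos ht hθ0) (t * (1 - θ)) x y
        rw [hf]; simp only
        rw [← smul_sub, norm_smul, norm_inv, Real.norm_of_nonneg hθ0.le, Real.norm_eq_abs]
        refine (mul_le_mul_of_nonneg_left h1 (by positivity)).trans (le_of_eq ?_)
        have e1 : (√(t * θ))⁻¹ * √(√(t * θ)) = t ^ (-(1/4):ℝ) * θ ^ (-(1/4):ℝ) := by
          rw [sqrt2_rpow _ (by positivity), sqrt_eq_rpow, ← rpow_neg (by positivity), ← rpow_add (by positivity),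
            ← mul_rpow ht.le hθ0.le]
          norm_num
        have e2 : θ⁻¹ * θ ^ (-(1/4):ℝ) = θ ^ (-(5/4):ℝ) := by
          rw [← rpow_neg_one, ← rpow_add hθ0]; norm_num
        rw [← e2]
        calc _ = θ⁻¹ * H * cA' n * d * ((√(t * θ))⁻¹ * √(√(t * θ))) := by ring
          _ = _ := by rw [e1]; ring)
      (IntervalIntegrable.const_mul (intervalIntegral.intervalIntegrable_rpow
        (Or.inr (by rw [uIcc_of_le hm1]; exact fun h => absurd h.1 (by linarith)))) _)
    rw [intervalIntegral.integral_const_mul] at hb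
    refine hb.trans ?_
    have i1 := int54 hm0 hm1
    have : d * t ^ (-(1/4):ℝ) * m ^ (-(1/4):ℝ) = √d := by
      rw [mul_assoc, ← mul_rpow ht.le hm0.le, hmeq, mul_div_cancel₀ _ ht.ne', ← rpow_natCast, ← rpow_mul hd.le, sqrt_eq_rpow]
      nth_rewrite 1 [← rpow_one d]
      rw [← rpow_add hd]; norm_num
    calc _ ≤ (H * cA' n * d * t ^ (-(1/4):ℝ)) * (4 * m ^ (-(1/4):ℝ)) := by gcongr
      _ = 4 * cA' n * H * (d * t ^ (-(1/4):ℝ) * m ^ (-(1/4):ℝ)) := by ring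
      _ = _ := by rw [this]
  rw [e]
  refine (abs_add_le _ _).trans ((add_le_add b1 b2).trans (le_of_eq (by ring)))

/-- space-time kernel along a fixed point -/
noncomputable def kk (F : ℝ → Eu n → ℝ) (x : Eu n) (r s : ℝ) : ℝ := (r - s)⁻¹ * GG (Lgam n) (r - s) (F s) x

theorem kk_zero {x : Eu n} {r s : ℝ} (h : r ≤ s) : kk F x r s = 0 := by
  rw [kk, GG_nonpos integral_Lgam (by linarith), mul_zero]

theorem kk_bound (h : HF F B H) {x : Eu n} {r s : ℝ} (hrs : s < r) :
    |kk F x r s| ≤ (H * cA n) * (r - s) ^ (-(3/4):ℝ) := by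
  have h1 := GG_holder (Lgam n) integral_Lgam (r - s) (h.c s) (h.bd s) (h.hol s) h.H0 x
  have h0 : 0 < r - s := by linarith
  rw [kk, abs_mul, abs_of_pos (inv_pos.2 h0), ← inv_mul_sqrt2 h0]
  refine (mul_le_mul_of_nonneg_left h1 (inv_pos.2 h0).le).trans (le_of_eq ?_)
  unfold cA; ring

theorem kk_integrable (h : HF F B H) (x : Eu n) {t : ℝ} (ht : 0 ≤ t) :
    Integrable (Function.uncurry (kk F x)) ((volume.restrict (Ioc 0 t)).prod (volume.restrict (Ioc 0 t))) := by
  have h1 : Integrable (indicator (Ioc 0 t) fun _ => (1:ℝ)) := by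
    rw [integrable_indicator_iff measurableSet_Ioc]
    exact integrableOn_const (by simp)
  have h2 : Integrable (indicator (Ioc 0 t) fun θ : ℝ => (H * cA n) * θ ^ (-(3/4):ℝ)) := by
    rw [integrable_indicator_iff measurableSet_Ioc]
    exact ((intervalIntegrable_iff_integrableOn_Ioc_of_le ht).1 (rpow34_int 0 t)).const_mul _
  have h3 := Integrable.convolution_integrand (ContinuousLinearMap.mul ℝ ℝ) h1 h2
  rw [Measure.prod_restrict]
  refine (h3.restrict (s := Ioc 0 t ×ˢ Ioc 0 t)).mono' ?_ ?_
  · have hc : Continuous fun a : ℝ × ℝ => GG (Lgam n) (a.1 - a.2) (F a.2) x := by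
      refine GG_continuous (Lgam n) (X := ℝ × ℝ) (F := fun a => F a.2) ?_ (B := B) (fun _ => h.bd _) (by fun_prop) continuous_const
      exact h.cont.comp (f := fun a : (ℝ × ℝ) × Eu n => (a.1.2, a.2)) (by fun_prop)
    have hm : Measurable fun a : ℝ × ℝ => (a.1 - a.2)⁻¹ := by fun_prop
    exact hm.aestronglyMeasurable.mul hc.aestronglyMeasurable
  · refine (ae_restrict_iff' (measurableSet_Ioc.prod measurableSet_Ioc)).2 (Eventually.of_forall ?_)
    rintro ⟨r, s⟩ ⟨hr, hs⟩
    simp only [Function.uncurry, ContinuousLinearMap.mul_apply'] at hr hs ⊢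
    rw [indicator_of_mem hs, one_mul, Real.norm_eq_abs]
    rcases lt_or_ge s r with hsr | hsr
    · rw [indicator_of_mem (show r - s ∈ Ioc 0 t from ⟨by linarith, by linarith [hs.1, hr.2]⟩)]
      exact kk_bound h hsr
    · rw [kk_zero hsr, abs_zero, indicator_of_notMem (fun hh => by linarith [hh.1])]

theorem LZ_eq (h : HF F B H) {t T : ℝ} (ht : 0 < t) (htT : t ≤ T) (x : Eu n) : LZ F t x = ∫ s in 0..T, kk F x t s := by
  have e0 : ∫ s in 0..T, kk F x t s = ∫ s in 0..t, kk F x t s := by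
    rw [intervalIntegral.integral_of_le (ht.le.trans htT), intervalIntegral.integral_of_le ht.le]
    refine (setIntegral_eq_of_subset_of_forall_sdiff_eq_zero measurableSet_Ioc (Ioc_subset_Ioc_right htT) ?_)
    rintro s ⟨h1, h2⟩
    exact kk_zero (by by_contra hc; exact h2 ⟨h1.1, by linarith⟩)
  rw [e0]
  have e1 : ∫ s in 0..t, kk F x t s = ∫ σ in 0..t, σ⁻¹ * GG (Lgam n) σ (F (t - σ)) x := by
    have := intervalIntegral.integral_comp_sub_left (fun σ => σ⁻¹ * GG (Lgam n) σ (F (t - σ)) x) t (a := 0) (b := t)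
    simp only [sub_sub_cancel, sub_self, sub_zero] at this
    exact this
  have e2 := intervalIntegral.mul_integral_comp_mul_left (f := fun σ => σ⁻¹ * GG (Lgam n) σ (F (t - σ)) x) (c := t) (a := 0) (b := 1)
  rw [mul_zero, mul_one] at e2
  rw [e1, ← e2, ← intervalIntegral.integral_const_mul]
  unfold LZ JJ
  congr 1
  ext θ
  rw [smul_eq_mul, mul_inv, show t - t * θ = t * (1 - θ) by ring]
  field_simp

theorem ZZ_eq (h : HF F B H) {t : ℝ} (ht : 0 ≤ t) (x : Eu n) :
    ZZ F t x = ∫ r in 0..t, (F r x + LZ F r x) := by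
  have cF : Continuous fun r => F r x := h.cont.comp (Continuous.prodMk_left x)
  have cL : Continuous fun r => LZ F r x := (LZ_cont h).comp (Continuous.prodMk_left x)
  have e2 := intervalIntegral.mul_integral_comp_mul_left (f := fun σ => GG (gam n) σ (F (t - σ)) x) (c := t) (a := 0) (b := 1)
  rw [mul_zero, mul_one] at e2
  have e1 : ZZ F t x = ∫ s in 0..t, GG (gam n) (t - s) (F s) x := by
    have := intervalIntegral.integral_comp_sub_left (fun σ => GG (gam n) σ (F (t - σ)) x) t (a := 0) (b := t)
    simp only [sub_sub_cancel, sub_self, sub_zero] at this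
    rw [this, ← e2]
    unfold ZZ JJ
    congr 2
    ext θ
    rw [one_smul, show t - t * θ = t * (1 - θ) by ring]
  have hk := kk_integrable h x ht
  have e3 : ∀ s ∈ uIcc 0 t, GG (gam n) (t - s) (F s) x = F s x + ∫ r in 0..t, kk F x r s := by
    intro s hs
    rw [uIcc_of_le ht] at hs
    rw [GG_heat (h.c s) (h.bd s) (h.hol s) h.H0 x (by linarith [hs.2])]
    congr 1
    have a1 := intervalIntegral.integral_comp_sub_right (fun τ => τ⁻¹ * GG (Lgam n) τ (F s) x) s (a := s) (b := t)
    rw [sub_self] at a1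
    rw [← a1, intervalIntegral.integral_of_le hs.2, intervalIntegral.integral_of_le ht]
    refine (setIntegral_eq_of_subset_of_forall_sdiff_eq_zero measurableSet_Ioc (Ioc_subset_Ioc_left hs.1) ?_).symm
    rintro r ⟨h1, h2⟩
    exact kk_zero (by by_contra hc; exact h2 ⟨by linarith, h1.2⟩)
  rw [e1, intervalIntegral.integral_congr e3, intervalIntegral.integral_add (cF.intervalIntegrable _ _),
    intervalIntegral.integral_add (cF.intervalIntegrable _ _) (cL.intervalIntegrable _ _)]
  · congr 1
    have sw := integral_integral_swap hk
    simp_rw [intervalIntegral.integral_of_le ht]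
    rw [← sw]
    refine setIntegral_congr_fun measurableSet_Ioc fun r hr => ?_
    rw [LZ_eq h hr.1 hr.2, intervalIntegral.integral_of_le ht]
  · rw [intervalIntegrable_iff_integrableOn_Ioc_of_le ht]
    simp_rw [intervalIntegral.integral_of_le ht]
    exact hk.integral_prod_right

theorem ZZ_hasDerivAt (h : HF F B H) {t : ℝ} (ht : 0 < t) (x : Eu n) :
    HasDerivAt (fun s => ZZ F s x) (F t x + LZ F t x) t := by
  have cF : Continuous fun r => F r x := h.cont.comp (Continuous.prodMk_left x)
  have cL : Continuous fun r => LZ F r x := (LZ_cont h).comp (Continuous.prodMk_left x)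
  have h1 : HasDerivAt (fun s => ∫ r in 0..s, (F r x + LZ F r x)) (F t x + LZ F t x) t :=
    intervalIntegral.integral_hasDerivAt_right ((cF.add cL).intervalIntegrable _ _)
      ((cF.add cL).stronglyMeasurableAtFilter _ _) (cF.add cL).continuousAt
  refine h1.congr_of_eventuallyEq ?_
  filter_upwards [lt_mem_nhds ht] with s hs using ZZ_eq h hs.le x

theorem ZZ_bound (h : HF F B H) {t : ℝ} (ht : 0 ≤ t) (x : Eu n) : |ZZ F t x| ≤ t * (B * ∫ z, ‖gam n z‖) := by
  unfold ZZ JJ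
  rw [abs_mul, abs_of_nonneg ht]
  gcongr
  have := intervalIntegral.norm_integral_le_of_norm_le_const (a := 0) (b := 1) (C := B * ∫ z, ‖gam n z‖)
    (f := fun θ => (1:ℝ) • GG (gam n) (t * θ) (F (t * (1 - θ))) x) (fun θ _ => by
      rw [one_smul]; exact GG_bound _ _ (h.bd _) _)
  simpa using this

end

section
open Real Set MeasureTheory Metric Filter
open scoped Topology SchwartzMap

variable {n : ℕ} {F G : ℝ → Eu n → ℝ} {B H B' H' : ℝ}

theorem HF.sub (h : HF F B H) (h' : HF G B' H') : HF (fun t x => F t x - G t x) (B + B') (H + H') where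
  cont := h.cont.sub h'.cont
  bd t x := (abs_sub _ _).trans (add_le_add (h.bd t x) (h'.bd t x))
  hol t x y := by
    have e : F t x - G t x - (F t y - G t y) = (F t x - F t y) - (G t x - G t y) := by ring
    rw [e, add_mul]
    exact (abs_sub _ _).trans (add_le_add (h.hol t x y) (h'.hol t x y))
  H0 := add_nonneg h.H0 h'.H0

theorem HF.add (h : HF F B H) (h' : HF G B' H') : HF (fun t x => F t x + G t x) (B + B') (H + H') where
  cont := h.cont.add h'.cont
  bd t x := (abs_add_le _ _).trans (add_le_add (h.bd t x) (h'.bd t x))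
  hol t x y := by
    have e : F t x + G t x - (F t y + G t y) = (F t x - F t y) + (G t x - G t y) := by ring
    rw [e, add_mul]
    exact (abs_add_le _ _).trans (add_le_add (h.hol t x y) (h'.hol t x y))
  H0 := add_nonneg h.H0 h'.H0

theorem HF.mono (h : HF F B H) (hB : B ≤ B') (hH : H ≤ H') : HF F B' H' where
  cont := h.cont
  bd t x := (h.bd t x).trans hB
  hol t x y := (h.hol t x y).trans (by gcongr)
  H0 := h.H0.trans hH

/-- perturbation operator -/
noncomputable def Phi (c : ℝ → Eu n → ℝ) (T : ℝ) (F : ℝ → Eu n → ℝ) (t : ℝ) (x : Eu n) : ℝ :=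
  c t x * LZ F (min t T) x

theorem LZ_bound' (h : HF F B H) {T : ℝ} (t : ℝ) (x : Eu n) :
    |LZ F (min t T) x| ≤ 4 * cA n * H * √(√T) := by
  have hA := cA_nonneg (n := n)
  have hH := h.H0
  rcases le_total (min t T) 0 with h0 | h0
  · rw [LZ_nonpos h0, abs_zero]; positivity
  · refine (LZ_bound h h0 x).trans ?_
    gcongr
    exact min_le_right _ _

variable {c : ℝ → Eu n → ℝ} {T e l : ℝ}

theorem Phi_HF (h : HF F B H) (hc : HF c e l) (he : e * (8 * cA n + 4 * cA' n) ≤ 1/4)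
    (hl : l * (4 * cA n * √(√T)) ≤ 1/4) :
    HF (Phi c T F) (e * (4 * cA n * H * √(√T))) (H / 2) where
  cont := by
    refine hc.cont.mul ((LZ_cont h).comp (f := fun a : ℝ × Eu n => (min a.1 T, a.2)) (by fun_prop))
  bd t x := by
    unfold Phi
    rw [abs_mul]
    have := (abs_nonneg _).trans (hc.bd t x)
    gcongr
    · exact hc.bd t x
    · exact LZ_bound' h t x
  hol t x y := by
    unfold Phi
    have h1 := LZ_bound' h (T := T) t y
    have h2 := LZ_holder h (min t T) x y
    have h3 := hc.hol t x y
    have h4 := hc.bd t x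
    have h5 : 0 ≤ √‖x - y‖ := sqrt_nonneg _
    set a := LZ F (min t T) x
    set b := LZ F (min t T) y
    have e1 : c t x * a - c t y * b = c t x * (a - b) + (c t x - c t y) * b := by ring
    rw [e1]
    refine (abs_add_le _ _).trans ?_
    rw [abs_mul, abs_mul]
    have e0 : 0 ≤ e := (abs_nonneg _).trans h4
    have hH := h.H0
    have i1 : |c t x| * |a - b| ≤ e * ((8 * cA n + 4 * cA' n) * H * √‖x - y‖) := by gcongr
    have i2 : |c t x - c t y| * |b| ≤ (l * √‖x - y‖) * (4 * cA n * H * √(√T)) := by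
      have := hc.H0
      gcongr
    have i3 := mul_le_mul_of_nonneg_right he (mul_nonneg hH h5)
    have i4 := mul_le_mul_of_nonneg_right hl (mul_nonneg hH h5)
    nlinarith
  H0 := by linarith [h.H0]

theorem Phi_sub (h : HF F B H) (h' : HF G B' H') (t : ℝ) (x : Eu n) :
    Phi c T (fun t x => F t x - G t x) t x = Phi c T F t x - Phi c T G t x := by
  unfold Phi
  rw [LZ_sub h h', mul_sub]

/-- iterates -/
noncomputable def Itr (g c : ℝ → Eu n → ℝ) (T : ℝ) : ℕ → ℝ → Eu n → ℝ
  | 0 => g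
  | N + 1 => fun t x => g t x + Phi c T (Itr g c T N) t x

theorem fixpt {g : ℝ → Eu n → ℝ} (hg : HF g B H) (hc : HF c e l)
    (he : e * (8 * cA n + 4 * cA' n) ≤ 1/4) (hl : l * (4 * cA n * √(√T)) ≤ 1/4) :
    ∃ F : ℝ → Eu n → ℝ, ∃ B' H', HF F B' H' ∧ ∀ t x, F t x = g t x + c t x * LZ F (min t T) x := by
  have hH := hg.H0
  have hA := cA_nonneg (n := n)
  have e0 : 0 ≤ e := (abs_nonneg _).trans (hc.bd 0 0)
  set k0 := e * (4 * cA n * √(√T)) with hk0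
  have k0n : 0 ≤ k0 := by positivity
  have P : ∀ {F : ℝ → Eu n → ℝ} {B H}, HF F B H → HF (Phi c T F) (k0 * H) (H / 2) := fun h =>
    (Phi_HF h hc he hl).mono (le_of_eq (by rw [hk0]; ring)) le_rfl
  have A : ∀ N, HF (Itr g c T N) (B + k0 * (2 * H)) (2 * H) := by
    intro N
    induction N with
    | zero => exact hg.mono (by linarith [mul_nonneg k0n hH]) (by linarith)
    | succ N ih => exact (hg.add (P ih)).mono le_rfl (by linarith)
  have D : ∀ N k, HF (fun t x => Itr g c T (N + k) t x - Itr g c T N t x) (4 * k0 * H / 2 ^ N) (2 * H / 2 ^ N) := by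
    intro N
    induction N with
    | zero =>
      intro k
      cases k with
      | zero =>
        have : (fun t x => Itr g c T (0 + 0) t x - Itr g c T 0 t x) = fun _ _ => 0 := by simp
        rw [this]
        refine ⟨continuous_const, fun t x => ?_, fun t x y => ?_, by positivity⟩
        · simp; positivity
        · simp; positivity
      | succ k =>
        have : (fun t x => Itr g c T (0 + (k+1)) t x - Itr g c T 0 t x) = Phi c T (Itr g c T k) := by
          ext t x; simp [Itr]
        rw [this]
        exact (P (A k)).mono (by simp; nlinarith [mul_nonneg k0n hH]) (by simp; linarith)
    | succ N ih =>
      intro k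
      have : (fun t x => Itr g c T (N + 1 + k) t x - Itr g c T (N+1) t x)
          = Phi c T (fun t x => Itr g c T (N + k) t x - Itr g c T N t x) := by
        ext t x
        rw [Phi_sub (A _) (A _), show N + 1 + k = N + k + 1 by ring]
        simp [Itr]
      rw [this]
      refine (P (ih k)).mono (le_of_eq ?_) (le_of_eq ?_)
      · rw [pow_succ]; field_simp; ring
      · rw [pow_succ]; field_simp
  have lim0 : ∀ K : ℝ, Tendsto (fun N : ℕ => K / 2 ^ N) atTop (𝓝 0) := fun K => by
    simpa [div_eq_mul_inv] using (tendsto_pow_atTop_nhds_zero_of_lt_one (r := (1/2:ℝ)) (by norm_num) (by norm_num)).const_mul K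
  have hcau : ∀ t x, CauchySeq fun N => Itr g c T N t x := by
    intro t x
    refine cauchySeq_of_le_tendsto_0' (fun N => 4 * k0 * H / 2 ^ N) ?_ (lim0 _)
    intro N M hNM
    obtain ⟨k, rfl⟩ := Nat.exists_eq_add_of_le hNM
    rw [dist_comm, Real.dist_eq]
    exact (D N k).bd t x
  choose F hF using fun t x => cauchySeq_tendsto_of_complete (hcau t x)
  have hFN : ∀ N t, Tendsto (fun k => Itr g c T (N + k) t) atTop (𝓝 (F t)) := by
    intro N t
    rw [tendsto_pi_nhds]
    intro x
    have := (hF t x).comp (tendsto_add_atTop_nat N)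
    simpa [Function.comp_def, add_comm] using this
  have bdF : ∀ N t x, |F t x - Itr g c T N t x| ≤ 4 * k0 * H / 2 ^ N := by
    intro N t x
    refine le_of_tendsto (((tendsto_pi_nhds.1 (hFN N t) x).sub_const _).abs) (Eventually.of_forall fun k => (D N k).bd t x)
  have contF : Continuous fun a : ℝ × Eu n => F a.1 a.2 := by
    refine TendstoUniformly.continuous (F := fun (N : ℕ) (a : ℝ × Eu n) => Itr g c T N a.1 a.2) (p := atTop) ?_ (Frequently.of_forall fun N => (A N).cont)
    rw [Metric.tendstoUniformly_iff]
    intro ε hε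
    filter_upwards [(lim0 (4 * k0 * H)).eventually_lt_const hε] with N hN a
    rw [Real.dist_eq]
    exact (bdF N a.1 a.2).trans_lt hN
  have DF : ∀ N, HF (fun t x => F t x - Itr g c T N t x) (4 * k0 * H / 2 ^ N) (2 * H / 2 ^ N) := by
    intro N
    refine ⟨contF.sub (A N).cont, bdF N, fun t x y => ?_, by positivity⟩
    have l1 := (tendsto_pi_nhds.1 (hFN N t) x).sub_const (Itr g c T N t x)
    have l2 := (tendsto_pi_nhds.1 (hFN N t) y).sub_const (Itr g c T N t y)
    exact le_of_tendsto ((l1.sub l2).abs) (Eventually.of_forall fun k => (D N k).hol t x y)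
  have HFF : HF F (4 * k0 * H / 2 ^ 0 + B) (2 * H / 2 ^ 0 + H) := by
    have := (DF 0).add hg
    simpa [Itr] using this
  refine ⟨F, _, _, HFF, fun t x => ?_⟩
  have l1 : Tendsto (fun N => Itr g c T (N + 1) t x) atTop (𝓝 (F t x)) := (hF t x).comp (tendsto_add_atTop_nat 1)
  have l2 : Tendsto (fun N => LZ (Itr g c T N) (min t T) x) atTop (𝓝 (LZ F (min t T) x)) := by
    rw [tendsto_iff_dist_tendsto_zero]
    refine squeeze_zero (fun _ => dist_nonneg) (fun N => ?_) (lim0 (4 * cA n * (2 * H) * √(√T)))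
    rw [dist_comm, Real.dist_eq, ← LZ_sub HFF (A N)]
    exact (LZ_bound' (DF N) t x).trans (le_of_eq (by ring))
  exact tendsto_nhds_unique l1 ((l2.const_mul (c t x)).const_add (g t x))

end

section
open Real Set MeasureTheory Metric Filter
open scoped Topology SchwartzMap

variable {n : ℕ} {p M : ℝ} {u₀ : Eu n → ℝ}

theorem mvt_slope {Q Qt : Eu n → ℝ → ℝ} {x0 : Eu n} {t0 : ℝ}
    (hQt : ∀ᶠ z in 𝓝 (x0, t0), HasDerivAt (Q z.1) (Qt z.1 z.2) z.2)
    (hcont : ContinuousAt (fun z : Eu n × ℝ => Qt z.1 z.2) (x0, t0)) {ε : ℝ} (hε : 0 < ε)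
    {P : Eu n × ℝ → Prop} (hP : ∀ᶠ z in 𝓝 (x0, t0), P z) :
    ∃ r > 0, ∀ x ∈ ball x0 r, ∀ t ∈ Ioc (t0 - r) t0,
      P (x, t) ∧ (Qt x0 t0 - ε) * (t0 - t) ≤ Q x t0 - Q x t ∧ Q x t0 - Q x t ≤ (Qt x0 t0 + ε) * (t0 - t) := by
  have h1 : ∀ᶠ z in 𝓝 (x0, t0), Qt x0 t0 - ε < Qt z.1 z.2 ∧ Qt z.1 z.2 < Qt x0 t0 + ε :=
    (hcont.eventually_const_lt (by simp; linarith)).and (hcont.eventually_lt_const (by simp; linarith))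
  obtain ⟨r, hr, h⟩ := Metric.eventually_nhds_iff_ball.1 (hQt.and (h1.and hP))
  refine ⟨r, hr, fun x hx t ht => ?_⟩
  have mem : ∀ s ∈ Icc t t0, (x, s) ∈ ball (x0, t0) r := by
    intro s hs
    rw [← ball_prod_same]
    refine ⟨hx, ?_⟩
    rw [Real.ball_eq_Ioo]
    exact ⟨by linarith [ht.1, hs.1], by linarith [hs.2]⟩
  refine ⟨(h _ (mem t ⟨le_rfl, ht.2⟩)).2.2, ?_⟩
  rcases ht.2.eq_or_lt with rfl | hlt
  · simp
  · obtain ⟨s, hs, he⟩ := exists_hasDerivAt_eq_slope (Q x) (Qt x) hlt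
      (fun s hs => (h _ (mem s hs)).1.continuousAt.continuousWithinAt) (fun s hs => (h _ (mem s (Ioo_subset_Icc_self hs))).1)
    have h2 := (h _ (mem s (Ioo_subset_Icc_self hs))).2.1
    have h3 : 0 < t0 - t := by linarith
    rw [eq_div_iff h3.ne'] at he
    simp only at h2
    rw [← he]
    constructor <;> nlinarith [h2.1, h2.2]

theorem Dat.superTouch' (d : Dat p u₀ M) {Q Qt : Eu n → ℝ → ℝ} {x0 : Eu n} {t0 : ℝ} (ht0 : 0 < t0)
    (hC : ContDiffAt ℝ 2 (fun y => Q y t0) x0)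
    (hQt : ∀ᶠ z in 𝓝 (x0, t0), HasDerivAt (Q z.1) (Qt z.1 z.2) z.2)
    (hcont : ContinuousAt (fun z : Eu n × ℝ => Qt z.1 z.2) (x0, t0))
    (heq : Q x0 t0 = vv p u₀ x0 t0)
    (hle : ∀ᶠ z in 𝓝 (x0, t0), z.2 ≤ t0 → Q z.1 z.2 ≤ vv p u₀ z.1 z.2) :
    vv p u₀ x0 t0 ^ p * lap (fun y => Q y t0) x0 ≤ Qt x0 t0 := by
  refine le_of_forall_pos_le_add fun ε hε => ?_
  obtain ⟨r, hr, h⟩ := mvt_slope hQt hcont hε hle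
  have := d.superTouch (b := Qt x0 t0 + ε) (ψ := fun y => Q y t0 + (-(Qt x0 t0 + ε) * t0)) ht0 hr (hC.add contDiffAt_const)
    (by simp only [heq]; ring) (fun x hx t ht _ => by
      obtain ⟨a, b, c⟩ := h x hx t ht
      have := a ht.2
      simp only at this
      linarith)
  rwa [lap_add_const hC] at this

theorem Dat.subTouch' (d : Dat p u₀ M) {Q Qt : Eu n → ℝ → ℝ} {x0 : Eu n} {t0 : ℝ} (ht0 : 0 < t0)
    (hC : ContDiffAt ℝ 2 (fun y => Q y t0) x0)
    (hQt : ∀ᶠ z in 𝓝 (x0, t0), HasDerivAt (Q z.1) (Qt z.1 z.2) z.2)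
    (hcont : ContinuousAt (fun z : Eu n × ℝ => Qt z.1 z.2) (x0, t0))
    (heq : Q x0 t0 = vv p u₀ x0 t0)
    (hle : ∀ᶠ z in 𝓝 (x0, t0), z.2 ≤ t0 → vv p u₀ z.1 z.2 ≤ Q z.1 z.2) :
    Qt x0 t0 ≤ vv p u₀ x0 t0 ^ p * lap (fun y => Q y t0) x0 := by
  refine le_of_forall_pos_le_add fun ε hε => ?_
  obtain ⟨r, hr, h⟩ := mvt_slope hQt hcont hε hle
  have := d.subTouch (b := Qt x0 t0 - ε) (ψ := fun y => Q y t0 + (-(Qt x0 t0 - ε) * t0)) ht0 hr (hC.add contDiffAt_const)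
    (by simp only [heq]; ring) (fun x hx t ht _ => by
      obtain ⟨a, b, c⟩ := h x hx t ht
      have := a ht.2
      simp only at this
      linarith)
  rw [lap_add_const hC] at this
  linarith

/-- maximum principle bookkeeping -/
theorem max_arg {Y : Eu n → ℝ → ℝ} {t1 t2 C K : ℝ}
    (hc : ContinuousOn (fun z : Eu n × ℝ => Y z.1 z.2) (univ ×ˢ Icc t1 t2))
    (hb : ∀ x, ∀ t ∈ Icc t1 t2, Y x t ≤ C) (h1 : ∀ x, Y x t1 ≤ 0) (hK : 0 ≤ K)
    (hno : ∀ ε > 0, ∀ xh, ∀ th ∈ Ioc t1 t2,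
      (∀ x, ∀ t ∈ Icc t1 th, Y x t - ε * (‖x‖ ^ 2 + K * (t - t1)) ≤ Y xh th - ε * (‖xh‖ ^ 2 + K * (th - t1))) → False) :
    ∀ x, ∀ t ∈ Icc t1 t2, Y x t ≤ 0 := by
  intro x' t' ht'
  by_contra hcon
  push Not at hcon
  set S := ‖x'‖ ^ 2 + K * (t' - t1) + 1 with hS
  have hS0 : 0 < S := by
    have := mul_nonneg hK (sub_nonneg.2 ht'.1)
    positivity
  set ε := Y x' t' / (2 * S) with hε
  have hε0 : 0 < ε := by positivity
  have hpos : 0 < Y x' t' - ε * (‖x'‖ ^ 2 + K * (t' - t1)) := by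
    have : ε * S = Y x' t' / 2 := by rw [hε]; field_simp
    have e2 : ε * (‖x'‖ ^ 2 + K * (t' - t1)) = ε * S - ε := by rw [hS]; ring
    linarith
  have hC0 : 0 < C := hcon.trans_le (hb _ _ ht')
  set R := √(C / ε) with hR
  have hR2 : R ^ 2 = C / ε := Real.sq_sqrt (by positivity)
  set W : Eu n × ℝ → ℝ := fun z => Y z.1 z.2 - ε * (‖z.1‖ ^ 2 + K * (z.2 - t1)) with hW
  have hout : ∀ x, ∀ t ∈ Icc t1 t2, R < ‖x‖ → W (x, t) < 0 := by
    intro x t ht hx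
    have h2 : C / ε < ‖x‖ ^ 2 := by rw [← hR2]; exact pow_lt_pow_left₀ hx (sqrt_nonneg _) (by norm_num)
    rw [div_lt_iff₀ hε0] at h2
    have := hb x t ht
    have h3 := mul_nonneg hε0.le (mul_nonneg hK (sub_nonneg.2 ht.1))
    simp only [hW]
    nlinarith
  have hin : ‖x'‖ ≤ R := by
    by_contra hx; push Not at hx
    have := hout x' t' ht' hx
    simp only [hW] at this
    linarith
  obtain ⟨⟨xh, th⟩, hmem, hmax⟩ := ((isCompact_closedBall (0 : Eu n) R).prod (isCompact_Icc (a := t1) (b := t2))).exists_isMaxOn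
    (f := W) ⟨(x', t'), by simpa using hin, ht'⟩ (by
      refine ContinuousOn.sub (hc.mono (prod_mono (subset_univ _) le_rfl)) (Continuous.continuousOn (by fun_prop)))
  have hmx : W (x', t') ≤ W (xh, th) := hmax ⟨by simpa using hin, ht'⟩
  have hWp : 0 < W (xh, th) := hpos.trans_le hmx
  have hth : t1 < th := by
    rcases hmem.2.1.eq_or_lt with h | h
    · exfalso
      have h' : t1 = th := h
      simp only [hW] at hWp
      rw [← h', sub_self, mul_zero, add_zero] at hWp
      have := h1 xh
      nlinarith [sq_nonneg ‖xh‖]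
    · exact h
  refine hno ε hε0 xh th ⟨hth, hmem.2.2⟩ fun x t ht => ?_
  have htt : t ∈ Icc t1 t2 := ⟨ht.1, ht.2.trans hmem.2.2⟩
  rcases le_or_gt ‖x‖ R with hx | hx
  · exact hmax (show (x, t) ∈ closedBall (0 : Eu n) R ×ˢ Icc t1 t2 from ⟨by simpa using hx, htt⟩)
  · exact ((hout x t htt hx).trans hWp).le

theorem linsol {c g : ℝ → Eu n → ℝ} {B H e l T : ℝ} (hg : HF g B H) (hc : HF c e l)
    (he : e * (8 * cA n + 4 * cA' n) ≤ 1/4) (hl : l * (4 * cA n * √(√T)) ≤ 1/4) :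
    ∃ Z Zt : ℝ → Eu n → ℝ, Continuous (fun a : ℝ × Eu n => Z a.1 a.2) ∧
      Continuous (fun a : ℝ × Eu n => Zt a.1 a.2) ∧ (∀ x, Z 0 x = 0) ∧
      (∃ K, ∀ t ∈ Icc 0 T, ∀ x, |Z t x| ≤ K) ∧ (∀ t, 0 < t → ContDiff ℝ 2 (Z t)) ∧
      (∀ t, 0 < t → ∀ x, HasDerivAt (fun s => Z s x) (Zt t x) t) ∧
      (∀ t, 0 < t → t ≤ T → ∀ x, Zt t x = (1 + c t x) * lap (Z t) x + g t x) := by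
  obtain ⟨F, B', H', hF, hfix⟩ := fixpt hg hc he hl
  refine ⟨ZZ F, fun t x => F t x + LZ F t x, ZZ_cont hF, hF.cont.add (LZ_cont hF), fun x => by simp [ZZ],
    ⟨T * (B' * ∫ z, ‖gam n z‖), fun t ht x => (ZZ_bound hF ht.1 x).trans ?_⟩, fun t ht => ZZ_contDiff hF ht,
    fun t ht x => ZZ_hasDerivAt hF ht x, fun t ht htT x => ?_⟩
  · have h1 : 0 ≤ B' := (abs_nonneg _).trans (hF.bd 0 0)
    have h2 : 0 ≤ ∫ z, ‖gam n z‖ := integral_nonneg fun z => norm_nonneg _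
    have := ht.2
    gcongr
  · rw [lap_ZZ hF ht]
    simp only
    rw [hfix t x, min_eq_left htT]
    ring

end

section
open Real Set MeasureTheory Metric Filter
open scoped Topology SchwartzMap

variable {n : ℕ} {p M : ℝ} {u₀ : Eu n → ℝ}

theorem Dat.sgnTouch (d : Dat p u₀ M) {Q Qt : Eu n → ℝ → ℝ} {x0 : Eu n} {t0 σ : ℝ} (hσ : σ = 1 ∨ σ = -1) (ht0 : 0 < t0)
    (hC : ContDiffAt ℝ 2 (fun y => Q y t0) x0)
    (hQt : ∀ᶠ z in 𝓝 (x0, t0), HasDerivAt (Q z.1) (Qt z.1 z.2) z.2)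
    (hcont : ContinuousAt (fun z : Eu n × ℝ => Qt z.1 z.2) (x0, t0))
    (heq : Q x0 t0 = vv p u₀ x0 t0)
    (hle : ∀ᶠ z in 𝓝 (x0, t0), z.2 ≤ t0 → σ * vv p u₀ z.1 z.2 ≤ σ * Q z.1 z.2) :
    σ * Qt x0 t0 ≤ σ * (vv p u₀ x0 t0 ^ p * lap (fun y => Q y t0) x0) := by
  rcases hσ with rfl | rfl
  · simp only [one_mul] at hle ⊢
    exact d.subTouch' ht0 hC hQt hcont heq hle
  · have := d.superTouch' ht0 hC hQt hcont heq (hle.mono fun z h hz => by linarith [h hz])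
    linarith

theorem deriv_nonneg_of_left_max {f : ℝ → ℝ} {f' t1 t : ℝ} (h1 : t1 < t) (hf : HasDerivAt f f' t)
    (hle : ∀ s ∈ Icc t1 t, f s ≤ f t) : 0 ≤ f' := by
  have h := hf.hasDerivWithinAt (s := Iio t)
  rw [hasDerivWithinAt_iff_tendsto_slope' (by simp)] at h
  refine ge_of_tendsto h ?_
  filter_upwards [Ioo_mem_nhdsLT h1] with s hs
  rw [slope_def_field]
  exact div_nonneg_of_nonpos (by linarith [hle s ⟨hs.1.le, hs.2.le⟩]) (by linarith [hs.2])

/-- data for the linear comparison -/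
structure LinDat (p : ℝ) (u₀ : Eu n → ℝ) (η : Eu n → ℝ) (Z Zt A : Eu n → ℝ → ℝ) (t1 t2 A0 B : ℝ) : Prop where
  t1pos : 0 < t1
  t12 : t1 < t2
  ηc : ContDiff ℝ 2 η
  η0 : ∀ x, 0 ≤ η x
  η1 : ∀ x, η x ≤ 1
  ηz : ∀ x, η x = 0 → fderiv ℝ η x = 0 ∧ lap η x = 0
  Zc : Continuous fun z : Eu n × ℝ => Z z.1 z.2
  Ztc : Continuous fun z : Eu n × ℝ => Zt z.1 z.2
  Z0 : ∀ x, Z x t1 = 0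
  Zb : ∀ t ∈ Icc t1 t2, ∀ x, |Z x t| ≤ B
  Z2 : ∀ t, t1 < t → ContDiff ℝ 2 (fun y => Z y t)
  Zd : ∀ t, t1 < t → ∀ x, HasDerivAt (Z x) (Zt x t) t
  An : ∀ t ∈ Icc t1 t2, ∀ x, 0 ≤ A x t
  A1 : ∀ t ∈ Icc t1 t2, ∀ x, A x t ≤ A0
  Av : ∀ t ∈ Icc t1 t2, ∀ x, η x ≠ 0 → A x t = vv p u₀ x t ^ p
  eqn : ∀ t ∈ Ioc t1 t2, ∀ x, Zt x t = A x t * lap (fun y => Z y t) x +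
    (η x * vv p u₀ x t - (t - t1) * vv p u₀ x t ^ p * (vv p u₀ x t * lap η x +
      2 * ∑ i : Fin n, fderiv ℝ η x (EuclideanSpace.single i 1) * Dv p u₀ x t (EuclideanSpace.single i 1)))

variable {η : Eu n → ℝ} {Z Zt A : Eu n → ℝ → ℝ} {t1 t2 A0 B : ℝ}

theorem lap_quot {P q : Eu n → ℝ} {x : Eu n} {θ : ℝ} (hP : ContDiffAt ℝ 2 P x) (hη : ContDiffAt ℝ 2 η x) (h0 : η x ≠ 0)
    (hθ : θ ≠ 0) (hq : q = fun y => P y / (θ * η y)) :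
    ContDiffAt ℝ 2 q x ∧ lap P x = θ * (η x * lap q x + q x * lap η x +
      2 * ∑ i : Fin n, fderiv ℝ η x (EuclideanSpace.single i 1) * fderiv ℝ q x (EuclideanSpace.single i 1)) := by
  have hqc : ContDiffAt ℝ 2 q x := by
    rw [hq]; exact hP.div (contDiffAt_const.mul hη) (mul_ne_zero hθ h0)
  refine ⟨hqc, ?_⟩
  rw [← lap_mul hη hqc, ← lap_const_mul θ (hη.mul hqc)]
  refine lap_congr ?_
  filter_upwards [hη.continuousAt.eventually_ne h0] with y hy
  rw [hq]
  simp only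
  field_simp

theorem lap_ZS {Z : Eu n → ℝ} {x : Eu n} (hZ : ContDiffAt ℝ 2 Z x) (a b : ℝ) :
    ContDiffAt ℝ 2 (fun y => Z y + (a * ‖y‖ ^ 2 + b)) x ∧
    lap (fun y => Z y + (a * ‖y‖ ^ 2 + b)) x = lap Z x + a * (2 * n) := by
  have h1 : ContDiffAt ℝ 2 (fun y : Eu n => ‖y‖ ^ 2) x := (contDiff_id.norm_sq ℝ).contDiffAt
  have h2 : ContDiffAt ℝ 2 (fun y : Eu n => a * ‖y‖ ^ 2) x := contDiffAt_const.mul h1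
  have h3 : lap (fun y : Eu n => ‖y‖ ^ 2) x = 2 * n := by simpa using lap_normsq (0 : Eu n) x
  refine ⟨hZ.add (h2.add contDiffAt_const), ?_⟩
  rw [lap_add hZ (h2.add contDiffAt_const), lap_add_const h2, lap_const_mul a h1, h3]

theorem LinDat.noTouch (d : Dat p u₀ M) (l : LinDat p u₀ η Z Zt A t1 t2 A0 B) {σ : ℝ} (hσ : σ = 1 ∨ σ = -1)
    {ε : ℝ} (hε : 0 < ε) (xh : Eu n) {th : ℝ} (hth : th ∈ Ioc t1 t2) {K : ℝ} (hK : 2 * n * A0 < K)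
    (hmax : ∀ x, ∀ t ∈ Icc t1 th, σ * ((t - t1) * (η x * vv p u₀ x t) - Z x t) - ε * (‖x‖ ^ 2 + K * (t - t1)) ≤
      σ * ((th - t1) * (η xh * vv p u₀ xh th) - Z xh th) - ε * (‖xh‖ ^ 2 + K * (th - t1))) : False := by
  have hth' : th ∈ Icc t1 t2 := Ioc_subset_Icc_self hth
  have hθ : 0 < th - t1 := by linarith [hth.1]
  have hth0 : 0 < th := l.t1pos.trans hth.1
  have hσσ : σ * σ = 1 := by rcases hσ with rfl | rfl <;> norm_num
  have hZ2 := (l.Z2 th hth.1).contDiffAt (x := xh)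
  have heqn := l.eqn th hth xh
  have hA0 := l.An th hth' xh
  have hA1 := l.A1 th hth' xh
  have hn0 : (0:ℝ) ≤ n := Nat.cast_nonneg n
  have key : 2 * n * A xh th * ε < ε * K := by
    have : 2 * n * A xh th ≤ 2 * n * A0 := by gcongr
    nlinarith
  by_cases h0 : η xh = 0
  · -- outside the support
    obtain ⟨z1, z2⟩ := l.ηz xh h0
    rw [h0, z1, z2] at heqn
    simp at heqn
    -- time
    have tder : HasDerivAt (fun t => -σ * Z xh t + -(ε * K) * (t - t1)) (-σ * Zt xh th + -(ε * K) * 1) th :=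
      ((l.Zd th hth.1 xh).const_mul _).add (((hasDerivAt_id th).sub_const t1).const_mul _)
    have t0 := deriv_nonneg_of_left_max hth.1 tder (fun s hs => by
      have := hmax xh s hs
      rw [h0] at this
      simp only [zero_mul, mul_zero, zero_sub] at this
      linarith)
    -- space
    have hM := d.hM
    have c1 : ContDiffAt ℝ 2 (fun y => -σ * Z y th) xh := contDiffAt_const.mul hZ2
    have c2 : ContDiffAt ℝ 2 (fun y => (-((th - t1) * M)) * η y) xh := contDiffAt_const.mul l.ηc.contDiffAt
    obtain ⟨c3, l3⟩ := lap_ZS (c1.add c2) (-ε) 0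
    have lm : lap (fun y => (-σ * Z y th + (-((th - t1) * M)) * η y) + ((-ε) * ‖y‖ ^ 2 + 0)) xh ≤ 0 := by
      refine lap_nonpos_of_localMax c3 (Eventually.of_forall fun y => ?_)
      have h1 := hmax y th ⟨hth.1.le, le_rfl⟩
      have hv0 := d.nonneg (x := y) hth0
      have hvM := d.leM (x := y) hth0
      have hη := l.η0 y
      have h2 : σ * ((th - t1) * (η y * vv p u₀ y th)) ≥ -((th - t1) * M * η y) := by
        have h3 : η y * vv p u₀ y th ≤ η y * M := by gcongr
        have h4 : 0 ≤ (th - t1) * (η y * vv p u₀ y th) := by positivity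
        have h5 : (th - t1) * (η y * vv p u₀ y th) ≤ (th - t1) * (η y * M) := by gcongr
        rcases hσ with rfl | rfl <;> nlinarith
      beta_reduce
      rw [h0] at h1 ⊢
      simp only [zero_mul, mul_zero, zero_sub, add_zero] at h1 ⊢
      linarith
    rw [l3, lap_add c1 c2, lap_const_mul _ hZ2, lap_const_mul _ l.ηc.contDiffAt, z2] at lm
    rw [heqn] at t0
    have := mul_le_mul_of_nonneg_left lm hA0
    nlinarith
  · -- inside the support
    have hηp : 0 < η xh := lt_of_le_of_ne (l.η0 xh) (Ne.symm h0)
    set m := σ * ((th - t1) * (η xh * vv p u₀ xh th) - Z xh th) - ε * (‖xh‖ ^ 2 + K * (th - t1)) with hm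
    set P : Eu n → ℝ → ℝ := fun x t => Z x t + ((σ * ε) * ‖x‖ ^ 2 + σ * (ε * (K * (t - t1)) + m)) with hP
    set Pt : Eu n → ℝ → ℝ := fun x t => Zt x t + σ * ε * K with hPt
    set Q : Eu n → ℝ → ℝ := fun x t => P x t / ((t - t1) * η x) with hQ
    set Qt : Eu n → ℝ → ℝ := fun x t => (Pt x t * ((t - t1) * η x) - P x t * η x) / ((t - t1) * η x) ^ 2 with hQt
    have PV : P xh th = (th - t1) * (η xh * vv p u₀ xh th) := by
      simp only [hP, hm]
      linear_combination (((th - t1) * (η xh * vv p u₀ xh th) - Z xh th)) * hσσ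
    have QV : Q xh th = vv p u₀ xh th := by
      simp only [hQ]; rw [PV]; field_simp
    obtain ⟨cP, lP⟩ := lap_ZS hZ2 (σ * ε) (σ * (ε * (K * (th - t1)) + m))
    have near : ∀ᶠ z : Eu n × ℝ in 𝓝 (xh, th), 0 < η z.1 ∧ t1 < z.2 := by
      have e1 : ContinuousAt (fun z : Eu n × ℝ => η z.1) (xh, th) := (l.ηc.continuous.comp continuous_fst).continuousAt
      exact (e1.eventually_const_lt hηp).and (continuousAt_snd.eventually_const_lt hth.1)
    have dQ : ∀ᶠ z in 𝓝 (xh, th), HasDerivAt (Q z.1) (Qt z.1 z.2) z.2 := by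
      filter_upwards [near] with z hz
      have hd : HasDerivAt (fun t => (t - t1) * η z.1) (1 * η z.1) z.2 := ((hasDerivAt_id z.2).sub_const t1).mul_const _
      have hp' : HasDerivAt (P z.1) (Pt z.1 z.2) z.2 := by
        have h3 : HasDerivAt (fun t => σ * (ε * (K * (t - t1)) + m)) (σ * (ε * (K * 1))) z.2 :=
          (((((hasDerivAt_id z.2).sub_const t1).const_mul K).const_mul ε).add_const m).const_mul σ
        have := (l.Zd z.2 hz.2 z.1).add (h3.const_add ((σ * ε) * ‖z.1‖ ^ 2))
        exact this.congr_deriv (by rw [hPt]; ring)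
      have := hp'.div hd (mul_pos (sub_pos.2 hz.2) hz.1).ne'
      rw [one_mul] at this
      exact this
    have cQt : ContinuousAt (fun z : Eu n × ℝ => Qt z.1 z.2) (xh, th) := by
      have a1 := l.Zc
      have a2 := l.Ztc
      have a3 : Continuous fun z : Eu n × ℝ => η z.1 := l.ηc.continuous.comp continuous_fst
      have a4 : Continuous fun z : Eu n × ℝ => P z.1 z.2 := by simp only [hP]; fun_prop
      have a5 : Continuous fun z : Eu n × ℝ => Pt z.1 z.2 := by simp only [hPt]; fun_prop
      refine ContinuousAt.div ((a5.mul ((continuous_snd.sub continuous_const).mul a3)).sub (a4.mul a3)).continuousAt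
        (((continuous_snd.sub continuous_const).mul a3).pow 2).continuousAt ?_
      simp only; positivity
    obtain ⟨cq, lq⟩ := lap_quot (P := fun y => P y th) (q := fun y => Q y th) cP l.ηc.contDiffAt h0 hθ.ne' rfl
    have hle : ∀ᶠ z in 𝓝 (xh, th), z.2 ≤ th → σ * vv p u₀ z.1 z.2 ≤ σ * Q z.1 z.2 := by
      filter_upwards [near] with z hz hzt
      have h1 := hmax z.1 z.2 ⟨hz.2.le, hzt⟩
      have h2 : 0 < (z.2 - t1) * η z.1 := mul_pos (sub_pos.2 hz.2) hz.1
      simp only [hQ]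
      rw [← mul_div_assoc, le_div_iff₀ h2]
      have h3 : σ * P z.1 z.2 = σ * Z z.1 z.2 + (ε * (‖z.1‖ ^ 2 + K * (z.2 - t1)) + m) := by
        simp only [hP]
        linear_combination (ε * (‖z.1‖ ^ 2 + K * (z.2 - t1)) + m) * hσσ
      rw [h3]
      linarith
    have T := d.sgnTouch hσ hth0 cq dQ cQt QV hle
    have fq : fderiv ℝ (fun y => Q y th) xh = Dv p u₀ xh th := by
      have hd1 : HasFDerivAt (fun y => Q y th) (fderiv ℝ (fun y => Q y th) xh) xh := (cq.differentiableAt (by norm_num)).hasFDerivAt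
      have hd2 := (d.hasFDerivAt xh hth0)
      have hloc : IsLocalMax (fun y => σ * (vv p u₀ y th - Q y th)) xh := by
        have hc : ContinuousAt (fun y : Eu n => (y, th)) xh := by fun_prop
        filter_upwards [hc.eventually hle] with y hy
        rw [QV, sub_self, mul_zero]
        have := hy le_rfl
        linarith
      have := hloc.hasFDerivAt_eq_zero ((hd2.sub hd1).const_mul σ)
      have hσ0 : σ ≠ 0 := by rcases hσ with rfl | rfl <;> norm_num
      rw [smul_eq_zero] at this
      rcases this with h | h
      · exact absurd h hσ0
      · exact (sub_eq_zero.1 h).symm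
    rw [fq] at lq
    rw [lP] at lq
    have e1 : (th - t1) * η xh * Qt xh th = Pt xh th - η xh * vv p u₀ xh th := by
      simp only [hQt]
      rw [PV]
      field_simp
    rw [l.Av th hth' xh h0] at heqn key
    have T2 := mul_le_mul_of_nonneg_left T (mul_pos hθ hηp).le
    set S := ∑ i : Fin n, fderiv ℝ η xh (EuclideanSpace.single i 1) * Dv p u₀ xh th (EuclideanSpace.single i 1)
    set v0 := vv p u₀ xh th
    simp only [QV] at lq
    simp only [hPt] at e1
    rw [heqn] at e1
    set w := v0 ^ p
    set lZ := lap (fun y => Z y th) xh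
    set lQ := lap (fun y => Q y th) xh
    have e2 : (th - t1) * η xh * (σ * Qt xh th) = σ * (w * lZ - (th - t1) * w * (v0 * lap η xh + 2 * S)) + ε * K := by
      linear_combination σ * e1 + ε * K * hσσ
    have e3 : (th - t1) * η xh * (σ * (w * lQ)) = σ * w * lZ + w * ε * (2 * n) - σ * w * (th - t1) * (v0 * lap η xh + 2 * S) := by
      linear_combination -σ * w * lq + w * ε * (2 * n) * hσσ
    rw [e2, e3] at T2
    linarith

theorem LinDat.eq (d : Dat p u₀ M) (l : LinDat p u₀ η Z Zt A t1 t2 A0 B) :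
    ∀ x, ∀ t ∈ Icc t1 t2, Z x t = (t - t1) * (η x * vv p u₀ x t) := by
  have hA : 0 ≤ A0 := (l.An t1 ⟨le_rfl, l.t12.le⟩ 0).trans (l.A1 t1 ⟨le_rfl, l.t12.le⟩ 0)
  have main : ∀ σ : ℝ, (σ = 1 ∨ σ = -1) → ∀ x, ∀ t ∈ Icc t1 t2, σ * ((t - t1) * (η x * vv p u₀ x t) - Z x t) ≤ 0 := by
    intro σ hσ
    have hs : |σ| = 1 := by rcases hσ with rfl | rfl <;> norm_num
    refine max_arg (C := (t2 - t1) * M + B) (K := 2 * n * A0 + 1) ?_ ?_ ?_ (by positivity) ?_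
    · intro z hz
      have hz2 : 0 < z.2 := l.t1pos.trans_le hz.2.1
      have h1 := (d.contD z.1 hz2).1
      have h2 : ContinuousAt (fun z : Eu n × ℝ => η z.1) z := (l.ηc.continuous.comp continuous_fst).continuousAt
      have h3 := l.Zc.continuousAt (x := z)
      refine ContinuousAt.continuousWithinAt ?_
      exact continuousAt_const.mul (((continuousAt_snd.sub continuousAt_const).mul (h2.mul h1)).sub h3)
    · intro x t ht
      have ht0 : 0 < t := l.t1pos.trans_le ht.1
      refine (le_abs_self _).trans ?_
      rw [abs_mul, hs, one_mul]
      refine (abs_sub _ _).trans (add_le_add ?_ (l.Zb t ht x))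
      have v0 := d.nonneg (x := x) ht0
      have hη0 := l.η0 x
      have hη1 := l.η1 x
      have ht1 : 0 ≤ t - t1 := by linarith [ht.1]
      rw [abs_of_nonneg (by positivity)]
      have hM := d.hM
      calc (t - t1) * (η x * vv p u₀ x t) ≤ (t2 - t1) * (1 * M) := by
            have := ht.2
            have := d.leM (x := x) ht0
            have : 0 ≤ t2 - t1 := by linarith [l.t12]
            gcongr
        _ = _ := by ring
    · intro x; rw [l.Z0]; simp
    · intro ε hε xh th hth hmax
      exact l.noTouch d hσ hε xh hth (by linarith) hmax
  intro x t ht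
  have a := main 1 (Or.inl rfl) x t ht
  have b := main (-1) (Or.inr rfl) x t ht
  linarith

end

section
open Real Set MeasureTheory Metric Filter
open scoped Topology SchwartzMap ContDiff

variable {n : ℕ} {p M : ℝ} {u₀ : Eu n → ℝ}

/-- bounded and Lipschitz in space, uniformly in time -/
def LB (S : Set (Eu n)) (I : Set ℝ) (f : Eu n → ℝ → ℝ) : Prop :=
  ∃ K, 0 ≤ K ∧ ∀ t ∈ I, ∀ x ∈ S, |f x t| ≤ K ∧ ∀ y ∈ S, |f x t - f y t| ≤ K * ‖x - y‖

variable {S : Set (Eu n)} {I : Set ℝ} {f g : Eu n → ℝ → ℝ}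

theorem LB.add (hf : LB S I f) (hg : LB S I g) : LB S I (fun x t => f x t + g x t) := by
  obtain ⟨K, hK, h⟩ := hf
  obtain ⟨K', hK', h'⟩ := hg
  refine ⟨K + K', by positivity, fun t ht x hx => ⟨?_, fun y hy => ?_⟩⟩
  · exact (abs_add_le _ _).trans (add_le_add (h t ht x hx).1 (h' t ht x hx).1)
  · have e : f x t + g x t - (f y t + g y t) = (f x t - f y t) + (g x t - g y t) := by ring
    rw [e, add_mul]
    exact (abs_add_le _ _).trans (add_le_add ((h t ht x hx).2 y hy) ((h' t ht x hx).2 y hy))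

theorem LB.mul (hf : LB S I f) (hg : LB S I g) : LB S I (fun x t => f x t * g x t) := by
  obtain ⟨K, hK, h⟩ := hf
  obtain ⟨K', hK', h'⟩ := hg
  refine ⟨2 * (K * K'), by positivity, fun t ht x hx => ⟨?_, fun y hy => ?_⟩⟩
  · rw [abs_mul]
    have := mul_le_mul (h t ht x hx).1 (h' t ht x hx).1 (abs_nonneg _) hK
    nlinarith [mul_nonneg hK hK']
  · have e : f x t * g x t - f y t * g y t = (f x t - f y t) * g x t + f y t * (g x t - g y t) := by ring
    rw [e]
    refine (abs_add_le _ _).trans ?_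
    rw [abs_mul, abs_mul]
    have a := mul_le_mul ((h t ht x hx).2 y hy) (h' t ht x hx).1 (abs_nonneg _) (by positivity)
    have b := mul_le_mul (h t ht y hy).1 ((h' t ht x hx).2 y hy) (abs_nonneg _) hK
    linarith

theorem LB.time {h : ℝ → ℝ} {K : ℝ} (hh : ∀ t ∈ I, |h t| ≤ K) (hK : 0 ≤ K) : LB S I (fun _ t => h t) :=
  ⟨K, hK, fun t ht x hx => ⟨hh t ht, fun y hy => by simp; positivity⟩⟩

theorem LB.const (a : ℝ) : LB S I (fun _ _ => a) := LB.time (h := fun _ => a) (fun _ _ => le_rfl) (abs_nonneg a)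

theorem LB.sum {ι : Type*} (s : Finset ι) {F : ι → Eu n → ℝ → ℝ} (h : ∀ i, LB S I (F i)) :
    LB S I (fun x t => ∑ i ∈ s, F i x t) := by
  classical
  induction s using Finset.induction_on with
  | empty => simpa using LB.const 0
  | insert a s ha ih =>
    simp_rw [Finset.sum_insert ha]
    exact (h a).add ih

theorem LB.smooth {f : Eu n → ℝ} (hf : ContDiff ℝ 1 f) (hs : HasCompactSupport f) : LB S I (fun x _ => f x) := by
  obtain ⟨C, hC⟩ := ContDiff.lipschitzWith_of_hasCompactSupport hs hf (by norm_num)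
  obtain ⟨D, hD⟩ := hs.exists_bound_of_continuous hf.continuous
  refine ⟨max C D, le_max_of_le_left C.2, fun t _ x _ => ⟨(hD x).trans (le_max_right _ _), fun y _ => ?_⟩⟩
  have := hC.dist_le_mul x y
  rw [Real.dist_eq, dist_eq_norm] at this
  exact this.trans (by gcongr; exact le_max_left _ _)

theorem rpow_lip (hp : 1 ≤ p) {a b M : ℝ} (ha : 0 < a) (hb : 0 < b) (haM : a ≤ M) (hbM : b ≤ M) :
    |a ^ p - b ^ p| ≤ p * M ^ (p - 1) * |a - b| := by
  have hM : 0 < M := ha.trans_le haM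
  have := (convex_Ioc (0:ℝ) M).norm_image_sub_le_of_norm_hasDerivWithin_le (f := fun x => x ^ p)
    (f' := fun x => p * x ^ (p - 1)) (C := p * M ^ (p - 1)) (x := b) (y := a)
    (fun x hx => (Real.hasDerivAt_rpow_const (Or.inl hx.1.ne')).hasDerivWithinAt)
    (fun x hx => by
      rw [Real.norm_eq_abs, abs_of_nonneg (by have := hx.1; positivity)]
      have := hx.1
      have := hx.2
      gcongr) ⟨hb, hbM⟩ ⟨ha, haM⟩
  simpa using this

theorem Dat.LBv (d : Dat p u₀ M) {R t1 t2 : ℝ} (hR : 0 < R) (ht1 : 0 < t1) (ht12 : t1 ≤ t2) :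
    LB (ball 0 R) (Icc t1 t2) (vv p u₀) ∧ (∀ e, LB (ball 0 R) (Icc t1 t2) (fun x t => Dv p u₀ x t e)) ∧
    LB (ball 0 R) (Icc t1 t2) (fun x t => vv p u₀ x t ^ p) := by
  obtain ⟨K, hK, h⟩ := d.c11 hR ht1 ht12
  have hM := d.hM
  have hp := d.p0
  have t0 : ∀ t ∈ Icc t1 t2, 0 < t := fun t ht => ht1.trans_le ht.1
  have hb : ∀ x, x ∈ ball (0 : Eu n) R → ‖x‖ < R := fun x hx => by simpa using hx
  refine ⟨⟨max K M, by positivity, fun t ht x hx => ⟨?_, fun y hy => ?_⟩⟩, fun e => ⟨K * ‖e‖, by positivity, fun t ht x hx => ⟨?_, fun y hy => ?_⟩⟩,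
    ⟨max (p * M ^ (p - 1) * K) (M ^ p), by positivity, fun t ht x hx => ⟨?_, fun y hy => ?_⟩⟩⟩
  · rw [abs_of_nonneg (d.nonneg (t0 t ht))]
    exact (d.leM (t0 t ht)).trans (le_max_right _ _)
  · exact (((h t ht x (hb x hx)).2.2.1 y (hb y hy)).2.2).trans (by gcongr; exact le_max_left _ _)
  · refine ((Dv p u₀ x t).le_opNorm e).trans ?_
    gcongr
    exact (h t ht x (hb x hx)).2.1
  · have := (Dv p u₀ x t - Dv p u₀ y t).le_opNorm e
    rw [sub_apply] at this
    refine this.trans ?_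
    have := (((h t ht x (hb x hx)).2.2.1 y (hb y hy)).2.1)
    calc _ ≤ K * ‖x - y‖ * ‖e‖ := by gcongr
      _ = _ := by ring
  · have := d.nonneg (x := x) (t0 t ht)
    rw [abs_of_nonneg (by positivity)]
    exact (rpow_le_rpow this (d.leM (t0 t ht)) hp.le).trans (le_max_right _ _)
  · refine (rpow_lip d.hp (d.pos x (t0 t ht)) (d.pos y (t0 t ht)) (d.leM (t0 t ht)) (d.leM (t0 t ht))).trans ?_
    have := (((h t ht x (hb x hx)).2.2.1 y (hb y hy)).2.2)
    calc _ ≤ p * M ^ (p - 1) * (K * ‖x - y‖) := by gcongr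
      _ = p * M ^ (p - 1) * K * ‖x - y‖ := by ring
      _ ≤ _ := by gcongr; exact le_max_left _ _

theorem LB.mono {S' : Set (Eu n)} (hf : LB S I f) (h : S' ⊆ S) : LB S' I f := by
  obtain ⟨K, hK, hh⟩ := hf
  exact ⟨K, hK, fun t ht x hx => ⟨(hh t ht x (h hx)).1, fun y hy => (hh t ht x (h hx)).2 y (h hy)⟩⟩

theorem LB.toHF {x0 : Eu n} {r : ℝ} (hr : 0 < r) (hf : LB (ball x0 (2 * r)) I f)
    (h0 : ∀ t ∈ I, ∀ x, x ∉ ball x0 r → f x t = 0) :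
    ∃ H, ∀ θ : ℝ → ℝ, (∀ τ, θ τ ∈ I) → Continuous (fun a : ℝ × Eu n => f a.2 (θ a.1)) → HF (fun τ x => f x (θ τ)) H H := by
  obtain ⟨K, hK, h⟩ := hf
  have hsub : ball x0 r ⊆ ball x0 (2 * r) := ball_subset_ball (by linarith)
  have bd : ∀ t ∈ I, ∀ x, |f x t| ≤ K := by
    intro t ht x
    by_cases hx : x ∈ ball x0 r
    · exact (h t ht x (hsub hx)).1
    · rw [h0 t ht x hx, abs_zero]; exact hK
  set H := K * (√(4 * r) + 1 / √r) + K with hH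
  have hsr : 0 < √r := sqrt_pos.2 hr
  have half : ∀ t ∈ I, ∀ x ∈ ball x0 r, ∀ y, |f x t - f y t| ≤ H * √‖x - y‖ := by
    intro t ht x hx y
    have hs := sqrt_nonneg ‖x - y‖
    by_cases hy : y ∈ ball x0 (2 * r)
    · refine ((h t ht x (hsub hx)).2 y hy).trans ?_
      have h1 : ‖x - y‖ ≤ 4 * r := by
        rw [mem_ball] at hx hy
        rw [← dist_eq_norm]
        linarith [dist_triangle_right x y x0]
      have h2 : √‖x - y‖ ≤ √(4 * r) := sqrt_le_sqrt h1
      have h3 : ‖x - y‖ = √‖x - y‖ * √‖x - y‖ := (mul_self_sqrt (norm_nonneg _)).symm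
      have h4 : 0 ≤ 1 / √r := by positivity
      calc K * ‖x - y‖ = K * (√‖x - y‖ * √‖x - y‖) := by rw [← h3]
        _ ≤ K * (√(4 * r) * √‖x - y‖) := by gcongr
        _ ≤ H * √‖x - y‖ := by rw [hH]; nlinarith [mul_nonneg hK hs, mul_nonneg (mul_nonneg hK h4) hs]
    · rw [h0 t ht y (fun h => hy (hsub h)), sub_zero]
      have h1 : r ≤ ‖x - y‖ := by
        rw [mem_ball] at hx hy
        rw [← dist_eq_norm]
        have := dist_triangle y x x0
        rw [dist_comm y x] at this
        linarith
      have h2 : √r ≤ √‖x - y‖ := sqrt_le_sqrt h1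
      have h3 : 1 ≤ 1 / √r * √‖x - y‖ := by rw [one_div, inv_mul_eq_div, one_le_div hsr]; exact h2
      have h5 := mul_le_mul_of_nonneg_left h3 hK
      have h4 := sqrt_nonneg (4 * r)
      refine (bd t ht x).trans ?_
      rw [hH]
      nlinarith [mul_nonneg hK hs, mul_nonneg (mul_nonneg hK h4) hs]
  have hHK : K ≤ H := by
    rw [hH]
    have : 0 ≤ K * (√(4 * r) + 1 / √r) := by positivity
    linarith
  have H0 : 0 ≤ H := hK.trans hHK
  refine ⟨H, fun θ hθ hc => ⟨hc, fun t x => (bd _ (hθ t) x).trans hHK, fun t x y => ?_, H0⟩⟩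
  by_cases hx : x ∈ ball x0 r
  · exact half _ (hθ t) x hx y
  · by_cases hy : y ∈ ball x0 r
    · rw [abs_sub_comm, norm_sub_rev]
      exact half _ (hθ t) y hy x
    · rw [h0 _ (hθ t) x hx, h0 _ (hθ t) y hy, sub_zero, abs_zero]; positivity

/-- cutoff -/
theorem exists_cutoff (x0 : Eu n) {r : ℝ} (hr : 0 < r) : ∃ η : Eu n → ℝ, ContDiff ℝ ∞ η ∧ HasCompactSupport η ∧
    (∀ x, 0 ≤ η x) ∧ (∀ x, η x ≤ 1) ∧ (∀ x, η x = 0 → fderiv ℝ η x = 0 ∧ lap η x = 0) ∧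
    (∀ x ∈ ball x0 (r / 2), η x = 1) ∧ (∀ x, x ∉ ball x0 r → η x = 0) := by
  let ζ : ContDiffBump x0 := ⟨r / 2, r, by linarith, by linarith⟩
  have hc : ContDiff ℝ ∞ ζ := ζ.contDiff
  have h2 : ContDiff ℝ 2 ζ := ζ.contDiff
  refine ⟨fun x => ζ x * ζ x, hc.mul hc, ζ.hasCompactSupport.mul_right, fun x => mul_self_nonneg _,
    fun x => mul_le_one₀ ζ.le_one ζ.nonneg ζ.le_one, fun x hx => ?_, fun x hx => ?_, fun x hx => ?_⟩
  · have hz : ζ x = 0 := mul_self_eq_zero.1 hx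
    have hd : DifferentiableAt ℝ ζ x := (h2.differentiable (by norm_num)) x
    constructor
    · rw [fderiv_fun_mul hd hd, hz]; simp
    · have hf : fderiv ℝ ζ x = 0 := by
        have : IsLocalMin ζ x := Eventually.of_forall fun y => by rw [hz]; exact ζ.nonneg
        exact this.fderiv_eq_zero
      rw [lap_mul h2.contDiffAt h2.contDiffAt, hz, hf]; simp
  · have : ζ x = 1 := ζ.one_of_mem_closedBall (ball_subset_closedBall hx)
    simp [this]
  · have : ζ x = 0 := ζ.zero_of_le_dist (by simpa using hx)
    simp [this]

theorem contDiff_lap {η : Eu n → ℝ} (h : ContDiff ℝ ∞ η) : ContDiff ℝ 1 (lap η) := by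
  unfold lap
  refine ContDiff.sum fun i _ => ?_
  have h1 : ContDiff ℝ ∞ fun y => fderiv ℝ η y (EuclideanSpace.single i 1) :=
    (h.fderiv_right (m := ∞) (by simp)).clm_apply contDiff_const
  exact (h1.fderiv_right (m := 1) (by norm_cast)).clm_apply contDiff_const

theorem compact_lap {η : Eu n → ℝ} (h : HasCompactSupport η) : HasCompactSupport (lap η) := by
  refine HasCompactSupport.intro h fun x hx => ?_
  have : η =ᶠ[𝓝 x] fun _ => 0 := notMem_tsupport_iff_eventuallyEq.1 hx
  rw [lap_congr this, lap_const]

end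

section
open Real Set MeasureTheory Metric Filter
open scoped Topology SchwartzMap ContDiff

variable {n : ℕ} {p M : ℝ} {u₀ : Eu n → ℝ}

theorem choose_T (l cc a : ℝ) {r : ℝ} (hr : 0 < r) : ∃ s, 0 < s ∧ s ≤ r ∧ l * (4 * cc * √(√(a * (2 * s)))) ≤ 1/4 := by
  have hc : Continuous fun s : ℝ => l * (4 * cc * √(√(a * (2 * s)))) := by fun_prop
  have h0 : ∀ᶠ s in 𝓝[>] (0:ℝ), l * (4 * cc * √(√(a * (2 * s)))) < 1/4 :=
    (hc.continuousAt (x := 0)).eventually_lt_const (by simp) |>.filter_mono nhdsWithin_le_nhds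
  obtain ⟨s, h1, h2⟩ := (h0.and (Ioc_mem_nhdsGT hr)).exists
  exact ⟨s, h2.1, h2.2, h1.le⟩

/-- the inhomogeneity -/
noncomputable def gsrc (p : ℝ) (u₀ η : Eu n → ℝ) (t1 : ℝ) (x : Eu n) (t : ℝ) : ℝ :=
  η x * vv p u₀ x t - (t - t1) * vv p u₀ x t ^ p * (vv p u₀ x t * lap η x +
      2 * ∑ i : Fin n, fderiv ℝ η x (EuclideanSpace.single i 1) * Dv p u₀ x t (EuclideanSpace.single i 1))

theorem gsrc_LB (d : Dat p u₀ M) {η : Eu n → ℝ} (hη : ContDiff ℝ ∞ η) (hs : HasCompactSupport η) {R a b : ℝ} (hR : 0 < R)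
    (ha : 0 < a) (hab : a ≤ b) (t1 k : ℝ) : LB (ball 0 R) (Icc a b) (fun x t => k * gsrc p u₀ η t1 x t) := by
  obtain ⟨l1, l2, l3⟩ := d.LBv hR ha hab
  have e1 : LB (ball 0 R) (Icc a b) (fun x _ => η x) := LB.smooth (hη.of_le (by norm_cast)) hs
  have e2 : LB (ball 0 R) (Icc a b) (fun x _ => lap η x) := LB.smooth (contDiff_lap hη) (compact_lap hs)
  have e3 : ∀ i : Fin n, LB (ball 0 R) (Icc a b) (fun x _ => fderiv ℝ η x (EuclideanSpace.single i 1)) := fun i =>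
    LB.smooth ((hη.fderiv_right (m := 1) (by norm_cast)).clm_apply contDiff_const) (hs.fderiv_apply (𝕜 := ℝ) _)
  have e4 : LB (ball (0 : Eu n) R) (Icc a b) (fun _ t => -(t - t1)) := by
    refine LB.time (h := fun t => -(t - t1)) (K := |a| + |b| + |t1|) (fun t ht => ?_) (by positivity)
    rw [abs_neg]
    refine (abs_sub _ _).trans ?_
    have : |t| ≤ |a| + |b| := by
      rw [abs_of_pos (ha.trans_le ht.1), abs_of_pos ha, abs_of_pos (ha.trans_le hab)]; linarith [ht.2]
    linarith
  have := (LB.const k).mul ((e1.mul l1).add ((e4.mul l3).mul ((l1.mul e2).add ((LB.const 2).mul (LB.sum Finset.univ fun i => (e3 i).mul (l2 (EuclideanSpace.single i 1)))))))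
  convert this using 3
  unfold gsrc
  ring

theorem gsrc_zero {η : Eu n → ℝ} (hz : ∀ x, η x = 0 → fderiv ℝ η x = 0 ∧ lap η x = 0) (t1 : ℝ) {x : Eu n} (hx : η x = 0) (t : ℝ) :
    gsrc p u₀ η t1 x t = 0 := by
  unfold gsrc
  rw [hx, (hz x hx).1, (hz x hx).2]; simp

theorem Dat.classical (d : Dat p u₀ M) (x0 : Eu n) {t0 : ℝ} (ht0 : 0 < t0) :
    ContDiffAt ℝ 2 (fun y => vv p u₀ y t0) x0 ∧
    HasDerivAt (fun s => vv p u₀ x0 s) (vv p u₀ x0 t0 ^ p * lap (fun y => vv p u₀ y t0) x0) t0 := by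
  have hp := d.p0
  have hM := d.hM
  -- constants
  obtain ⟨e, he0, he1, he⟩ : ∃ e : ℝ, 0 < e ∧ e ≤ 1/2 ∧ e * (8 * cA n + 4 * cA' n) ≤ 1/4 := by
    have h1 := cA_nonneg (n := n)
    have h2 := cA'_nonneg (n := n)
    refine ⟨1 / (4 * (8 * cA n + 4 * cA' n + 1)), by positivity, ?_, ?_⟩
    · rw [div_le_iff₀ (by positivity)]; linarith
    · rw [div_mul_eq_mul_div, div_le_iff₀ (by positivity)]; linarith
  set v := vv p u₀ with hv
  set a0 := v x0 t0 ^ p with ha0d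
  have hv0 : 0 < v x0 t0 := d.pos x0 ht0
  have ha0 : 0 < a0 := by positivity
  have hvc : ∀ x, ∀ {t}, 0 < t → ContinuousAt (fun z : Eu n × ℝ => v z.1 z.2 ^ p) (x, t) := fun x t ht =>
    (d.contD x ht).1.rpow_const (Or.inr hp.le)
  obtain ⟨r, hr, hrt, hclose⟩ : ∃ r > 0, r < t0 ∧ ∀ x ∈ ball x0 r, ∀ t ∈ Icc (t0 - r) (t0 + r), |v x t ^ p / a0 - 1| ≤ e := by
    have hcc : ContinuousAt (fun z : Eu n × ℝ => |v z.1 z.2 ^ p / a0 - 1|) (x0, t0) :=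
      (((hvc x0 ht0).div_const a0).sub continuousAt_const).abs
    have hlt : |v x0 t0 ^ p / a0 - 1| < e := by rw [← ha0d, div_self ha0.ne']; simpa using he0
    have := hcc.eventually (gt_mem_nhds hlt)
    obtain ⟨r, hr, h⟩ := Metric.eventually_nhds_iff_ball.1 this
    refine ⟨min (r / 2) (t0 / 2), by positivity, (min_le_right _ _).trans_lt (by linarith), fun x hx t ht => (h (x, t) ?_).le⟩
    rw [← ball_prod_same]
    refine ⟨ball_subset_ball ((min_le_left _ _).trans (by linarith)) hx, ?_⟩
    rw [Real.ball_eq_Ioo]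
    have := min_le_left (r / 2) (t0 / 2)
    exact ⟨by linarith [ht.1], by linarith [ht.2]⟩
  have hI0 : 0 < t0 - r := by linarith
  set I := Icc (t0 - r) (t0 + r) with hI
  set R := ‖x0‖ + 2 * r + 1 with hRd
  have hR : 0 < R := by positivity
  have hbsub : ball x0 (2 * r) ⊆ ball 0 R := by
    refine ball_subset_ball' ?_
    rw [dist_zero_right]; linarith
  obtain ⟨lv, lD, lvp⟩ := d.LBv (t1 := t0 - r) (t2 := t0 + r) hR hI0 (by linarith)
  obtain ⟨ηt, ηt_c, ηt_s, ηt0, ηt1, -, ηtone, ηtz⟩ := exists_cutoff x0 hr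
  obtain ⟨η, η_c, η_s, η0, η1, ηz, ηone, ηzz⟩ := exists_cutoff x0 (r := r / 2) (by linarith)
  set c : Eu n → ℝ → ℝ := fun x t => ηt x * (a0⁻¹ * v x t ^ p + (-1)) with hc
  have cLB : LB (ball x0 (2 * r)) I c :=
    ((LB.smooth (ηt_c.of_le (by norm_cast)) ηt_s).mul (((LB.const a0⁻¹).mul lvp).add (LB.const (-1)))).mono hbsub
  have ccl : ∀ x, ∀ t ∈ I, |c x t| ≤ e := by
    intro x t ht
    by_cases hx : x ∈ ball x0 r
    · have := hclose x hx t ht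
      simp only [hc]
      rw [abs_mul, abs_of_nonneg (ηt0 x)]
      rw [div_eq_inv_mul, sub_eq_add_neg] at this
      exact (mul_le_of_le_one_left (abs_nonneg _) (ηt1 x)).trans this
    · simp only [hc]; rw [ηtz x hx]; simpa using he0.le
  obtain ⟨lc, hlc⟩ := cLB.toHF hr (fun t ht x hx => by simp only [hc]; rw [ηtz x hx]; simp)
  obtain ⟨s, hs0, hsr, hsT⟩ := choose_T lc (cA n) a0 hr
  set t1 := t0 - s with ht1
  set t2 := t0 + s with ht2
  set T := a0 * (2 * s) with hT
  have hT0 : 0 < T := by positivity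
  have ht1p : 0 < t1 := by linarith
  have hsub : Icc t1 t2 ⊆ I := Icc_subset_Icc (by linarith) (by linarith)
  set θ : ℝ → ℝ := fun τ => t1 + max 0 (min τ T) / a0 with hθ
  have θI' : ∀ τ, θ τ ∈ Icc t1 t2 := by
    intro τ
    have h1 : 0 ≤ max 0 (min τ T) := le_max_left _ _
    have h2 : max 0 (min τ T) ≤ T := max_le hT0.le (min_le_right _ _)
    have h3 : max 0 (min τ T) / a0 ≤ 2 * s := by rw [div_le_iff₀ ha0]; linarith
    have h4 : 0 ≤ max 0 (min τ T) / a0 := by positivity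
    exact ⟨by simp only [hθ]; linarith, by simp only [hθ]; linarith⟩
  have θI : ∀ τ, θ τ ∈ I := fun τ => hsub (θI' τ)
  have θpos : ∀ τ, 0 < θ τ := fun τ => ht1p.trans_le (θI' τ).1
  have θc : Continuous θ := by simp only [hθ]; fun_prop
  have θeq : ∀ t ∈ Icc t1 t2, θ (a0 * (t - t1)) = t := by
    intro t ht
    have h1 : a0 * (t - t1) ≤ T := by
      rw [hT]; gcongr; linarith [ht.2]
    have h2 : 0 ≤ a0 * (t - t1) := mul_nonneg ha0.le (by linarith [ht.1])
    simp only [hθ]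
    rw [min_eq_left h1, max_eq_right h2]
    field_simp
    ring
  have θv : Continuous (fun a : ℝ × Eu n => v a.2 (θ a.1)) ∧ Continuous (fun a : ℝ × Eu n => Dv p u₀ a.2 (θ a.1)) := by
    have hf : Continuous fun a : ℝ × Eu n => (a.2, θ a.1) := by fun_prop
    constructor
    · refine continuous_iff_continuousAt.2 fun a => ?_
      exact ContinuousAt.comp (f := fun a : ℝ × Eu n => (a.2, θ a.1)) (g := fun z : Eu n × ℝ => v z.1 z.2) (d.contD a.2 (θpos a.1)).1 hf.continuousAt
    · refine continuous_iff_continuousAt.2 fun a => ?_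
      exact ContinuousAt.comp (f := fun a : ℝ × Eu n => (a.2, θ a.1)) (g := fun z : Eu n × ℝ => Dv p u₀ z.1 z.2) (d.contD a.2 (θpos a.1)).2 hf.continuousAt
  have θvp : Continuous (fun a : ℝ × Eu n => v a.2 (θ a.1) ^ p) := θv.1.rpow_const fun _ => Or.inr hp.le
  have hcHF0 := hlc θ θI (by
    have := ηt_c.continuous
    simp only [hc]
    fun_prop)
  have hcHF : HF (fun τ x => c x (θ τ)) e lc := ⟨hcHF0.cont, fun t x => ccl x _ (θI t), hcHF0.hol, hcHF0.H0⟩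
  have gLB := (gsrc_LB d η_c η_s hR hI0 (b := t0 + r) (by linarith) t1 a0⁻¹).mono hbsub
  obtain ⟨Hg, hHg⟩ := gLB.toHF hr (fun t ht x hx => by
    rw [gsrc_zero ηz t1 (ηzz x (fun h => hx (ball_subset_ball (by linarith) h))) t, mul_zero])
  have gHF := hHg θ θI (by
    have c1 := η_c.continuous
    have c2 := (contDiff_lap η_c).continuous
    have c3 : ∀ i : Fin n, Continuous fun x => fderiv ℝ η x (EuclideanSpace.single i 1) := fun i =>
      ((η_c.fderiv_right (m := 1) (by norm_cast)).clm_apply contDiff_const).continuous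
    have c4 : ∀ i : Fin n, Continuous fun a : ℝ × Eu n => Dv p u₀ a.2 (θ a.1) (EuclideanSpace.single i 1) := fun i =>
      θv.2.clm_apply continuous_const
    have c5 := θv.1
    refine continuous_const.mul ?_
    unfold gsrc
    have c6 : Continuous fun a : ℝ × Eu n => ∑ i : Fin n, fderiv ℝ η a.2 (EuclideanSpace.single i 1) * Dv p u₀ a.2 (θ a.1) (EuclideanSpace.single i 1) :=
      continuous_finsetSum _ fun i _ => ((c3 i).comp continuous_snd).mul (c4 i)
    exact ((c1.comp continuous_snd).mul c5).sub ((((θc.comp continuous_fst).sub continuous_const).mul θvp).mul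
      ((c5.mul (c2.comp continuous_snd)).add (continuous_const.mul c6))))
  obtain ⟨Z, Zt, Zc, Ztc, Z0, ⟨K, ZK⟩, Z2, Zd, Zeq⟩ := linsol gHF hcHF he hsT
  have τd : ∀ t, t1 < t → 0 < a0 * (t - t1) := fun t ht => mul_pos ha0 (by linarith)
  have τc : Continuous fun z : Eu n × ℝ => (a0 * (z.2 - t1), z.1) := by fun_prop
  have L : LinDat p u₀ η (fun x t => Z (a0 * (t - t1)) x) (fun x t => a0 * Zt (a0 * (t - t1)) x) (fun x t => a0 * (1 + c x t)) t1 t2 (a0 * (1 + e)) K := by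
    refine ⟨ht1p, by linarith, η_c.of_le (by norm_cast), η0, η1, ηz, Zc.comp τc, continuous_const.mul (Ztc.comp τc), fun x => by simp [Z0],
      fun t ht x => ZK _ ⟨mul_nonneg ha0.le (by linarith [ht.1]), ?_⟩ x, fun t ht => Z2 _ (τd t ht), fun t ht x => ?_, fun t ht x => ?_, fun t ht x => ?_, fun t ht x hx => ?_, fun t ht x => ?_⟩
    · rw [hT]; gcongr; linarith [ht.2]
    · have h1 : HasDerivAt (fun t => a0 * (t - t1)) (a0 * 1) t := ((hasDerivAt_id t).sub_const t1).const_mul a0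
      have := (Zd _ (τd t ht) x).comp t h1
      exact this.congr_deriv (by ring)
    · have := (abs_le.1 (ccl x t (hsub ht))).1
      exact mul_nonneg ha0.le (by linarith)
    · have := (abs_le.1 (ccl x t (hsub ht))).2
      gcongr
    · have hxb : x ∈ ball x0 (r / 2) := by by_contra h; exact hx (ηzz x h)
      simp only [hc]
      rw [ηtone x hxb]
      field_simp
      ring
    · have hti : t ∈ Icc t1 t2 := Ioc_subset_Icc_self ht
      have := Zeq (a0 * (t - t1)) (τd t ht.1) (by rw [hT]; gcongr; linarith [ht.2]) x
      rw [θeq t hti] at this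
      rw [this, mul_add, ← mul_assoc a0 a0⁻¹, mul_inv_cancel₀ ha0.ne', one_mul, ← mul_assoc]
      rfl
  have hEq := L.eq d
  have ηnear : η =ᶠ[𝓝 x0] fun _ => 1 := by
    filter_upwards [ball_mem_nhds x0 (show 0 < r / 2 / 2 by linarith)] with x hx using ηone x hx
  have hη1 : η x0 = 1 := ηnear.eq_of_nhds
  have t0m : t0 ∈ Ioc t1 t2 := ⟨by linarith, by linarith⟩
  have hts : t0 - t1 = s := by rw [ht1]; ring
  have vx : (fun y => v y t0) =ᶠ[𝓝 x0] fun y => s⁻¹ * Z (a0 * (t0 - t1)) y := by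
    filter_upwards [ηnear] with y hy
    rw [hEq y t0 (Ioc_subset_Icc_self t0m), hy, hts]
    field_simp
    rfl
  have Zcd : ContDiffAt ℝ 2 (fun y => Z (a0 * (t0 - t1)) y) x0 := (Z2 _ (τd t0 t0m.1)).contDiffAt
  have hcd : ContDiffAt ℝ 2 (fun y => v y t0) x0 := (contDiffAt_const.mul Zcd).congr_of_eventuallyEq vx
  refine ⟨hcd, ?_⟩
  have vt : (fun t => v x0 t) =ᶠ[𝓝 t0] fun t => Z (a0 * (t - t1)) x0 / (t - t1) := by
    filter_upwards [Ioo_mem_nhds (show t1 < t0 by linarith) (show t0 < t2 by linarith)] with t ht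
    rw [hEq x0 t (Ioo_subset_Icc_self ht), hη1]
    have : t - t1 ≠ 0 := by linarith [ht.1]
    field_simp
    rfl
  have hder := (L.Zd t0 t0m.1 x0).div ((hasDerivAt_id t0).sub_const t1) (by simp only [id]; rw [hts]; exact hs0.ne')
  refine (hder.congr_of_eventuallyEq vt).congr_deriv ?_
  have lapv : lap (fun y => v y t0) x0 = s⁻¹ * lap (fun y => Z (a0 * (t0 - t1)) y) x0 := by
    rw [lap_congr vx, lap_const_mul _ Zcd]
  have heqn := L.eqn t0 t0m x0
  have hZ0 := hEq x0 t0 (Ioc_subset_Icc_self t0m)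
  rw [hη1] at hZ0 heqn
  have f0 : fderiv ℝ η x0 = 0 := by rw [ηnear.fderiv_eq]; simp
  rw [f0, lap_congr ηnear, lap_const, L.Av t0 (Ioc_subset_Icc_self t0m) x0 (by rw [hη1]; norm_num)] at heqn
  simp only [id] at heqn hZ0 ⊢
  rw [heqn, lapv, hZ0, hts]
  simp only [zero_apply, zero_mul, Finset.sum_const_zero]
  field_simp
  simp only [← hv]
  ring

end

section
open Real Set MeasureTheory Metric Filter
open scoped Topology SchwartzMap ContDiff

variable {n : ℕ} {p M : ℝ} {u₀ : Eu n → ℝ}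

noncomputable def ww (p : ℝ) (u₀ : Eu n → ℝ) (x : Eu n) (t : ℝ) : ℝ := if t ≤ 0 then u₀ x else vv p u₀ x t

theorem ww_pos {x : Eu n} {t : ℝ} (ht : 0 < t) : ww p u₀ x t = vv p u₀ x t := by simp [ww, ht]
theorem ww_zero {x : Eu n} : ww p u₀ x 0 = u₀ x := by simp [ww]

theorem Dat.initial (d : Dat p u₀ M) (R : ℝ) {ε : ℝ} (hε : 0 < ε) :
    ∃ δ > (0:ℝ), ∀ x, ‖x‖ ≤ R → ∀ t, 0 ≤ t → t < δ → |ww p u₀ x t - u₀ x| ≤ ε := by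
  obtain ⟨δ1, h1, h1'⟩ := vv_init_lower d.p0 d.hM.le d.hu d.hc R hε
  obtain ⟨δ2, h2, h2'⟩ := vv_init_upper d.p0 d.hM.le d.hu d.hpos d.hc R hε
  refine ⟨min δ1 δ2, by positivity, fun x hx t ht htd => ?_⟩
  rcases ht.eq_or_lt with rfl | ht
  · rw [ww_zero]; simpa using hε.le
  · rw [ww_pos ht, abs_le]
    have := h1' x hx t ht (htd.trans_le (min_le_left _ _))
    have := h2' x hx t ht (htd.trans_le (min_le_right _ _))
    constructor <;> linarith

theorem Dat.ww_cont (d : Dat p u₀ M) :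
    ContinuousOn (fun z : Eu n × ℝ => ww p u₀ z.1 z.2) {z | 0 ≤ z.2} := by
  rintro ⟨x, t⟩ ht
  rcases (show 0 ≤ t from ht).eq_or_lt with h0 | h0
  · subst h0
    rw [Metric.continuousWithinAt_iff]
    intro ε hε
    obtain ⟨δ1, hδ1, h1⟩ := d.initial (‖x‖ + 1) (ε := ε / 2) (by linarith)
    obtain ⟨δ2, hδ2, h2⟩ := Metric.continuousAt_iff.1 (d.hc.continuousAt (x := x)) (ε / 2) (by linarith)
    refine ⟨min (min δ1 δ2) 1, by positivity, ?_⟩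
    rintro ⟨y, s⟩ hs hd
    rw [Prod.dist_eq, max_lt_iff] at hd
    simp only at hd
    obtain ⟨hd1, hd2⟩ := hd
    rw [lt_min_iff, lt_min_iff] at hd1 hd2
    have hs0 : 0 ≤ s := hs
    rw [Real.dist_eq, sub_zero, abs_of_nonneg hs0] at hd2
    have hy : ‖y‖ ≤ ‖x‖ + 1 := by
      have := norm_le_insert' y x
      rw [← dist_eq_norm] at this
      linarith [hd1.2]
    have e1 := h1 y hy s hs0 hd2.1.1
    have e2 := h2 hd1.1.2
    rw [Real.dist_eq] at e2 ⊢
    simp only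
    rw [ww_zero]
    calc _ ≤ |ww p u₀ y s - u₀ y| + |u₀ y - u₀ x| := abs_sub_le _ _ _
      _ < ε := by linarith
  · have : (fun z : Eu n × ℝ => ww p u₀ z.1 z.2) =ᶠ[𝓝 (x, t)] fun z => vv p u₀ z.1 z.2 := by
      have : ∀ᶠ z : Eu n × ℝ in 𝓝 (x, t), 0 < z.2 := continuous_snd.continuousAt.eventually (lt_mem_nhds h0)
      filter_upwards [this] with z hz using ww_pos hz
    exact ((d.contD x h0).1.congr_of_eventuallyEq this).continuousWithinAt

theorem Dat.isSolOn (d : Dat p u₀ M) (T : ℝ) : IsSolOn n p u₀ (ww p u₀) T := by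
  have hx : ∀ t, 0 < t → (fun y => ww p u₀ y t) = fun y => vv p u₀ y t := fun t ht => funext fun y => ww_pos ht
  refine ⟨d.ww_cont.mono fun z hz => hz.1, fun x => ww_zero, fun x t ht _ => ?_, fun t ht _ => ?_, fun x t ht _ => ?_⟩
  · rw [ww_pos ht]; exact d.pos x ht
  · rw [hx t ht]; exact contDiff_iff_contDiffAt.2 fun x => (d.classical x ht).1
  · rw [hx t ht, ww_pos ht]
    refine (d.classical x ht).2.congr_of_eventuallyEq ?_
    filter_upwards [lt_mem_nhds ht] with s hs using ww_pos hs

theorem Dat.min_le (d : Dat p u₀ M) {u : Eu n → ℝ → ℝ} (hu : IsMinimalSol n p u₀ u) (x : Eu n) {t : ℝ} (ht : 0 < t) :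
    u x t ≤ vv p u₀ x t := by
  have := hu.2 (t + 1) (by linarith) _ (d.isSolOn (t + 1)) x t ht.le (by linarith)
  rwa [ww_pos ht] at this

/-- F1: lower bound on a ball. -/
theorem Dat.spread (d : Dat p u₀ M) {t : ℝ} (ht : 0 < t) {x : Eu n}
    (hx : ‖x‖ ^ 2 ≤ 4 ^ (-p) / 4 * t * vv p u₀ 0 t ^ p) :
    ∃ s ∈ Icc (t / 2) t, vv p u₀ 0 t / 4 ≤ vv p u₀ x s := by
  by_contra hcon
  push Not at hcon
  set m := vv p u₀ 0 t with hm
  have hm0 : 0 < m := d.pos 0 ht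
  set ρ := ‖x‖ with hρ
  have hρ0 : 0 < ρ := by
    rcases (norm_nonneg x).eq_or_lt with h | h
    · have : x = 0 := norm_eq_zero.1 h.symm
      have := hcon t ⟨by linarith, le_rfl⟩
      subst x
      linarith
    · exact h
  have hle2 : ∀ y : Eu n, ∀ s ∈ Icc (t / 2) t, vv p u₀ y s ≤ 2 * m := by
    intro y s hs
    have hs0 : 0 < s := by linarith [hs.1]
    have hl : 1 ≤ t / s := by rw [le_div_iff₀ hs0]; linarith [hs.2]
    have hl2 : t / s ≤ 2 := by rw [div_le_iff₀ hs0]; linarith [hs.1]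
    have h1 := d.AB hl 0 hs0
    rw [div_mul_cancel₀ _ hs0.ne'] at h1
    have h2 : (t / s) ^ (1 / p) ≤ 2 := by
      calc (t / s) ^ (1 / p) ≤ (t / s) ^ (1:ℝ) := Real.rpow_le_rpow_of_exponent_le hl (by
            rw [div_le_one d.p0]; exact d.hp)
        _ ≤ 2 := by rwa [Real.rpow_one]
    calc vv p u₀ y s ≤ vv p u₀ 0 s := d.mono (by simp) hs0
      _ ≤ _ := h1
      _ ≤ 2 * m := by gcongr
  have hn : (1:ℝ) ≤ n := by exact_mod_cast d.hn
  have key := sub_cmp (M := M) d.p0 d.hM.le d.hu d.hc (D := closedBall (0 : Eu n) ρ) (t1 := t / 2) (t2 := t)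
    (b := -(7 * m / (2 * t))) (ψ := fun y => (2 * m + m / 2 + 7 * m / 4) + -(m / (2 * ρ ^ 2)) * ‖y - 0‖ ^ 2)
    (isCompact_closedBall _ _) (by linarith) (fun y _ => (contDiff_quad _ _ _).contDiffAt)
  have hlow : ∀ y ∈ closedBall (0 : Eu n) ρ, ∀ s ∈ Icc (t / 2) t, m / 4 ≤
      (2 * m + m / 2 + 7 * m / 4) + -(m / (2 * ρ ^ 2)) * ‖y - 0‖ ^ 2 + -(7 * m / (2 * t)) * s := by
    intro y hy s hs
    have hy' : ‖y‖ ≤ ρ := by simpa using hy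
    have h1 : m / (2 * ρ ^ 2) * ‖y - 0‖ ^ 2 ≤ m / 2 := by
      rw [sub_zero]
      calc m / (2 * ρ ^ 2) * ‖y‖ ^ 2 ≤ m / (2 * ρ ^ 2) * ρ ^ 2 := by gcongr
        _ = m / 2 := by field_simp
    have h2 : 7 * m / (2 * t) * s ≤ 7 * m / 2 := by
      calc 7 * m / (2 * t) * s ≤ 7 * m / (2 * t) * t := by gcongr; exact hs.2
        _ = _ := by field_simp
    linarith
  have h3 := key (fun y hy s hs => le_trans (by positivity) (hlow y hy s hs)) ?_ ?_ ?_ 0 (by simp [hρ0.le]) t ⟨by linarith, le_rfl⟩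
  · have : 7 * m / (2 * t) * t = 7 * m / 2 := by field_simp
    simp only [sub_zero, norm_zero] at h3
    norm_num at h3
    rw [← hm] at h3
    linarith
  · intro y hy
    refine (hle2 y (t / 2) ⟨le_rfl, by linarith⟩).trans ?_
    have hy' : ‖y‖ ≤ ρ := by simpa using hy
    have h1 : m / (2 * ρ ^ 2) * ‖y - 0‖ ^ 2 ≤ m / 2 := by
      rw [sub_zero]
      calc m / (2 * ρ ^ 2) * ‖y‖ ^ 2 ≤ m / (2 * ρ ^ 2) * ρ ^ 2 := by gcongr
        _ = m / 2 := by field_simp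
    have h2 : 7 * m / (2 * t) * (t / 2) = 7 * m / 4 := by field_simp; norm_num
    linarith
  · intro y hy s hs
    have hyD : y ∈ closedBall (0 : Eu n) ρ := isClosed_closedBall.frontier_subset hy
    refine le_trans ?_ (hlow y hyD s hs)
    rw [frontier_closedBall _ hρ0.ne'] at hy
    have hy' : ‖y‖ = ρ := by simpa using hy
    exact (d.mono hy'.ge (by linarith [hs.1])).trans (hcon s hs).le
  · intro y hy s hs q hq hq2
    rw [lap_quad]
    have hq4 : m / 4 ≤ q := (hlow y hy s hs).trans hq
    have h1 : (m / 4) ^ p ≤ q ^ p := Real.rpow_le_rpow (by positivity) hq4 d.p0.le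
    have h4 : (m / 4) ^ p = 4 ^ (-p) * m ^ p := by
      rw [Real.div_rpow hm0.le (by norm_num), Real.rpow_neg (by norm_num)]; field_simp
    have h5 : 4 * ρ ^ 2 ≤ t * q ^ p := by
      calc 4 * ρ ^ 2 ≤ t * (m / 4) ^ p := by rw [h4]; linarith
        _ ≤ _ := by gcongr
    have h6 : 7 * m / (2 * t) ≤ q ^ p * (m / (2 * ρ ^ 2) * (2 * n)) := by
      rw [div_le_iff₀ (by positivity)]
      have : q ^ p * (m / (2 * ρ ^ 2) * (2 * n)) * (2 * t) = (t * q ^ p) * (2 * m * n / ρ ^ 2) := by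
        field_simp
      rw [this]
      calc 7 * m ≤ 8 * m * n := by nlinarith
        _ = 4 * ρ ^ 2 * (2 * m * n / ρ ^ 2) := by field_simp; norm_num
        _ ≤ _ := by gcongr
    linarith

end

section
open Real Set MeasureTheory Metric Filter
open scoped Topology SchwartzMap ContDiff

variable {n : ℕ} {p M : ℝ} {u₀ : Eu n → ℝ}

theorem hasDerivAt_maxsq (z : ℝ) : HasDerivAt (fun z : ℝ => max 0 z ^ 2) (2 * max 0 z) z := by
  rcases lt_trichotomy z 0 with h | h | h
  · rw [max_eq_left h.le, mul_zero]
    refine (hasDerivAt_const z (0:ℝ)).congr_of_eventuallyEq ?_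
    filter_upwards [gt_mem_nhds h] with y hy
    rw [max_eq_left hy.le]; norm_num
  · subst h
    rw [hasDerivAt_iff_isLittleO_nhds_zero]
    refine Asymptotics.IsBigO.trans_isLittleO (g := fun h : ℝ => h ^ 2) ?_ (Asymptotics.isLittleO_pow_id one_lt_two)
    refine Asymptotics.IsBigO.of_bound 1 (Eventually.of_forall fun h => ?_)
    simp only [zero_add, max_self, ne_eq, OfNat.ofNat_ne_zero, not_false_eq_true, zero_pow, sub_zero, mul_zero, smul_eq_mul, one_mul]
    rw [Real.norm_eq_abs, Real.norm_eq_abs, abs_of_nonneg (by positivity), abs_of_nonneg (by positivity)]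
    rcases le_total 0 h with h' | h'
    · rw [max_eq_right h']
    · rw [max_eq_left h']; nlinarith [sq_nonneg h]
  · rw [max_eq_right h.le]
    have : HasDerivAt (fun z : ℝ => z ^ 2) (2 * z) z := by simpa using hasDerivAt_pow 2 z
    refine this.congr_of_eventuallyEq ?_
    filter_upwards [lt_mem_nhds h] with y hy
    rw [max_eq_right hy.le]

noncomputable def chi (R : ℝ) (x : Eu n) : ℝ := max 0 (1 - ‖x‖ ^ 2 / R ^ 2) ^ 2

theorem chi_nonneg (R : ℝ) (x : Eu n) : 0 ≤ chi R x := by unfold chi; positivity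

theorem chi_le_one (R : ℝ) (x : Eu n) : chi R x ≤ 1 := by
  unfold chi
  refine pow_le_one₀ (le_max_left _ _) (max_le zero_le_one ?_)
  have : 0 ≤ ‖x‖ ^ 2 / R ^ 2 := by positivity
  linarith

theorem chi_zero {R : ℝ} (hR : 0 < R) {x : Eu n} (hx : R ≤ ‖x‖) : chi R x = 0 := by
  unfold chi
  rw [max_eq_left]; · norm_num
  have : 1 ≤ ‖x‖ ^ 2 / R ^ 2 := by rw [one_le_div (by positivity)]; gcongr
  linarith

theorem chi_ge {R : ℝ} (hR : 0 < R) {x : Eu n} (hx : 2 * ‖x‖ ^ 2 ≤ R ^ 2) : 1 / 4 ≤ chi R x := by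
  unfold chi
  have : ‖x‖ ^ 2 / R ^ 2 ≤ 1 / 2 := by rw [div_le_iff₀ (by positivity)]; linarith
  calc (1:ℝ) / 4 = (1 / 2) ^ 2 := by norm_num
    _ ≤ _ := by
      refine pow_le_pow_left₀ (by norm_num) (le_trans ?_ (le_max_right _ _)) 2
      linarith

theorem chi_cont (R : ℝ) : Continuous (chi R : Eu n → ℝ) := by unfold chi; fun_prop

theorem chi_supp {R : ℝ} (hR : 0 < R) : HasCompactSupport (chi R : Eu n → ℝ) := by
  refine HasCompactSupport.intro (isCompact_closedBall 0 R) fun x hx => chi_zero hR ?_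
  have : ¬ ‖x‖ ≤ R := by simpa using hx
  linarith

/-- radial factor in the gradient of the cutoff -/
noncomputable def chik (R : ℝ) (x : Eu n) : ℝ := -(4 / R ^ 2 * max 0 (1 - ‖x‖ ^ 2 / R ^ 2))

theorem chik_nonpos (R : ℝ) (x : Eu n) : chik R x ≤ 0 := by unfold chik; rw [neg_nonpos]; positivity

theorem chik_cont (R : ℝ) : Continuous (chik R : Eu n → ℝ) := by unfold chik; fun_prop

theorem chik_zero {R : ℝ} (hR : 0 < R) {x : Eu n} (hx : R ≤ ‖x‖) : chik R x = 0 := by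
  unfold chik
  rw [max_eq_left]; · norm_num
  have : 1 ≤ ‖x‖ ^ 2 / R ^ 2 := by rw [one_le_div (by positivity)]; gcongr
  linarith

theorem chi_hasFDerivAt (R : ℝ) (x : Eu n) : HasFDerivAt (chi R) (chik R x • innerSL ℝ x) x := by
  have h1 : HasFDerivAt (fun y : Eu n => ‖y‖ ^ 2) (2 • innerSL ℝ x) x := (hasStrictFDerivAt_norm_sq x).hasFDerivAt
  have h2 : HasFDerivAt (fun y : Eu n => 1 - ‖y‖ ^ 2 / R ^ 2) (-((R ^ 2)⁻¹ • (2 • innerSL ℝ x))) x := by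
    have := (h1.const_mul (R ^ 2)⁻¹).const_sub 1
    refine this.congr_of_eventuallyEq (Eventually.of_forall fun y => ?_)
    simp only
    ring
  have := (hasDerivAt_maxsq (1 - ‖x‖ ^ 2 / R ^ 2)).comp_hasFDerivAt x h2
  refine this.congr_fderiv ?_
  ext w
  simp [chik]
  ring

theorem fderiv_self_sum (A : Eu n →L[ℝ] ℝ) (x : Eu n) : ∑ i, x i * A (EuclideanSpace.single i 1) = A x := by
  have := congrArg A ((EuclideanSpace.basisFun (Fin n) ℝ).sum_repr x)
  rw [map_sum] at this
  rw [← this]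
  refine Finset.sum_congr rfl fun i _ => ?_
  simp

theorem inner_sg (x : Eu n) (i : Fin n) : inner ℝ x (EuclideanSpace.single i (1:ℝ)) = x i := by
  rw [EuclideanSpace.inner_single_right]; simp

theorem ibp {w : Eu n → ℝ} (hw : ContDiff ℝ 2 w) {S R : ℝ} (hR : 0 < R) (hw0 : ∀ x, w x ∈ Ioo 0 S)
    (hrad : ∀ x, fderiv ℝ w x x ≤ 0) {ψ ψ' : ℝ → ℝ} (hψ : ∀ s ∈ Ioo 0 S, HasDerivAt ψ (ψ' s) s)
    (hψ'c : ContinuousOn ψ' (Ioo 0 S)) (hψ0 : ∀ s ∈ Ioo 0 S, 0 ≤ ψ s) (hψ'0 : ∀ s ∈ Ioo 0 S, 0 ≤ ψ' s) :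
    ∫ x, chi R x * (ψ (w x) * lap w x) ≤ 0 := by
  have wc : Continuous w := hw.continuous
  have ψc : Continuous fun x => ψ (w x) := continuous_iff_continuousAt.2 fun x =>
    (hψ _ (hw0 x)).continuousAt.comp wc.continuousAt
  have ψ'c : Continuous fun x => ψ' (w x) := hψ'c.comp_continuous wc hw0
  set f : Eu n → ℝ := fun x => chi R x * ψ (w x) with hf
  have hwd : ∀ x, HasFDerivAt w (fderiv ℝ w x) x := fun x => (hw.differentiable (by norm_num) x).hasFDerivAt
  have fd : ∀ x, HasFDerivAt f (chi R x • (ψ' (w x) • fderiv ℝ w x) + ψ (w x) • (chik R x • innerSL ℝ x)) x := fun x =>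
    (chi_hasFDerivAt R x).fun_mul ((hψ _ (hw0 x)).comp_hasFDerivAt x (hwd x))
  have dwc : Continuous (fderiv ℝ w) := hw.continuous_fderiv (by norm_num)
  have g1 : ∀ i : Fin n, ContDiff ℝ 1 fun y => fderiv ℝ w y (EuclideanSpace.single i 1) := fun i =>
    (hw.fderiv_right (m := 1) (by norm_num)).clm_apply contDiff_const
  have hff : ∀ x, fderiv ℝ f x = chi R x • (ψ' (w x) • fderiv ℝ w x) + ψ (w x) • (chik R x • innerSL ℝ x) := fun x => (fd x).fderiv
  have cs : ∀ g : Eu n → ℝ, (∀ x, R ≤ ‖x‖ → g x = 0) → HasCompactSupport g := fun g hg =>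
    HasCompactSupport.intro (isCompact_closedBall 0 R) fun x hx => hg x (by
      have : ¬ ‖x‖ ≤ R := by simpa using hx
      linarith)
  have fc : Continuous f := (chi_cont R).mul ψc
  have c1 : ∀ i : Fin n, Continuous fun x => fderiv ℝ f x (EuclideanSpace.single i 1) := by
    intro i
    have a1 := (g1 i).continuous
    have a2 := chi_cont (n := n) R
    have a3 := chik_cont (n := n) R
    have : (fun x => fderiv ℝ f x (EuclideanSpace.single i 1)) = fun x => chi R x * (ψ' (w x) * fderiv ℝ w x (EuclideanSpace.single i 1)) + ψ (w x) * (chik R x * x i) := by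
      funext x
      rw [hff]; simp [inner_sg]
    have a4 : Continuous fun x : Eu n => x i := by fun_prop
    rw [this]
    exact (a2.mul (ψ'c.mul a1)).add (ψc.mul (a3.mul a4))
  have I1 : ∀ i : Fin n, Integrable (fun x => fderiv ℝ f x (EuclideanSpace.single i 1) * fderiv ℝ w x (EuclideanSpace.single i 1)) := fun i =>
    ((c1 i).mul (g1 i).continuous).integrable_of_hasCompactSupport (cs _ fun x hx => by
      simp only [Pi.mul_apply]
      rw [hff, chi_zero hR hx, chik_zero hR hx]; simp)
  have c2 : ∀ i : Fin n, Continuous fun x => fderiv ℝ (fun y => fderiv ℝ w y (EuclideanSpace.single i 1)) x (EuclideanSpace.single i 1) := fun i =>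
    ((g1 i).continuous_fderiv (by norm_num)).clm_apply continuous_const
  have f0 : ∀ x, R ≤ ‖x‖ → f x = 0 := fun x hx => by simp only [hf]; rw [chi_zero hR hx, zero_mul]
  have I2 : ∀ i : Fin n, Integrable (fun x => f x * fderiv ℝ (fun y => fderiv ℝ w y (EuclideanSpace.single i 1)) x (EuclideanSpace.single i 1)) := fun i =>
    (fc.mul (c2 i)).integrable_of_hasCompactSupport (cs _ fun x hx => by rw [Pi.mul_apply, f0 x hx, zero_mul])
  have I3 : ∀ i : Fin n, Integrable (fun x => f x * fderiv ℝ w x (EuclideanSpace.single i 1)) := fun i =>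
    (fc.mul (g1 i).continuous).integrable_of_hasCompactSupport (cs _ fun x hx => by rw [Pi.mul_apply, f0 x hx, zero_mul])
  have key : ∀ i : Fin n, _ := fun i => integral_mul_fderiv_eq_neg_fderiv_mul_of_integrable (I1 i) (I2 i) (I3 i)
    (fun x _ => (fd x).differentiableAt) (fun x _ => (g1 i).differentiable (by norm_num) x)
  have e1 : (fun x => chi R x * (ψ (w x) * lap w x)) = fun x => ∑ i : Fin n, f x * fderiv ℝ (fun y => fderiv ℝ w y (EuclideanSpace.single i 1)) x (EuclideanSpace.single i 1) := by
    funext x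
    rw [← Finset.mul_sum, ← mul_assoc]; rfl
  rw [e1, integral_finsetSum _ fun i _ => I2 i, Finset.sum_congr rfl fun i _ => key i, Finset.sum_neg_distrib,
    ← integral_finsetSum _ fun i _ => I1 i, neg_nonpos]
  refine integral_nonneg fun x => ?_
  have e2 : ∑ i : Fin n, fderiv ℝ f x (EuclideanSpace.single i 1) * fderiv ℝ w x (EuclideanSpace.single i 1) =
      chi R x * ψ' (w x) * ∑ i : Fin n, fderiv ℝ w x (EuclideanSpace.single i 1) ^ 2 + ψ (w x) * (chik R x * fderiv ℝ w x x) := by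
    rw [hff, ← fderiv_self_sum (fderiv ℝ w x) x, Finset.mul_sum, Finset.mul_sum, Finset.mul_sum, ← Finset.sum_add_distrib]
    refine Finset.sum_congr rfl fun i _ => ?_
    simp [inner_sg]
    ring
  simp only
  rw [e2]
  have := chi_nonneg R x
  have h1 := hψ0 _ (hw0 x)
  have h2 := hψ'0 _ (hw0 x)
  have h3 := mul_nonneg_of_nonpos_of_nonpos (chik_nonpos R x) (hrad x)
  have h4 : 0 ≤ ∑ i : Fin n, fderiv ℝ w x (EuclideanSpace.single i 1) ^ 2 := Finset.sum_nonneg fun i _ => sq_nonneg _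
  show (0:ℝ) ≤ _
  positivity

theorem Dat.Dv_rad (d : Dat p u₀ M) (x : Eu n) {t : ℝ} (ht : 0 < t) : fderiv ℝ (fun y => vv p u₀ y t) x x ≤ 0 := by
  have h1 : HasDerivAt (fun r : ℝ => r • x) x 1 := by
    simpa using (hasDerivAt_id (1:ℝ)).smul_const x
  have h0 := (d.hasFDerivAt x ht).differentiableAt.hasFDerivAt
  have h2 : HasDerivAt (fun r : ℝ => vv p u₀ (r • x) t) (fderiv ℝ (fun y => vv p u₀ y t) x x) 1 := by
    have := HasFDerivAt.comp_hasDerivAt (1:ℝ) (f := fun r : ℝ => r • x) (l := fun y => vv p u₀ y t) (by rw [one_smul]; exact h0) h1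
    exact this
  have h3 : AntitoneOn (fun r : ℝ => vv p u₀ (r • x) t) (Ioi 0) := by
    intro a ha b hb hab
    refine d.mono ?_ ht
    have ha : 0 < a := ha
    rw [norm_smul, norm_smul, Real.norm_of_nonneg ha.le, Real.norm_of_nonneg (ha.le.trans hab)]
    gcongr
  have := h3.derivWithin_nonpos (x := 1)
  rwa [derivWithin_of_isOpen isOpen_Ioi (by simp), h2.deriv] at this

end

section
open Real Set MeasureTheory Metric Filter
open scoped Topology SchwartzMap ContDiff

variable {n : ℕ} {p M : ℝ} {u₀ : Eu n → ℝ}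

theorem Dat.vS (d : Dat p u₀ M) {S : ℝ} (hMS : M < S) {t : ℝ} (ht : 0 < t) (x : Eu n) : vv p u₀ x t ∈ Ioo 0 S :=
  ⟨d.pos x ht, (d.leM ht).trans_lt hMS⟩

theorem Dat.contDiff (d : Dat p u₀ M) {t : ℝ} (ht : 0 < t) : ContDiff ℝ 2 (fun y => vv p u₀ y t) :=
  contDiff_iff_contDiffAt.2 fun x => (d.classical x ht).1

theorem Dat.Jderiv (d : Dat p u₀ M) {S R : ℝ} (hR : 0 < R) (hMS : M < S) {φ φ' : ℝ → ℝ}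
    (hφ : ∀ s ∈ Ioo 0 S, HasDerivAt φ (φ' s) s) (hφ'c : ContinuousOn φ' (Ioo 0 S)) {t : ℝ} (ht : 0 < t) :
    HasDerivAt (fun s => ∫ x, chi R x * φ (vv p u₀ x s))
      (∫ x, chi R x * (vv p u₀ x t ^ p * φ' (vv p u₀ x t) * lap (fun y => vv p u₀ y t) x)) t := by
  obtain ⟨K, hK, c, hc, hlow, -, hlip⟩ := d.loc (R := R) (t1 := t / 2) (t2 := 2 * t) hR (by linarith) (by linarith)
  have hsub : Icc c M ⊆ Ioo 0 S := fun s hs => ⟨hc.trans_le hs.1, hs.2.trans_lt hMS⟩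
  obtain ⟨B, hB⟩ := isCompact_Icc.exists_bound_of_continuousOn (hφ'c.mono hsub)
  have cv : ∀ {s}, 0 < s → Continuous fun x => vv p u₀ x s := fun hs => (d.contDiff hs).continuous
  have cφ : ContinuousOn φ (Ioo 0 S) := fun s hs => (hφ s hs).continuousAt.continuousWithinAt
  have cF : ∀ {s}, 0 < s → Continuous fun x => chi R x * φ (vv p u₀ x s) := fun hs =>
    (chi_cont R).mul (cφ.comp_continuous (cv hs) (d.vS hMS hs))
  have h2 : ∀ x : Eu n, lap (fun y => vv p u₀ y t) x = lap (fun y => vv p u₀ y t) x := fun _ => rfl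
  have clap : Continuous (lap fun y => vv p u₀ y t) := continuous_iff_continuousAt.2 fun x =>
    (d.classical x ht).1.continuousAt_lap
  refine (hasDerivAt_integral_of_dominated_loc_of_lip (s := Icc (t / 2) (2 * t)) (bound := fun x => chi R x * (|B| * K))
    (F := fun s x => chi R x * φ (vv p u₀ x s))
    (Icc_mem_nhds (by linarith) (by linarith)) ?_ ?_ ?_ ?_ ?_ ?_).2
  · filter_upwards [lt_mem_nhds ht] with s hs using (cF hs).aestronglyMeasurable
  · exact (cF ht).integrable_of_hasCompactSupport (chi_supp hR).mul_right
  · exact ((chi_cont R).mul ((((cv ht).rpow_const fun _ => Or.inr d.p0.le).mul (hφ'c.comp_continuous (cv ht) (d.vS hMS ht))).mul clap)).aestronglyMeasurable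
  · refine Eventually.of_forall fun x => ?_
    by_cases hx : R ≤ ‖x‖
    · simp only [chi_zero hR hx, zero_mul]
      exact (LipschitzWith.const (0:ℝ)).lipschitzOnWith.weaken (zero_le)
    push Not at hx
    refine LipschitzOnWith.of_dist_le_mul fun a ha b hb => ?_
    rw [Real.dist_eq, Real.dist_eq, Real.coe_nnabs, abs_of_nonneg (mul_nonneg (chi_nonneg R x) (by positivity)),
      ← mul_sub, abs_mul, abs_of_nonneg (chi_nonneg R x), mul_assoc]
    have ha0 : 0 < a := by linarith [ha.1]
    have hb0 : 0 < b := by linarith [hb.1]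
    have h1 := (convex_Icc c M).norm_image_sub_le_of_norm_hasDerivWithin_le (f := φ) (f' := φ') (C := |B|) (x := vv p u₀ x b) (y := vv p u₀ x a)
      (fun s hs => (hφ s (hsub hs)).hasDerivWithinAt) (fun s hs => (hB s hs).trans (le_abs_self B))
      ⟨hlow x hx.le b hb, d.leM hb0⟩ ⟨hlow x hx.le a ha, d.leM ha0⟩
    rw [Real.norm_eq_abs, Real.norm_eq_abs] at h1
    refine mul_le_mul_of_nonneg_left (h1.trans ?_) (chi_nonneg R x)
    rw [mul_assoc]
    exact mul_le_mul_of_nonneg_left (hlip x hx.le b hb a ha) (abs_nonneg B)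
  · exact (((chi_cont R).mul continuous_const).integrable_of_hasCompactSupport (chi_supp hR).mul_right)
  · refine Eventually.of_forall fun x => ?_
    have := ((hφ _ (d.vS hMS ht x)).comp t (d.classical x ht).2).const_mul (chi R x)
    exact this.congr_deriv (by ring)

theorem Dat.Jle (d : Dat p u₀ M) {S R : ℝ} (hR : 0 < R) (hMS : M < S) {φ φ' ψ' : ℝ → ℝ}
    (hφ : ∀ s ∈ Ioo 0 S, HasDerivAt φ (φ' s) s) (hφ'c : ContinuousOn φ' (Ioo 0 S))
    (hφ0 : ∀ s ∈ Ioo 0 S, 0 ≤ φ s) (hφ'0 : ∀ s ∈ Ioo 0 S, 0 ≤ φ' s)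
    (hψ : ∀ s ∈ Ioo 0 S, HasDerivAt (fun s => s ^ p * φ' s) (ψ' s) s) (hψ'c : ContinuousOn ψ' (Ioo 0 S))
    (hψ'0 : ∀ s ∈ Ioo 0 S, 0 ≤ ψ' s) {t : ℝ} (ht : 0 < t) :
    ∫ x, chi R x * φ (vv p u₀ x t) ≤ ∫ x, chi R x * φ (u₀ x) := by
  have cφ : ContinuousOn φ (Ioo 0 S) := fun s hs => (hφ s hs).continuousAt.continuousWithinAt
  have hanti : AntitoneOn (fun s => ∫ x, chi R x * φ (vv p u₀ x s)) (Ioi 0) := by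
    refine antitoneOn_of_deriv_nonpos (convex_Ioi 0) (fun s hs => (d.Jderiv hR hMS hφ hφ'c hs).continuousAt.continuousWithinAt)
      (fun s hs => ?_) (fun s hs => ?_)
    · rw [interior_Ioi] at hs
      exact (d.Jderiv hR hMS hφ hφ'c hs).differentiableAt.differentiableWithinAt
    · rw [interior_Ioi] at hs
      have hs : 0 < s := hs
      rw [(d.Jderiv hR hMS hφ hφ'c hs).deriv]
      exact ibp (d.contDiff hs) hR (d.vS hMS hs) (fun x => d.Dv_rad x hs) hψ hψ'c
        (fun s hs => mul_nonneg (Real.rpow_nonneg hs.1.le _) (hφ'0 s hs)) hψ'0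
  have hmono : MonotoneOn φ (Ioo 0 S) := monotoneOn_of_deriv_nonneg (convex_Ioo 0 S) cφ
    (fun s hs => by rw [interior_Ioo] at hs; exact (hφ s hs).differentiableAt.differentiableWithinAt)
    (fun s hs => by rw [interior_Ioo] at hs; rw [(hφ s hs).deriv]; exact hφ'0 s hs)
  have cv : ∀ {s}, 0 < s → Continuous fun x => vv p u₀ x s := fun hs => (d.contDiff hs).continuous
  have cF : ∀ {s}, 0 < s → Continuous fun x => chi R x * φ (vv p u₀ x s) := fun hs =>
    (chi_cont R).mul (cφ.comp_continuous (cv hs) (d.vS hMS hs))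
  have hMI : M ∈ Ioo 0 S := ⟨d.hM, hMS⟩
  have hlim : Tendsto (fun s => ∫ x, chi R x * φ (vv p u₀ x s)) (𝓝[>] 0) (𝓝 (∫ x, chi R x * φ (u₀ x))) := by
    refine tendsto_integral_filter_of_dominated_convergence (fun x => chi R x * φ M) ?_ ?_ ?_ ?_
    · filter_upwards [self_mem_nhdsWithin] with s hs using (cF hs).aestronglyMeasurable
    · filter_upwards [self_mem_nhdsWithin] with s hs
      refine Eventually.of_forall fun x => ?_
      have h1 := d.vS hMS hs x
      rw [Real.norm_of_nonneg (mul_nonneg (chi_nonneg R x) (hφ0 _ h1))]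
      exact mul_le_mul_of_nonneg_left (hmono h1 hMI (d.leM hs)) (chi_nonneg R x)
    · exact ((chi_cont R).mul continuous_const).integrable_of_hasCompactSupport (chi_supp hR).mul_right
    · refine Eventually.of_forall fun x => ?_
      refine Tendsto.const_mul _ ?_
      have hx : u₀ x ∈ Ioo 0 S := ⟨d.hpos x, (d.hu x).trans_lt hMS⟩
      refine (hφ _ hx).continuousAt.tendsto.comp ?_
      rw [Metric.tendsto_nhds]
      intro ε hε
      obtain ⟨δ, hδ, h⟩ := d.initial ‖x‖ (ε := ε / 2) (by linarith)
      filter_upwards [Ioo_mem_nhdsGT hδ] with s hs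
      have := h x le_rfl s hs.1.le hs.2
      rw [ww_pos hs.1] at this
      rw [Real.dist_eq]; linarith
  refine ge_of_tendsto hlim ?_
  filter_upwards [Ioo_mem_nhdsGT ht] with s hs
  exact hanti hs.1 ht hs.2.le

end

section
open Real Set MeasureTheory Metric Filter
open scoped Topology SchwartzMap ContDiff

variable {n : ℕ} {p M : ℝ} {u₀ : Eu n → ℝ}

theorem phi_pack {p s₀ q₀ : ℝ} (hp : 1 ≤ p) (hs₀ : 0 < s₀) (hq₀ : 0 < q₀)
    (L L' L'' : ℝ → ℝ)
    (hLderiv : ∀ s ∈ Set.Ioo 0 s₀, HasDerivAt L (L' s) s)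
    (hL'deriv : ∀ s ∈ Set.Ioo 0 s₀, HasDerivAt L' (L'' s) s)
    (hL''cont : ContinuousOn L'' (Set.Ioo 0 s₀))
    (hLmono : MonotoneOn L (Set.Ioi 0))
    (hLconv : ∀ s ∈ Set.Ioo 0 s₀, s * L'' s ≥ -((3*p + q₀ - 2)/(p + q₀)) * L' s) :
    ∃ φ' ψ' : ℝ → ℝ, (∀ s ∈ Ioo 0 (s₀ ^ (2 / p)), HasDerivAt (fun s => L (s ^ (p / 2))) (φ' s) s) ∧
      ContinuousOn φ' (Ioo 0 (s₀ ^ (2 / p))) ∧ (∀ s ∈ Ioo 0 (s₀ ^ (2 / p)), 0 ≤ φ' s) ∧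
      (∀ s ∈ Ioo 0 (s₀ ^ (2 / p)), HasDerivAt (fun s => s ^ p * φ' s) (ψ' s) s) ∧
      ContinuousOn ψ' (Ioo 0 (s₀ ^ (2 / p))) ∧ (∀ s ∈ Ioo 0 (s₀ ^ (2 / p)), 0 ≤ ψ' s) := by
  have hp0 : 0 < p := by linarith
  have hr : ∀ s ∈ Ioo 0 (s₀ ^ (2 / p)), s ^ (p / 2) ∈ Ioo 0 s₀ := by
    intro s hs
    refine ⟨Real.rpow_pos_of_pos hs.1 _, ?_⟩
    have := Real.rpow_lt_rpow hs.1.le hs.2 (show 0 < p / 2 by positivity)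
    rwa [← Real.rpow_mul hs₀.le, show 2 / p * (p / 2) = 1 by field_simp, Real.rpow_one] at this
  have hL'0 : ∀ s ∈ Ioo 0 s₀, 0 ≤ L' s := by
    intro s hs
    have := hLmono.derivWithin_nonneg (x := s)
    rwa [derivWithin_of_isOpen isOpen_Ioi hs.1, (hLderiv s hs).deriv] at this
  have cr : ContinuousOn (fun s : ℝ => s ^ (p / 2)) (Ioo 0 (s₀ ^ (2 / p))) := fun s hs =>
    (Real.continuousAt_rpow_const _ _ (Or.inl hs.1.ne')).continuousWithinAt
  have ce : ∀ e : ℝ, ContinuousOn (fun s : ℝ => s ^ e) (Ioo 0 (s₀ ^ (2 / p))) := fun e s hs =>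
    (Real.continuousAt_rpow_const _ _ (Or.inl hs.1.ne')).continuousWithinAt
  have cL' : ContinuousOn (fun s : ℝ => L' (s ^ (p / 2))) (Ioo 0 (s₀ ^ (2 / p))) :=
    ContinuousOn.comp (t := Ioo 0 s₀) (g := L') (fun s hs => (hL'deriv s hs).continuousAt.continuousWithinAt) cr hr
  have cL'' : ContinuousOn (fun s : ℝ => L'' (s ^ (p / 2))) (Ioo 0 (s₀ ^ (2 / p))) :=
    ContinuousOn.comp (t := Ioo 0 s₀) (g := L'') hL''cont cr hr
  have hrd : ∀ s ∈ Ioo 0 (s₀ ^ (2 / p)), HasDerivAt (fun s : ℝ => s ^ (p / 2)) (p / 2 * s ^ (p / 2 - 1)) s := fun s hs =>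
    Real.hasDerivAt_rpow_const (Or.inl hs.1.ne')
  refine ⟨fun s => L' (s ^ (p / 2)) * (p / 2 * s ^ (p / 2 - 1)),
    fun s => p / 2 * s ^ (3 * p / 2 - 2) * (p / 2 * (s ^ (p / 2) * L'' (s ^ (p / 2))) + (3 * p / 2 - 1) * L' (s ^ (p / 2))),
    fun s hs => (hLderiv _ (hr s hs)).comp s (hrd s hs), cL'.mul (continuousOn_const.mul (ce _)), fun s hs => ?_, fun s hs => ?_,
    (continuousOn_const.mul (ce _)).mul ((continuousOn_const.mul (cr.mul cL'')).add (continuousOn_const.mul cL')), fun s hs => ?_⟩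
  · have := hL'0 _ (hr s hs)
    have := hs.1
    positivity
  · have h1 : HasDerivAt (fun s : ℝ => s ^ (3 * p / 2 - 1)) ((3 * p / 2 - 1) * s ^ (3 * p / 2 - 1 - 1)) s :=
      Real.hasDerivAt_rpow_const (Or.inl hs.1.ne')
    have h2 := (((hL'deriv _ (hr s hs)).comp s (hrd s hs)).fun_mul h1).const_mul (p / 2)
    have h3 : (fun s => s ^ p * (L' (s ^ (p / 2)) * (p / 2 * s ^ (p / 2 - 1)))) =ᶠ[𝓝 s] fun s => p / 2 * ((L' ∘ fun s => s ^ (p / 2)) s * s ^ (3 * p / 2 - 1)) := by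
      filter_upwards [lt_mem_nhds hs.1] with y hy
      have : y ^ (3 * p / 2 - 1) = y ^ p * y ^ (p / 2 - 1) := by rw [← Real.rpow_add hy]; congr 1; ring
      rw [this]
      simp only [Function.comp]
      ring
    refine (h2.congr_of_eventuallyEq h3).congr_deriv ?_
    have e1 : s ^ (3 * p / 2 - 1 - 1) = s ^ (3 * p / 2 - 2) := by congr 1; ring
    have e2 : s ^ (p / 2 - 1) * s ^ (3 * p / 2 - 1) = s ^ (3 * p / 2 - 2) * s ^ (p / 2) := by
      rw [← Real.rpow_add hs.1, ← Real.rpow_add hs.1]; congr 1; ring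
    rw [e1]
    simp only [Function.comp]
    linear_combination (p / 2 * L'' (s ^ (p / 2)) * (p / 2)) * e2
  · have h0 := hL'0 _ (hr s hs)
    have h1 := hLconv _ (hr s hs)
    have hs1 := hs.1
    refine mul_nonneg (by positivity) ?_
    set r := s ^ (p / 2)
    have h2 : p * ((3*p + q₀ - 2)/(p + q₀)) ≤ 3 * p - 2 := by
      rw [← mul_div_assoc, div_le_iff₀ (by linarith)]
      nlinarith [mul_nonneg hq₀.le (sub_nonneg.2 hp)]
    have h3 : p / 2 * (r * L'' r) ≥ p / 2 * (-((3*p + q₀ - 2)/(p + q₀)) * L' r) := mul_le_mul_of_nonneg_left h1 (by positivity)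
    nlinarith [mul_le_mul_of_nonneg_right h2 h0]

/-- iterating hypothesis (H) -/
theorem H_iter {s₀ : ℝ} {L : ℝ → ℝ} (hLpos : ∀ s ∈ Set.Ioi (0:ℝ), 0 < L s) (hLmono : MonotoneOn L (Set.Ioi 0))
    (hH : ∃ a > 0, ∃ lam₀ > 0, ∀ s ∈ Set.Ioo 0 s₀, ∀ l ∈ Set.Ioo 0 lam₀,
      L s ≤ (1 + a * l) * L (s ^ (1 + l))) (e : ℝ) :
    ∃ K > 0, ∀ r, 0 < r → r < 1 → r < s₀ → L r ≤ K * L (r ^ e) := by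
  obtain ⟨a, ha, l0, hl0, h⟩ := hH
  set l := l0 / 2 with hl
  have hlI : l ∈ Ioo 0 l0 := ⟨by positivity, by linarith⟩
  have hlp : 0 < l := hlI.1
  obtain ⟨k, hk⟩ := pow_unbounded_of_one_lt e (show 1 < 1 + l by linarith)
  have hit : ∀ j : ℕ, ∀ r, 0 < r → r < 1 → r < s₀ → L r ≤ (1 + a * l) ^ j * L (r ^ ((1 + l) ^ j)) := by
    intro j
    induction j with
    | zero => intro r _ _ _; simp
    | succ j ih =>
      intro r h0 h1 h2
      have hr1 : r ^ (1 + l) ≤ r := by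
        conv_rhs => rw [← Real.rpow_one r]
        exact Real.rpow_le_rpow_of_exponent_ge h0 h1.le (by linarith)
      calc L r ≤ (1 + a * l) * L (r ^ (1 + l)) := h r ⟨h0, h2⟩ l hlI
        _ ≤ (1 + a * l) * ((1 + a * l) ^ j * L ((r ^ (1 + l)) ^ ((1 + l) ^ j))) := by
          gcongr
          exact ih _ (Real.rpow_pos_of_pos h0 _) (hr1.trans_lt h1) (hr1.trans_lt h2)
        _ = _ := by
          rw [← Real.rpow_mul h0.le, pow_succ', pow_succ']
          ring
  refine ⟨(1 + a * l) ^ k, by positivity, fun r h0 h1 h2 => (hit k r h0 h1 h2).trans ?_⟩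
  gcongr
  exact hLmono (Real.rpow_pos_of_pos h0 _) (Real.rpow_pos_of_pos h0 _) (Real.rpow_le_rpow_of_exponent_ge h0 h1.le hk.le)

theorem Dat.phi_int (d : Dat p u₀ M) {s₀ : ℝ} (hs₀ : 0 < s₀) {L : ℝ → ℝ} (hLcont : ContinuousOn L (Set.Ici 0))
    (hLpos : ∀ s ∈ Set.Ioi (0:ℝ), 0 < L s) (hLmono : MonotoneOn L (Set.Ioi 0))
    (hH : ∃ a > 0, ∃ lam₀ > 0, ∀ s ∈ Set.Ioo 0 s₀, ∀ l ∈ Set.Ioo 0 lam₀,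
      L s ≤ (1 + a * l) * L (s ^ (1 + l)))
    (hu₀int : Integrable (fun x => L (u₀ x)) volume) : Integrable (fun x => L (u₀ x ^ (p / 2))) volume := by
  have hp := d.p0
  obtain ⟨K, hK, h⟩ := H_iter hLpos hLmono hH (2 / p)
  set δ := (min 1 s₀) ^ (2 / p) with hδ
  have hδ0 : 0 < δ := by positivity
  have hnt : Nontrivial (Eu n) := by
    obtain ⟨e, he⟩ := d.exists_unit
    exact ⟨e, 0, fun h => by rw [h] at he; simp at he⟩
  obtain ⟨R, hR⟩ : ∃ R : ℝ, ∀ x, R < ‖x‖ → u₀ x < δ := by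
    by_contra hcon
    push Not at hcon
    have hall : ∀ x, δ ≤ u₀ x := fun x => by
      obtain ⟨y, hy, hy2⟩ := hcon ‖x‖
      exact hy2.trans (d.hmono _ _ hy.le)
    have h1 : Integrable (fun _ : Eu n => L δ) volume := hu₀int.mono' aestronglyMeasurable_const
      (Eventually.of_forall fun x => by
        rw [Real.norm_of_nonneg (hLpos δ hδ0).le]
        exact hLmono hδ0 (d.hpos x) (hall x))
    rw [integrable_const_iff] at h1
    rcases h1 with h1 | h1
    · exact (hLpos δ hδ0).ne' h1
    · exact absurd (measure_univ_of_isAddLeftInvariant (volume : Measure (Eu n))) (measure_lt_top _ _).ne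
  have hmeas : Continuous fun x => L (u₀ x ^ (p / 2)) :=
    hLcont.comp_continuous (d.hc.rpow_const fun _ => Or.inr (by positivity)) fun x => Real.rpow_nonneg (d.hpos x).le _
  have hdom : Integrable (fun x => K * L (u₀ x) + (closedBall (0 : Eu n) R).indicator (fun _ => L (M ^ (p / 2))) x) volume := by
    refine (hu₀int.const_mul K).add ?_
    exact (integrable_indicator_iff measurableSet_closedBall).2 (integrableOn_const (isCompact_closedBall _ _).measure_lt_top.ne)
  refine hdom.mono' hmeas.aestronglyMeasurable (Eventually.of_forall fun x => ?_)
  have hr0 : 0 < u₀ x ^ (p / 2) := Real.rpow_pos_of_pos (d.hpos x) _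
  rw [Real.norm_of_nonneg (hLpos _ hr0).le]
  have hLu := hLpos _ (d.hpos x)
  have hLM := hLpos (M ^ (p / 2)) (Real.rpow_pos_of_pos d.hM _)
  by_cases hx : x ∈ closedBall (0 : Eu n) R
  · rw [indicator_of_mem hx]
    have : L (u₀ x ^ (p / 2)) ≤ L (M ^ (p / 2)) := hLmono hr0 (Real.rpow_pos_of_pos d.hM _)
      (Real.rpow_le_rpow (d.hpos x).le (d.hu x) (by positivity))
    nlinarith
  · rw [indicator_of_notMem hx, add_zero]
    have hx' : R < ‖x‖ := by simpa using hx
    have h1 := Real.rpow_lt_rpow (d.hpos x).le (hR x hx') (show 0 < p / 2 by positivity)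
    rw [hδ, ← Real.rpow_mul (by positivity), show 2 / p * (p / 2) = 1 by field_simp, Real.rpow_one, lt_min_iff] at h1
    have := h _ hr0 h1.1 h1.2
    rwa [← Real.rpow_mul (d.hpos x).le, show p / 2 * (2 / p) = 1 by field_simp, Real.rpow_one] at this

end

section
open Real Set MeasureTheory Metric Filter
open scoped Topology SchwartzMap ContDiff

variable {n : ℕ} {p M : ℝ} {u₀ : Eu n → ℝ}

theorem Dat.mass (d : Dat p u₀ M) {S : ℝ} (hMS : M < S) {φ φ' ψ' : ℝ → ℝ}
    (hφ : ∀ s ∈ Ioo 0 S, HasDerivAt φ (φ' s) s) (hφ'c : ContinuousOn φ' (Ioo 0 S))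
    (hφ0 : ∀ s ∈ Ioo 0 S, 0 ≤ φ s) (hφ'0 : ∀ s ∈ Ioo 0 S, 0 ≤ φ' s)
    (hψ : ∀ s ∈ Ioo 0 S, HasDerivAt (fun s => s ^ p * φ' s) (ψ' s) s) (hψ'c : ContinuousOn ψ' (Ioo 0 S))
    (hψ'0 : ∀ s ∈ Ioo 0 S, 0 ≤ ψ' s) (hintegr : Integrable (fun x => φ (u₀ x)) volume) {s ρ m : ℝ} (hs : 0 < s) (hρ : 0 < ρ)
    (hm : 0 < m) (hv : ∀ y : Eu n, ‖y‖ ≤ ρ → m ≤ vv p u₀ y s) :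
    1 / 4 * φ m * (ρ ^ n * (volume (ball (0 : Eu n) 1)).toReal) ≤ ∫ x, φ (u₀ x) := by
  have cφ : ContinuousOn φ (Ioo 0 S) := fun s hs => (hφ s hs).continuousAt.continuousWithinAt
  have hmono : MonotoneOn φ (Ioo 0 S) := monotoneOn_of_deriv_nonneg (convex_Ioo 0 S) cφ
    (fun s hs => by rw [interior_Ioo] at hs; exact (hφ s hs).differentiableAt.differentiableWithinAt)
    (fun s hs => by rw [interior_Ioo] at hs; rw [(hφ s hs).deriv]; exact hφ'0 s hs)
  have hR : 0 < 2 * ρ := by linarith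
  have h1 := d.Jle hR hMS hφ hφ'c hφ0 hφ'0 hψ hψ'c hψ'0 hs
  have hu : ∀ x, u₀ x ∈ Ioo 0 S := fun x => ⟨d.hpos x, (d.hu x).trans_lt hMS⟩
  have h2 : ∫ x, chi (2 * ρ) x * φ (u₀ x) ≤ ∫ x, φ (u₀ x) := by
    refine integral_mono_of_nonneg (Eventually.of_forall fun x => mul_nonneg (chi_nonneg _ x) (hφ0 _ (hu x))) hintegr
      (Eventually.of_forall fun x => mul_le_of_le_one_left (hφ0 _ (hu x)) (chi_le_one _ x))
  have hmS : m ∈ Ioo 0 S := ⟨hm, (hv 0 (by simpa using hρ.le)).trans_lt (d.vS hMS hs 0).2⟩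
  have h3 : ∫ x, (ball (0 : Eu n) ρ).indicator (fun _ => 1 / 4 * φ m) x ≤ ∫ x, chi (2 * ρ) x * φ (vv p u₀ x s) := by
    refine integral_mono_of_nonneg (Eventually.of_forall fun x => ?_) ?_ (Eventually.of_forall fun x => ?_)
    · have := hφ0 m hmS
      exact indicator_nonneg (fun _ _ => by positivity) x
    · exact ((chi_cont _).mul (cφ.comp_continuous (d.contDiff hs).continuous (d.vS hMS hs))).integrable_of_hasCompactSupport (chi_supp hR).mul_right
    · have h4 := d.vS hMS hs x
      by_cases hx : x ∈ ball (0 : Eu n) ρ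
      · rw [indicator_of_mem hx]
        have hx' : ‖x‖ < ρ := by simpa using hx
        have := hφ0 m hmS
        have h5 : 1 / 4 ≤ chi (2 * ρ) x := chi_ge hR (by nlinarith [norm_nonneg x])
        have h6 := hmono hmS h4 (hv x hx'.le)
        have h7 := chi_nonneg (2 * ρ) x
        simp only
        gcongr
      · rw [indicator_of_notMem hx]
        exact mul_nonneg (chi_nonneg _ x) (hφ0 _ h4)
  rw [integral_indicator measurableSet_ball, setIntegral_const, smul_eq_mul, measureReal_def,
    Measure.addHaar_ball_of_pos volume (0 : Eu n) hρ, finrank_euclideanSpace_fin, ENNReal.toReal_mul, ENNReal.toReal_ofReal (by positivity)] at h3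
  linarith

theorem final_alg {p c t m ℓ A ρ : ℝ} {n : ℕ} (hn : 1 ≤ n) (hp : 1 ≤ p) (hc : 0 < c) (ht : 0 < t) (hm : 0 < m) (hℓ : 0 < ℓ)
    (hA : 0 < A) (hρ0 : 0 ≤ ρ) (hρ : ρ ^ 2 = c * t * m ^ p) (h : ρ ^ n * ℓ ≤ A) :
    m ≤ (A ^ (2 / (n:ℝ)) / c) ^ (1 / p) * t ^ (-(1:ℝ) / p) * ℓ ^ (-(2 / ((n:ℝ) * p))) := by
  have hp0 : 0 < p := by linarith
  have hn0 : (0:ℝ) < n := by exact_mod_cast hn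
  have h1 : ρ ^ n ≤ A * ℓ⁻¹ := by rw [← div_eq_mul_inv, le_div_iff₀ hℓ]; exact h
  have h2 := Real.rpow_le_rpow (by positivity) h1 (show 0 ≤ 2 / (n:ℝ) by positivity)
  rw [← Real.rpow_natCast, ← Real.rpow_mul hρ0, mul_div_cancel₀ _ hn0.ne', Real.rpow_two, hρ, Real.mul_rpow hA.le (by positivity)] at h2
  have h3 : m ^ p ≤ A ^ (2 / (n:ℝ)) / c * t⁻¹ * ℓ⁻¹ ^ (2 / (n:ℝ)) := by
    rw [div_mul_eq_mul_div, div_mul_eq_mul_div, le_div_iff₀ hc]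
    have := mul_le_mul_of_nonneg_right h2 (inv_nonneg.2 ht.le)
    calc m ^ p * c = c * t * m ^ p * t⁻¹ := by field_simp
      _ ≤ _ := this
      _ = _ := by ring
  have h4 := Real.rpow_le_rpow (by positivity) h3 (show 0 ≤ 1 / p by positivity)
  rw [← Real.rpow_mul hm.le, mul_one_div_cancel hp0.ne', Real.rpow_one, Real.mul_rpow (by positivity) (by positivity),
    Real.mul_rpow (by positivity) (by positivity), ← Real.rpow_mul (by positivity), Real.inv_rpow ht.le, ← Real.rpow_neg ht.le,
    Real.inv_rpow hℓ.le, ← Real.rpow_neg hℓ.le] at h4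
  have e1 : -(1:ℝ) / p = -(1 / p) := by ring
  have e2 : -(2 / ((n:ℝ) * p)) = -(2 / (n:ℝ) * (1 / p)) := by field_simp
  rw [e1, e2]
  exact h4

end

/-- Theorem 1.3 of Fila–Winkler.
Under hypothesis (H) and the convexity-type condition (14.1) on `L`, for positive,
radially symmetric, radially nonincreasing initial data `u₀` with
`u₀ < min{s₀^{2/p}, s₀^{2/(p+q₀)}}` and `∫ L(u₀) < ∞`, the minimal solution satisfies
`‖u(·,t)‖_{L^∞} ≤ C t^{-1/p} L(1/t)^{-2/(np)}` for all `t ≥ t₀` (stated pointwise,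
which is equivalent for a continuous function). -/
theorem stmt_9 (n : ℕ) (hn : 1 ≤ n)
    (p s₀ q₀ : ℝ) (hp : 1 ≤ p) (hs₀ : 0 < s₀) (hq₀ : 0 < q₀)
    (L L' L'' : ℝ → ℝ)
    (hLcont : ContinuousOn L (Set.Ici 0))
    (hLderiv : ∀ s ∈ Set.Ioo 0 s₀, HasDerivAt L (L' s) s)
    (hL'deriv : ∀ s ∈ Set.Ioo 0 s₀, HasDerivAt L' (L'' s) s)
    (hL''cont : ContinuousOn L'' (Set.Ioo 0 s₀))
    (hLpos : ∀ s ∈ Set.Ioi (0:ℝ), 0 < L s)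
    (hLmono : MonotoneOn L (Set.Ioi 0))
    (hL0 : L 0 = 0)
    (hH : ∃ a > 0, ∃ lam₀ > 0, ∀ s ∈ Set.Ioo 0 s₀, ∀ l ∈ Set.Ioo 0 lam₀,
      L s ≤ (1 + a * l) * L (s ^ (1 + l)))
    (hLconv : ∀ s ∈ Set.Ioo 0 s₀, s * L'' s ≥ -((3*p + q₀ - 2)/(p + q₀)) * L' s)
    (u₀ : EuclideanSpace ℝ (Fin n) → ℝ)
    (hu₀cont : Continuous u₀) (hu₀pos : ∀ x, 0 < u₀ x)
    (hu₀rad : ∃ w : ℝ → ℝ, AntitoneOn w (Set.Ici 0) ∧ ∀ x, u₀ x = w ‖x‖)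
    (hu₀small : ∀ x, u₀ x < min (s₀ ^ ((2:ℝ)/p)) (s₀ ^ ((2:ℝ)/(p + q₀))))
    (hu₀int : Integrable (fun x => L (u₀ x)) volume)
    (u : EuclideanSpace ℝ (Fin n) → ℝ → ℝ)
    (hu : IsMinimalSol n p u₀ u) :
    ∃ t₀ > (0:ℝ), ∃ C > (0:ℝ), ∀ t ≥ t₀, ∀ x,
      u x t ≤ C * t ^ (-(1:ℝ)/p) * L (1/t) ^ (-(2/((n:ℝ)*p))) := by
  obtain ⟨w, hw, huw⟩ := hu₀rad
  have hp0 : 0 < p := by linarith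
  have hmono : ∀ x y : EuclideanSpace ℝ (Fin n), ‖y‖ ≤ ‖x‖ → u₀ x ≤ u₀ y := fun x y h => by
    rw [huw x, huw y]; exact hw (norm_nonneg y) (norm_nonneg x) h
  have d : Dat p u₀ (u₀ 0) := by
    constructor
    · exact hn
    · exact hp
    · exact hu₀pos 0
    · exact fun x => hmono x 0 (by simp)
    · exact hu₀pos
    · exact hu₀cont
    · exact hmono
  obtain ⟨φ', ψ', h1, h2, h3, h4, h5, h6⟩ := phi_pack hp hs₀ hq₀ L L' L'' hLderiv hL'deriv hL''cont hLmono hLconv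
  have hintegr := d.phi_int hs₀ hLcont hLpos hLmono hH hu₀int
  have hMS : u₀ 0 < s₀ ^ (2 / p) := (hu₀small 0).trans_le (min_le_left _ _)
  set I := ∫ x, L (u₀ x ^ (p / 2)) with hI
  have hI0 : 0 ≤ I := integral_nonneg fun x => (hLpos _ (Real.rpow_pos_of_pos (hu₀pos x) _)).le
  set ω := (volume (ball (0 : EuclideanSpace ℝ (Fin n)) 1)).toReal with hω
  have hω0 : 0 < ω := ENNReal.toReal_pos (measure_ball_pos _ _ one_pos).ne' measure_ball_lt_top.ne
  set A := 4 * (I + 1) / ω with hA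
  have hA0 : 0 < A := by positivity
  set c : ℝ := 4 ^ (-p) / 4 with hc
  have hc0 : 0 < c := by positivity
  obtain ⟨δ, hδ, hδ'⟩ : ∃ δ > 0, ∀ s, 0 < s → s < δ → L s ≤ 1 := by
    obtain ⟨δ, hδ, h⟩ := Metric.continuousWithinAt_iff.1 (hLcont 0 (by simp)) 1 one_pos
    refine ⟨δ, hδ, fun s hs hsd => ?_⟩
    have := h (show s ∈ Set.Ici 0 from hs.le) (by rw [Real.dist_eq, sub_zero, abs_of_pos hs]; exact hsd)
    rw [Real.dist_eq, hL0, sub_zero] at this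
    exact (le_abs_self _).trans this.le
  set C₁ := (A ^ (2 / (n:ℝ)) / c) ^ (1 / p) with hC₁
  have hC₁0 : 0 < C₁ := by positivity
  refine ⟨max 1 (2 / δ), by positivity, max 4 C₁, by positivity, fun t ht x => ?_⟩
  have ht1 : 1 ≤ t := (le_max_left _ _).trans ht
  have ht2 : 2 / δ ≤ t := (le_max_right _ _).trans ht
  have ht0 : 0 < t := by linarith
  refine ((d.min_le hu x ht0).trans (d.mono (y := 0) (by simp) ht0)).trans ?_
  set m := vv p u₀ 0 t with hm
  have hm0 : 0 < m := d.pos 0 ht0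
  have hℓ0 : 0 < L (1 / t) := hLpos _ (show (0:ℝ) < 1 / t by positivity)
  have hℓ1 : L (1 / t) ≤ 1 := hδ' _ (by positivity) (by
    rw [div_lt_iff₀ ht0]
    rw [div_le_iff₀ hδ] at ht2
    linarith)
  have hℓe : 1 ≤ L (1 / t) ^ (-(2 / ((n:ℝ) * p))) :=
    Real.one_le_rpow_of_pos_of_le_one_of_nonpos hℓ0 hℓ1 (by rw [neg_nonpos]; positivity)
  by_cases hsm : m ≤ 4 * t ^ (-(1:ℝ) / p)
  · calc m ≤ 4 * t ^ (-(1:ℝ) / p) := hsm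
      _ ≤ max 4 C₁ * t ^ (-(1:ℝ) / p) := by gcongr; exact le_max_left _ _
      _ ≤ _ := le_mul_of_one_le_right (by positivity) hℓe
  push Not at hsm
  have hLm : L (1 / t) ≤ L ((m / 4) ^ (p / 2)) := by
    refine hLmono (show (0:ℝ) < 1 / t by positivity) (Real.rpow_pos_of_pos (by positivity) _) ?_
    have e1 : t ^ (-(1:ℝ) / p) ≤ m / 4 := by linarith
    have e2 := Real.rpow_le_rpow (by positivity) e1 (show 0 ≤ p / 2 by positivity)
    refine le_trans ?_ e2
    rw [← Real.rpow_mul ht0.le, one_div, ← Real.rpow_neg_one]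
    refine Real.rpow_le_rpow_of_exponent_le ht1 ?_
    have : -(1:ℝ) / p * (p / 2) = -(1/2) := by field_simp
    rw [this]; norm_num
  obtain ⟨e, he⟩ := d.exists_unit
  set ρ := √(c * t * m ^ p) with hρ
  have hρ0 : 0 < ρ := by positivity
  have hρ2 : ρ ^ 2 = c * t * m ^ p := Real.sq_sqrt (by positivity)
  have hne : ‖ρ • e‖ = ρ := by rw [norm_smul, he, mul_one, Real.norm_of_nonneg hρ0.le]
  obtain ⟨s, hs, hvs⟩ := d.spread ht0 (x := ρ • e) (by rw [hne, hρ2])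
  have hs0 : 0 < s := by linarith [hs.1]
  have hmass := d.mass hMS (φ := fun s => L (s ^ (p / 2))) h1 h2
    (fun s hs => (hLpos _ (Real.rpow_pos_of_pos hs.1 _)).le) h3 h4 h5 h6 hintegr hs0 hρ0 (m := m / 4) (by positivity)
    (fun y hy => hvs.trans (d.mono (by rw [hne]; exact hy) hs0))
  have hfin : ρ ^ n * L (1 / t) ≤ A := by
    rw [hA, le_div_iff₀ hω0]
    have : ρ ^ n * L (1 / t) * ω ≤ ρ ^ n * L ((m / 4) ^ (p / 2)) * ω := by gcongr
    have hm2 : 1 / 4 * L ((m / 4) ^ (p / 2)) * (ρ ^ n * ω) ≤ I := hmass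
    linarith
  refine (final_alg hn hp hc0 ht0 hm0 hℓ0 hA0 hρ0.le hρ2 hfin).trans ?_
  gcongr
  exact le_max_right _ _
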